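/- arXiv:2406.05861 — 3 statements merged into one kernel-verified Lean document; each statement's English description precedes it below -/
import Mathlib

section
/- Let Q be a simple quadrilateral in the Euclidean plane with vertices v1 = (0,0), v5 = (x5, 0) with 1 ≤ x5 < 2, and two further vertices v6 and v7 lying in the open upper half-plane, appearing in the boundary order (v1, v5, v6, v7), such that v7 is reflex in Q and the pairwise geodesic distances in Q between the four vertices are all at least 1. Then the geodesic distance in Q from v6 to the segment S = [v1, v5] (the infimum over points s ∈ S of the geodesic distance from v6 to s in Q) is at least √3/2. -/
open Set Metric
open scoped ENNReal

noncomputable section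

/-- The Euclidean plane. -/
abbrev Plane : Type := EuclideanSpace ℝ (Fin 2)

/-- A *simple polygon*: the compact region of the plane bounded by a simple
closed polygonal curve, together with the cyclic sequence of vertices of that
curve.  The field `carrier` is the region (boundary included); the field
`frontier_eq` states that the topological boundary of the region is exactly
the closed polygonal curve through the vertices, and the fields
`edges_adjacent`/`edges_disjoint` state that this curve is simple. -/
structure SimplePolygon where
  /-- the number of vertices -/
  n : ℕ
  /-- a polygon has at least three vertices -/
  three_le : 3 ≤ n
  /-- the vertices, in cyclic order along the boundary curve -/
  vertex : ZMod n → Plane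
  /-- the compact region bounded by the polygonal curve -/
  carrier : Set Plane
  isCompact : IsCompact carrier
  isConnected : IsConnected carrier
  /-- the region is the closure of its interior (it is a genuine
  two-dimensional region) -/
  regular : carrier = closure (interior carrier)
  /-- the topological boundary of the region is the union of the edges of the
  closed polygonal curve through the vertices -/
  frontier_eq : frontier carrier = ⋃ i : ZMod n, segment ℝ (vertex i) (vertex (i + 1))
  /-- the vertices are pairwise distinct -/
  vertex_injective : Function.Injective vertex
  /-- consecutive edges of the curve meet exactly in their common vertex -/
  edges_adjacent : ∀ i : ZMod n,
    segment ℝ (vertex i) (vertex (i + 1)) ∩ segment ℝ (vertex (i + 1)) (vertex (i + 2)) =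
      {vertex (i + 1)}
  /-- non-adjacent edges of the curve are disjoint -/
  edges_disjoint : ∀ i j : ZMod n, i ≠ j → i + 1 ≠ j → j + 1 ≠ i →
    Disjoint (segment ℝ (vertex i) (vertex (i + 1))) (segment ℝ (vertex j) (vertex (j + 1)))

/-- The geodesic distance between `p` and `q` inside the set `P`: the infimum
of the lengths (total variations) of continuous paths from `p` to `q` staying
in `P`.  (Non-rectifiable paths have length `∞` and hence do not contribute.) -/
def geodesicDist (P : Set Plane) (p q : Plane) : ℝ≥0∞ :=
  ⨅ (γ : ℝ → Plane) (_ : ContinuousOn γ (Icc 0 1)) (_ : γ 0 = p) (_ : γ 1 = q)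
    (_ : MapsTo γ (Icc 0 1) P), eVariationOn γ (Icc 0 1)

/-- `p` sees `q` within `P` if the closed segment `[p,q]` is contained in `P`. -/
def Sees (P : Set Plane) (p q : Plane) : Prop :=
  segment ℝ p q ⊆ P

/-- `G` is a guard set for `P` if `G ⊆ P` and every point of `P` is seen by
some point of `G`. -/
def IsGuardSet (P : Set Plane) (G : Set Plane) : Prop :=
  G ⊆ P ∧ ∀ x ∈ P, ∃ g ∈ G, Sees P g x

/-- A vertex guard set of a simple polygon: a guard set consisting of
vertices of the polygon. -/
def SimplePolygon.IsVertexGuardSet (P : SimplePolygon) (G : Set Plane) : Prop :=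
  G ⊆ Set.range P.vertex ∧ IsGuardSet P.carrier G

/-- The dispersion distance of a guard set `G` in `P`: the infimum of the
geodesic distances between pairs of distinct guards. -/
def dispersionDist (P : Set Plane) (G : Set Plane) : ℝ≥0∞ :=
  ⨅ (g : Plane) (_ : g ∈ G) (h : Plane) (_ : h ∈ G) (_ : g ≠ h), geodesicDist P g h

/-- The vertex `P.vertex i` is *reflex* (interior angle strictly greater than
`180°`): sufficiently close to the vertex, the segment joining a point of the
incoming edge to a point of the outgoing edge (both distinct from the vertex)
always leaves the polygon. -/
def SimplePolygon.IsReflexAt (P : SimplePolygon) (i : ZMod P.n) : Prop :=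
  ∃ δ > (0 : ℝ), ∀ a ∈ segment ℝ (P.vertex (i - 1)) (P.vertex i),
    ∀ c ∈ segment ℝ (P.vertex i) (P.vertex (i + 1)),
      a ≠ P.vertex i → c ≠ P.vertex i →
      dist a (P.vertex i) < δ → dist c (P.vertex i) < δ →
      ¬ segment ℝ a c ⊆ P.carrier

/-- The vertices of `P` are labeled in counterclockwise order: the shoelace
signed area of the vertex cycle is positive. -/
def SimplePolygon.IsCCW (P : SimplePolygon) : Prop :=
  0 < ∑ i ∈ Finset.range P.n,
    (P.vertex (i : ZMod P.n) 0 * P.vertex ((i : ZMod P.n) + 1) 1 -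
      P.vertex ((i : ZMod P.n) + 1) 0 * P.vertex (i : ZMod P.n) 1)


theorem le_of_sq_le_sq_aux {a b : ℝ} (h : a ^ 2 ≤ b ^ 2) (hb : 0 ≤ b) : a ≤ b := by
  nlinarith

/-- The geodesic distance is at most the Euclidean one when the segment is contained in the set. -/
theorem geodesicDist_le_of_segment (K : Set Plane) (p q : Plane) (h : segment ℝ p q ⊆ K) :
    geodesicDist K p q ≤ edist p q := by
  unfold geodesicDist
  refine iInf_le_of_le (fun t => AffineMap.lineMap p q t) ?_
  refine iInf_le_of_le (by fun_prop) ?_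
  refine iInf_le_of_le (by simp) ?_
  refine iInf_le_of_le (by simp) ?_
  refine iInf_le_of_le ?_ ?_
  · intro t ht
    apply h
    rw [segment_eq_image_lineMap]
    exact ⟨t, ht, rfl⟩
  · have h1 := ((lipschitzWith_lineMap (𝕜 := ℝ) p q).lipschitzOnWith (s := univ)).comp_eVariationOn_le (g := (id : ℝ → ℝ)) (s := Icc 0 1) (mapsTo_univ _ _)
    have h2 : eVariationOn (id : ℝ → ℝ) (Icc 0 1) ≤ ENNReal.ofReal (1 - 0) := by
      have := (monotone_id.monotoneOn (Icc (0:ℝ) 1)).eVariationOn_eq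
        (left_mem_Icc.2 zero_le_one) (right_mem_Icc.2 zero_le_one)
      rw [inter_self] at this
      exact this.le
    have h3 : ((nndist p q : NNReal) : ℝ≥0∞) = edist p q := (edist_nndist p q).symm
    calc _ ≤ (nndist p q : ℝ≥0∞) * eVariationOn (id : ℝ → ℝ) (Icc 0 1) := h1
      _ ≤ (nndist p q : ℝ≥0∞) * ENNReal.ofReal (1 - 0) := by gcongr
      _ = edist p q := by rw [h3]; simp

theorem plane_dist_sq (p q : Plane) : dist p q ^ 2 = (p 0 - q 0) ^ 2 + (p 1 - q 1) ^ 2 := by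
  rw [EuclideanSpace.dist_eq, Real.sq_sqrt (by positivity)]
  simp [Fin.sum_univ_two, Real.dist_eq, sq_abs]

theorem one_le_of_geodesic (K : Set Plane) (p q : Plane) (h : segment ℝ p q ⊆ K)
    (h1 : 1 ≤ geodesicDist K p q) : 1 ≤ (p 0 - q 0) ^ 2 + (p 1 - q 1) ^ 2 := by
  have h2 := h1.trans (geodesicDist_le_of_segment K p q h)
  rw [edist_dist] at h2
  have h3 : 1 ≤ dist p q := by simpa using h2
  rw [← plane_dist_sq]
  nlinarith

theorem ofReal_le_edist (r : ℝ) (p q : Plane)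
    (h1 : r ^ 2 ≤ (p 0 - q 0) ^ 2 + (p 1 - q 1) ^ 2) : ENNReal.ofReal r ≤ edist p q := by
  rw [edist_dist]
  apply ENNReal.ofReal_le_ofReal
  rw [← plane_dist_sq] at h1
  exact le_of_sq_le_sq_aux h1 dist_nonneg

/-- Coordinates of a point on a segment. -/
theorem segment_coords {p q z : Plane} (h : z ∈ segment ℝ p q) :
    ∃ s t : ℝ, 0 ≤ s ∧ 0 ≤ t ∧ s + t = 1 ∧ z 0 = s * p 0 + t * q 0 ∧ z 1 = s * p 1 + t * q 1 := by
  obtain ⟨s, t, hs, ht, hst, rfl⟩ := h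
  exact ⟨s, t, hs, ht, hst, by simp, by simp⟩

theorem mem_segment_of_coords {p q z : Plane} (s t : ℝ) (hs : 0 ≤ s) (ht : 0 ≤ t) (hst : s + t = 1)
    (h0 : z 0 = s * p 0 + t * q 0) (h1 : z 1 = s * p 1 + t * q 1) : z ∈ segment ℝ p q := by
  refine ⟨s, t, hs, ht, hst, ?_⟩
  ext i
  fin_cases i <;> simp [h0, h1]

/-- Affine functionals that are bounded below at the end points are so on the segment. -/
theorem segment_le {p q z : Plane} (h : z ∈ segment ℝ p q) (α β c : ℝ)
    (hp : c ≤ α * p 0 + β * p 1) (hq : c ≤ α * q 0 + β * q 1) : c ≤ α * z 0 + β * z 1 := by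
  obtain ⟨s, t, hs, ht, hst, h0, h1⟩ := segment_coords h
  rw [h0, h1]
  have : c = s * c + t * c := by rw [← add_mul, hst, one_mul]
  nlinarith [mul_le_mul_of_nonneg_left hp hs, mul_le_mul_of_nonneg_left hq ht]

theorem segment_lt {p q z : Plane} (h : z ∈ segment ℝ p q) (α β c : ℝ)
    (hp : c < α * p 0 + β * p 1) (hq : c < α * q 0 + β * q 1) : c < α * z 0 + β * z 1 := by
  obtain ⟨s, t, hs, ht, hst, h0, h1⟩ := segment_coords h
  have := segment_le h α β (min (α * p 0 + β * p 1) (α * q 0 + β * q 1))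
    (min_le_left _ _) (min_le_right _ _)
  exact (lt_min hp hq).trans_le this

theorem inter_frontier_nonempty_aux {K T : Set Plane} (hT : IsPreconnected T) (hK : IsClosed K)
    (h1 : (T ∩ K).Nonempty) (h2 : (T ∩ Kᶜ).Nonempty) : (T ∩ frontier K).Nonempty := by
  by_contra hne
  rw [not_nonempty_iff_eq_empty] at hne
  have key : ∀ z ∈ T, z ∈ K → z ∈ interior K := by
    intro z hz hzK
    by_contra hzi
    have : z ∈ T ∩ frontier K := ⟨hz, by rw [hK.frontier_eq]; exact ⟨hzK, hzi⟩⟩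
    rw [hne] at this
    exact this
  obtain ⟨p, hp, hpK⟩ := h1
  obtain ⟨w, -, hw1, hw2⟩ := hT (interior K) Kᶜ isOpen_interior hK.isOpen_compl
    (fun z hz => (em (z ∈ K)).imp (key z hz) id) ⟨p, hp, key p hp hpK⟩ h2
  exact hw2 (interior_subset hw1)

/-- A point from which some ray avoids the frontier of a compact set is not in that set. -/
theorem notMem_of_ray {K : Set Plane} (hK : IsCompact K) (q d : Plane) (hd : d ≠ 0)
    (h : ∀ t : ℝ, 0 ≤ t → q + t • d ∉ frontier K) : q ∉ K := by
  intro hq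
  have hc : IsPreconnected ((fun t : ℝ => q + t • d) '' Ici 0) :=
    isPreconnected_Ici.image _ (by fun_prop)
  by_cases hs : ((fun t : ℝ => q + t • d) '' Ici 0) ⊆ K
  · have hb := hK.isBounded.subset hs
    obtain ⟨C, hC⟩ := hb.exists_norm_le
    have hdp : 0 < ‖d‖ := norm_pos_iff.2 hd
    have hCn : 0 ≤ C := (norm_nonneg _).trans (hC _ ⟨0, by simp, rfl⟩)
    have ht : 0 ≤ (C + ‖q‖ + 1) / ‖d‖ := by positivity
    have h1 := hC _ ⟨(C + ‖q‖ + 1) / ‖d‖, ht, rfl⟩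
    have h2 : ‖((C + ‖q‖ + 1) / ‖d‖) • d‖ = C + ‖q‖ + 1 := by
      rw [norm_smul, Real.norm_of_nonneg ht]; field_simp
    have h3 : ‖((C + ‖q‖ + 1) / ‖d‖) • d‖ ≤ ‖q + ((C + ‖q‖ + 1) / ‖d‖) • d‖ + ‖q‖ := by
      have := norm_sub_le (q + ((C + ‖q‖ + 1) / ‖d‖) • d) q
      simpa using this
    simp only at h1
    linarith
  · obtain ⟨z, hz, hzK⟩ := not_subset.1 hs
    obtain ⟨w, ⟨t, ht, rfl⟩, hw2⟩ := inter_frontier_nonempty_aux hc hK.isClosed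
      ⟨q, ⟨0, by simp, by simp⟩, hq⟩ ⟨z, hz, hzK⟩
    exact h t ht hw2

/-- The numeric core. -/
theorem numeric_core (X a b x y : ℝ) (hX : X < 2) (haX : a < X) (hxa : x ≤ a) (hx : 0 < x)
    (hy : 0 < y) (hyb : y < b) (hb : b ^ 2 < 3 / 4) (h65 : 1 ≤ (a - X) ^ 2 + b ^ 2)
    (h7 : 1 ≤ x ^ 2 + y ^ 2) (h67 : 1 ≤ (a - x) ^ 2 + (b - y) ^ 2) : False := by
  have ha : a < 3 / 2 := by nlinarith
  have hx2 : 1 / 2 < x := by nlinarith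
  have hax : 1 / 2 < a - x := by nlinarith
  have hx1 : x < 1 := by linarith
  set s := Real.sqrt (1 - x ^ 2) with hs
  have hs0 : 0 ≤ s := Real.sqrt_nonneg _
  have hs2 : s ^ 2 = 1 - x ^ 2 := Real.sq_sqrt (by nlinarith)
  set r := Real.sqrt 3 with hr
  have hr0 : 0 ≤ r := Real.sqrt_nonneg _
  have hr2 : r ^ 2 = 3 := Real.sq_sqrt (by norm_num)
  have hsy : s ≤ y := le_of_sq_le_sq_aux (by linarith) hy.le
  have hbr : b ≤ r / 2 := le_of_sq_le_sq_aux (by rw [div_pow, hr2]; linarith) (by positivity)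
  have e1 : (b - y) ^ 2 ≤ (r / 2 - s) ^ 2 := by
    apply pow_le_pow_left₀ <;> linarith
  have e2 : (a - x) ^ 2 < (3 / 2 - x) ^ 2 := by
    apply pow_lt_pow_left₀ (by linarith) (by linarith) (by norm_num)
  -- `r * s ≥ 3 * (1 - x)`
  have e3 : (3 * (1 - x)) ^ 2 ≤ (r * s) ^ 2 := by
    rw [mul_pow r, hr2, hs2]
    have := mul_nonneg (sub_nonneg.2 hx1.le) (show (0 : ℝ) ≤ 4 * x - 2 by linarith)
    linarith
  have e4 : 3 * (1 - x) ≤ r * s := by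
    exact le_of_sq_le_sq_aux e3 (by positivity)
  have e5 : (3 / 2 - x) ^ 2 + (r / 2 - s) ^ 2 = 9 / 4 - 3 * x + x ^ 2 + r ^ 2 / 4 - r * s + s ^ 2 := by
    ring
  rw [hr2, hs2] at e5
  linarith

/-- The quadrilateral data, in a form free of `ZMod` indices. -/
structure QuadData (K : Set Plane) (v1 v5 v6 v7 : Plane) (X : ℝ) : Prop where
  cpt : IsCompact K
  reg : K = closure (interior K)
  fr : ∀ z, z ∈ frontier K ↔ z ∈ segment ℝ v1 v5 ∨ z ∈ segment ℝ v5 v6 ∨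
    z ∈ segment ℝ v6 v7 ∨ z ∈ segment ℝ v7 v1
  disj : ∀ z, z ∈ segment ℝ v5 v6 → z ∈ segment ℝ v7 v1 → False
  X1 : 1 ≤ X
  v1x : v1 0 = 0
  v1y : v1 1 = 0
  v5x : v5 0 = X
  v5y : v5 1 = 0
  v6y : 0 < v6 1
  v7y : 0 < v7 1
  ne67 : v6 ≠ v7
  reflex : ∃ δ > (0 : ℝ), ∀ a ∈ segment ℝ v6 v7, ∀ c ∈ segment ℝ v7 v1,
      a ≠ v7 → c ≠ v7 → dist a v7 < δ → dist c v7 < δ → ¬ segment ℝ a c ⊆ K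

section
variable {K : Set Plane} {v1 v5 v6 v7 : Plane} {X : ℝ}

theorem QuadData.fr_sub (h : QuadData K v1 v5 v6 v7 X) {z : Plane} (hz : z ∈ frontier K) : z ∈ K :=
  h.cpt.isClosed.frontier_subset hz

/-- Convenient points near `v7` on the two incident edges. -/
theorem QuadData.exists_near (h : QuadData K v1 v5 v6 v7 X) :
    ∃ ε : ℝ, 0 < ε ∧ ε < 1 ∧ ∃ a c : Plane,
      a 0 = ε * v6 0 + (1 - ε) * v7 0 ∧ a 1 = ε * v6 1 + (1 - ε) * v7 1 ∧
      c 0 = (1 - ε) * v7 0 ∧ c 1 = (1 - ε) * v7 1 ∧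
      a ∈ segment ℝ v6 v7 ∧ c ∈ segment ℝ v7 v1 ∧ ¬ segment ℝ a c ⊆ K := by
  obtain ⟨δ, hδ, hr⟩ := h.reflex
  have h71 : v7 ≠ v1 := by
    intro e
    have := h.v7y
    rw [e, h.v1y] at this
    exact lt_irrefl _ this
  set M := dist v6 v7 + dist v1 v7 + 1 with hM
  have hM0 : 0 < M := by positivity
  obtain ⟨ε, hε0, hε1⟩ : ∃ ε : ℝ, 0 < ε ∧ ε < min 1 (δ / M) :=
    exists_between (lt_min one_pos (by positivity))
  have hεlt : ε < 1 := hε1.trans_le (min_le_left _ _)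
  have hεM : ε * M < δ := by
    have := hε1.trans_le (min_le_right _ _)
    rwa [lt_div_iff₀ hM0] at this
  have hd : ∀ w : Plane, w ≠ v7 → AffineMap.lineMap v7 w ε ≠ v7 := by
    intro w hw e
    rw [AffineMap.lineMap_eq_left_iff] at e
    rcases e with e | e
    · exact hw e.symm
    · exact hε0.ne' e
  have hdd : ∀ w : Plane, dist w v7 < M → dist (AffineMap.lineMap v7 w ε : Plane) v7 < δ := by
    intro w hw
    rw [dist_lineMap_left, Real.norm_of_nonneg hε0.le, dist_comm]
    nlinarith
  have hseg : ∀ w : Plane, (AffineMap.lineMap v7 w ε : Plane) ∈ segment ℝ v7 w := by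
    intro w
    rw [segment_eq_image_lineMap]
    exact ⟨ε, ⟨hε0.le, hεlt.le⟩, rfl⟩
  refine ⟨ε, hε0, hεlt, AffineMap.lineMap v7 v6 ε, AffineMap.lineMap v7 v1 ε, ?_, ?_, ?_, ?_, ?_⟩
  · simp [AffineMap.lineMap_apply]; ring
  · simp [AffineMap.lineMap_apply]; ring
  · simp [AffineMap.lineMap_apply, h.v1x]; ring
  · simp [AffineMap.lineMap_apply, h.v1y]; ring
  · have ha : (AffineMap.lineMap v7 v6 ε : Plane) ∈ segment ℝ v6 v7 := by
      rw [segment_symm]; exact hseg v6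
    refine ⟨ha, hseg v1, hr _ ha _ (hseg v1) (hd _ h.ne67) (hd _ h71.symm)
      (hdd _ ?_) (hdd _ ?_)⟩
    · rw [hM]; have := dist_nonneg (x := v1) (y := v7); linarith
    · rw [hM]; have := dist_nonneg (x := v6) (y := v7); linarith

/-- `v7` cannot lie on the line `v1 v6`. -/
theorem QuadData.not_collinear (h : QuadData K v1 v5 v6 v7 X)
    (h0 : v6 0 * v7 1 = v6 1 * v7 0) : False := by
  have hb := h.v6y
  have hy := h.v7y
  rcases le_or_gt (v6 1) (v7 1) with hle | hlt
  · refine h.disj v6 (right_mem_segment _ _ _) ?_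
    refine mem_segment_of_coords (v6 1 / v7 1) (1 - v6 1 / v7 1) (by positivity) ?_ (by ring) ?_ ?_
    · rw [sub_nonneg, div_le_one hy]; exact hle
    · rw [h.v1x]; field_simp; linarith
    · rw [h.v1y]; field_simp; ring
  · obtain ⟨ε, hε0, hε1, a, c, ha0, ha1, hc0, hc1, ha, hc, hns⟩ := h.exists_near
    apply hns
    intro z hz
    have e1 := segment_le hz (v7 1) (-(v7 0)) 0
      (by rw [ha0, ha1]; nlinarith) (by rw [hc0, hc1]; nlinarith)
    have e2 := segment_le hz (-(v7 1)) ((v7 0)) 0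
      (by rw [ha0, ha1]; nlinarith) (by rw [hc0, hc1]; nlinarith)
    have e3 : z 0 * v7 1 = z 1 * v7 0 := by linarith
    have e4 := segment_le hz 0 1 0 (by rw [ha1]; nlinarith) (by rw [hc1]; nlinarith)
    have e5 := segment_le hz 0 (-1) (-(v6 1)) (by rw [ha1]; nlinarith) (by rw [hc1]; nlinarith)
    have e6 : 0 ≤ z 1 := by linarith
    have e7 : z 1 ≤ v6 1 := by linarith
    have e8 : z 0 = z 1 * v7 0 / v7 1 := by rw [← e3]; field_simp
    have e9 : v6 0 = v6 1 * v7 0 / v7 1 := by rw [← h0]; field_simp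
    apply h.fr_sub
    rw [h.fr]
    rcases le_or_gt (z 1) (v7 1) with hz1 | hz1
    · right; right; right
      refine mem_segment_of_coords (z 1 / v7 1) (1 - z 1 / v7 1) (by positivity) ?_ (by ring) ?_ ?_
      · rw [sub_nonneg, div_le_one hy]; exact hz1
      · rw [h.v1x, e8]; field_simp; ring
      · rw [h.v1y]; field_simp; ring
    · right; right; left
      have hp : 0 < v6 1 - v7 1 := by linarith
      refine mem_segment_of_coords ((z 1 - v7 1) / (v6 1 - v7 1)) ((v6 1 - z 1) / (v6 1 - v7 1))
        (div_nonneg (by linarith) hp.le) (div_nonneg (by linarith) hp.le) ?_ ?_ ?_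
      · field_simp; ring
      · rw [e8, e9]; field_simp; ring
      · field_simp; ring

/-- `v7` cannot lie to the left of the ray `v1 v6`. -/
theorem QuadData.not_left (h : QuadData K v1 v5 v6 v7 X)
    (h0 : v6 1 * v7 0 < v6 0 * v7 1) : False := by
  have hb := h.v6y
  have hy := h.v7y
  have hX : 0 < X := lt_of_lt_of_le one_pos h.X1
  obtain ⟨ε, hε0, hε1, a, c, ha0, ha1, hc0, hc1, ha, hc, hns⟩ := h.exists_near
  set D := v6 0 * v7 1 - v6 1 * v7 0 with hD
  have hDpos : 0 < D := by linarith
  -- points of the frontier lie to the right of `v1 v7`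
  have hright : ∀ z ∈ frontier K, 0 ≤ v7 1 * z 0 + (-(v7 0)) * z 1 := by
    intro z hz
    have p1 : 0 ≤ v7 1 * v1 0 + (-(v7 0)) * v1 1 := by rw [h.v1x, h.v1y]; simp
    have p5 : 0 ≤ v7 1 * v5 0 + (-(v7 0)) * v5 1 := by rw [h.v5x, h.v5y]; nlinarith
    have p6 : 0 ≤ v7 1 * v6 0 + (-(v7 0)) * v6 1 := by linarith
    have p7 : 0 ≤ v7 1 * v7 0 + (-(v7 0)) * v7 1 := by linarith
    rcases (h.fr z).1 hz with e | e | e | e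
    · exact segment_le e _ _ _ p1 p5
    · exact segment_le e _ _ _ p5 p6
    · exact segment_le e _ _ _ p6 p7
    · exact segment_le e _ _ _ p7 p1
  -- points strictly to the left are not in `K`
  have hout : ∀ z : Plane, v7 1 * z 0 - v7 0 * z 1 < 0 → z ∉ K := by
    intro z hz
    refine notMem_of_ray h.cpt z (!₂[-1, 0]) ?_ ?_
    · intro e
      have := congrArg (fun p : Plane => p 0) e
      simp at this
    · intro t ht hf
      have := hright _ hf
      simp at this
      nlinarith
  -- the open triangle
  have hT : ∀ z : Plane, 0 < v7 1 * z 0 + (-(v7 0)) * z 1 → 0 < (-(v6 1)) * z 0 + v6 0 * z 1 →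
      -D < (v6 1 - v7 1) * z 0 + (v7 0 - v6 0) * z 1 → z ∉ frontier K := by
    intro z h1 h2 h3 hz
    rcases (h.fr z).1 hz with e | e | e | e
    · have := segment_le e (v6 1) (-(v6 0)) 0 (by rw [h.v1x, h.v1y]; simp)
        (by rw [h.v5x, h.v5y]; nlinarith)
      linarith
    · have := segment_le e (v6 1) (-(v6 0)) 0
        (by rw [h.v5x, h.v5y]; nlinarith) (by linarith)
      linarith
    · have := segment_le e (-(v6 1 - v7 1)) (-(v7 0 - v6 0)) D (by rw [hD]; linarith)
        (by rw [hD]; linarith)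
      linarith
    · have := segment_le e (-(v7 1)) (v7 0) 0 (by linarith) (by rw [h.v1x, h.v1y]; simp)
      linarith
  -- an interior point inside the open triangle
  obtain ⟨p, hpK, hp1, hp2, hp3⟩ : ∃ p ∈ K, 0 < v7 1 * p 0 + (-(v7 0)) * p 1 ∧
      0 < (-(v6 1)) * p 0 + v6 0 * p 1 ∧
      -D < (v6 1 - v7 1) * p 0 + (v7 0 - v6 0) * p 1 := by
    have hm : (1 / 2 : ℝ) • v7 ∈ closure (interior K) := by
      rw [← h.reg]
      apply h.fr_sub
      rw [h.fr]
      right; right; right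
      refine mem_segment_of_coords (1 / 2) (1 / 2) (by norm_num) (by norm_num) (by norm_num) ?_ ?_
      · simp [h.v1x]
      · simp [h.v1y]
    have hopen : IsOpen {p : Plane | 0 < (-(v6 1)) * p 0 + v6 0 * p 1 ∧
        -D < (v6 1 - v7 1) * p 0 + (v7 0 - v6 0) * p 1} := by
      have i1 : IsOpen {p : Plane | 0 < (-(v6 1)) * p 0 + v6 0 * p 1} :=
        isOpen_lt (by fun_prop) (by fun_prop)
      have i2 : IsOpen {p : Plane | -D < (v6 1 - v7 1) * p 0 + (v7 0 - v6 0) * p 1} :=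
        isOpen_lt (by fun_prop) (by fun_prop)
      exact i1.inter i2
    obtain ⟨p, ⟨hp2, hp3⟩, hpi⟩ := mem_closure_iff.1 hm _ hopen
      ⟨by simp; linarith, by simp; linarith⟩
    refine ⟨p, interior_subset hpi, ?_, hp2, hp3⟩
    by_contra hcon
    rcases (not_lt.1 hcon).lt_or_eq with hl | he
    · exact hout p (by linarith) (interior_subset hpi)
    · have hfr : p ∈ frontier K := by
        have e3 : p 0 = p 1 * v7 0 / v7 1 := by field_simp; linarith
        rw [h.fr]
        right; right; right
        have q1 : 0 < p 1 * D := by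
          have : p 1 * D = v7 1 * (-(v6 1) * p 0 + v6 0 * p 1) := by rw [e3, hD]; field_simp; ring
          rw [this]; positivity
        have q2 : 0 < p 1 := by
          by_contra hq; nlinarith
        have q3 : p 1 ≤ v7 1 := by
          have : (v7 1 - p 1) * D =
              v7 1 * (((v6 1 - v7 1) * p 0 + (v7 0 - v6 0) * p 1) + D) := by
            rw [e3, hD]; field_simp; ring
          have h' : 0 < (v7 1 - p 1) * D := by
            rw [this]; exact mul_pos hy (by linarith)
          by_contra hq; nlinarith
        refine mem_segment_of_coords (p 1 / v7 1) (1 - p 1 / v7 1) (by positivity) ?_ (by ring) ?_ ?_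
        · rw [sub_nonneg, div_le_one hy]; exact q3
        · rw [h.v1x, e3]; field_simp; ring
        · rw [h.v1y]; field_simp; ring
      exact hfr.2 hpi
  apply hns
  intro z hz
  by_contra hzK
  obtain ⟨s, t, hs, ht, hst, hz0, hz1⟩ := segment_coords hz
  have hs0 : 0 < s := by
    rcases hs.lt_or_eq with hs | hs
    · exact hs
    · exfalso; apply hzK
      have : t = 1 := by linarith
      have : z = c := by
        ext i; fin_cases i
        · simp [hz0, ← hs, this]
        · simp [hz1, ← hs, this]
      rw [this]; apply h.fr_sub; rw [h.fr]; tauto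
  have ht0 : 0 < t := by
    rcases ht.lt_or_eq with ht | ht
    · exact ht
    · exfalso; apply hzK
      have : s = 1 := by linarith
      have : z = a := by
        ext i; fin_cases i
        · simp [hz0, ← ht, this]
        · simp [hz1, ← ht, this]
      rw [this]; apply h.fr_sub; rw [h.fr]; tauto
  have z1 : 0 < v7 1 * z 0 + (-(v7 0)) * z 1 := by
    have : v7 1 * z 0 + (-(v7 0)) * z 1 = s * ε * D := by
      rw [hz0, hz1, ha0, ha1, hc0, hc1, hD]; ring
    rw [this]; positivity
  have hε' : 0 < 1 - ε := by linarith
  have z2 : 0 < (-(v6 1)) * z 0 + v6 0 * z 1 := by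
    have : (-(v6 1)) * z 0 + v6 0 * z 1 = (s + t) * (1 - ε) * D := by
      rw [hz0, hz1, ha0, ha1, hc0, hc1, hD]; ring
    rw [this]; positivity
  have z3 : -D < (v6 1 - v7 1) * z 0 + (v7 0 - v6 0) * z 1 := by
    have : (v6 1 - v7 1) * z 0 + (v7 0 - v6 0) * z 1 = -((s + t) * D) + t * ε * D := by
      rw [hz0, hz1, ha0, ha1, hc0, hc1, hD]; ring
    rw [this, hst]
    have : 0 < t * ε * D := by positivity
    linarith
  obtain ⟨w, hw, hwf⟩ := inter_frontier_nonempty_aux (convex_segment p z).isPreconnected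
    h.cpt.isClosed ⟨p, left_mem_segment _ _ _, hpK⟩ ⟨z, right_mem_segment _ _ _, hzK⟩
  exact hT w (segment_lt hw _ _ _ hp1 z1) (segment_lt hw _ _ _ hp2 z2)
    (segment_lt hw _ _ _ hp3 z3) hwf

theorem QuadData.right_ray (h : QuadData K v1 v5 v6 v7 X) :
    v6 0 * v7 1 < v6 1 * v7 0 := by
  rcases lt_trichotomy (v6 0 * v7 1) (v6 1 * v7 0) with e | e | e
  · exact e
  · exact (h.not_collinear e).elim
  · exact (h.not_left e).elim

/-- `v7` lies strictly to the left of the line `v5 v6`. -/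
theorem QuadData.left_line (h : QuadData K v1 v5 v6 v7 X) :
    0 < (v6 0 - X) * v7 1 - v6 1 * (v7 0 - X) := by
  by_contra hcon
  have hb := h.v6y
  have hy := h.v7y
  have hX : 0 < X := lt_of_lt_of_le one_pos h.X1
  have hr := h.right_ray
  set E := v6 1 * v7 0 - v6 0 * v7 1 + X * v7 1 with hE
  have hyX : 0 < X * v7 1 := by positivity
  have hE0 : 0 < E := by linarith
  have hEle : X * v6 1 ≤ E := by linarith
  -- intersection point is `(X * v6 1 / E) • v7`
  have hl : X * v6 1 / E ≤ 1 := by rw [div_le_one hE0]; exact hEle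
  refine h.disj ((X * v6 1 / E) • v7) ?_ ?_
  · refine mem_segment_of_coords (1 - X * v7 1 / E) (X * v7 1 / E) ?_ (by positivity)
      (by ring) ?_ ?_
    · rw [sub_nonneg, div_le_one hE0]; linarith
    · rw [h.v5x]; simp; field_simp; rw [hE]; ring
    · rw [h.v5y]; simp; field_simp
  · refine mem_segment_of_coords (X * v6 1 / E) (1 - X * v6 1 / E) (by positivity)
      (by linarith) (by ring) ?_ ?_
    · rw [h.v1x]; simp
    · rw [h.v1y]; simp

end

section
variable {K : Set Plane} {v1 v5 v6 v7 : Plane} {X : ℝ}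

/-- The wedge at `v7` on the outer side is disjoint from `K`. -/
theorem QuadData.wedge (h : QuadData K v1 v5 v6 v7 X) {z : Plane} (hz : z ∈ K)
    (hF : (v6 1 - v7 1) * z 0 + (v7 0 - v6 0) * z 1 < v6 1 * v7 0 - v6 0 * v7 1) :
    0 ≤ v7 1 * z 0 - v7 0 * z 1 := by
  by_contra hG
  rw [not_le] at hG
  have hr := h.right_ray
  have hl := h.left_line
  have hy := h.v7y
  have hX : 0 < X := lt_of_lt_of_le one_pos h.X1
  have hfr : ∀ w ∈ frontier K,
      (v6 1 - v7 1) * w 0 + (v7 0 - v6 0) * w 1 < v6 1 * v7 0 - v6 0 * v7 1 →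
      v7 1 * w 0 - v7 0 * w 1 < 0 → False := by
    intro w hw h1 h2
    have hyX : 0 < X * v7 1 := by positivity
    rcases (h.fr w).1 hw with e | e | e | e
    · have := segment_le e (v7 1) (-(v7 0)) 0 (by rw [h.v1x, h.v1y]; simp)
        (by rw [h.v5x, h.v5y]; linarith)
      linarith
    · have := segment_le e (v6 1 - v7 1) (v7 0 - v6 0) (v6 1 * v7 0 - v6 0 * v7 1)
        (by rw [h.v5x, h.v5y]; linarith) (by linarith)
      linarith
    · have := segment_le e (v6 1 - v7 1) (v7 0 - v6 0) (v6 1 * v7 0 - v6 0 * v7 1)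
        (by linarith) (by linarith)
      linarith
    · have := segment_le e (v7 1) (-(v7 0)) 0 (by linarith) (by rw [h.v1x, h.v1y]; simp)
      linarith
  refine notMem_of_ray h.cpt z (z - v7) ?_ ?_ hz
  · intro e
    rw [sub_eq_zero] at e
    rw [e] at hG
    linarith
  · intro t ht hf
    refine hfr _ hf ?_ ?_
    · simp
      nlinarith
    · simp
      nlinarith

set_option maxHeartbeats 1000000 in
theorem QuadData.main (h : QuadData K v1 v5 v6 v7 X) (hX2 : X < 2)
    (g56 : 1 ≤ geodesicDist K v5 v6) (g67 : 1 ≤ geodesicDist K v6 v7)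
    (g71 : 1 ≤ geodesicDist K v7 v1) (s : Plane) (hs : s ∈ segment ℝ v1 v5) :
    ENNReal.ofReal (Real.sqrt 3 / 2) ≤ geodesicDist K v6 s := by
  have hr := h.right_ray
  have hl := h.left_line
  have hb := h.v6y
  have hy := h.v7y
  have hX : 0 < X := lt_of_lt_of_le one_pos h.X1
  have d56 := one_le_of_geodesic K v5 v6 (fun z hz => h.fr_sub ((h.fr z).2 (by tauto))) g56
  have d67 := one_le_of_geodesic K v6 v7 (fun z hz => h.fr_sub ((h.fr z).2 (by tauto))) g67
  have d71 := one_le_of_geodesic K v7 v1 (fun z hz => h.fr_sub ((h.fr z).2 (by tauto))) g71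
  rw [h.v5x, h.v5y] at d56
  rw [h.v1x, h.v1y] at d71
  have hby : v7 1 < v6 1 := by
    have : 0 < (v6 1 - v7 1) * X := by linarith
    by_contra hc
    nlinarith
  have hs1 : s 1 = 0 := by
    obtain ⟨_, _, _, _, _, _, e⟩ := segment_coords hs
    rw [e, h.v1y, h.v5y]; ring
  have hsX : s 0 ≤ X := by
    have := segment_le hs (-1) 0 (-X) (by rw [h.v1x]; linarith) (by rw [h.v5x]; linarith)
    linarith
  have hsq : (Real.sqrt 3 / 2) ^ 2 = 3 / 4 := by
    rw [div_pow, Real.sq_sqrt (by norm_num)]; norm_num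
  unfold geodesicDist
  refine le_iInf fun γ => le_iInf fun hc => le_iInf fun h0 => le_iInf fun h1 => le_iInf fun hm => ?_
  -- it suffices to find a far point on the path
  suffices hfar : ∃ t ∈ Icc (0 : ℝ) 1,
      3 / 4 ≤ (v6 0 - γ t 0) ^ 2 + (v6 1 - γ t 1) ^ 2 by
    obtain ⟨t, ht, hd⟩ := hfar
    have e1 := eVariationOn.edist_le γ (left_mem_Icc.2 (zero_le_one' ℝ)) ht
    rw [h0] at e1
    exact (ofReal_le_edist _ _ _ (by rw [hsq]; exact hd)).trans e1
  rcases lt_or_ge ((v6 1 - v7 1) * s 0) (v6 1 * v7 0 - v6 0 * v7 1) with hF | hF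
  · -- the path has to go around `v7`
    have hFc : ContinuousOn (fun t => (v6 1 - v7 1) * γ t 0 + (v7 0 - v6 0) * γ t 1) (Icc 0 1) := by
      fun_prop
    have hGc : ContinuousOn (fun t => v7 1 * γ t 0 - v7 0 * γ t 1) (Icc 0 1) := by
      fun_prop
    set E := v6 1 * v7 0 - v6 0 * v7 1 with hE
    set A := Icc (0 : ℝ) 1 ∩ (fun t => (v6 1 - v7 1) * γ t 0 + (v7 0 - v6 0) * γ t 1) ⁻¹' (Ici E)
      with hA
    have hAc : IsCompact A :=
      isCompact_Icc.of_isClosed_subset (hFc.preimage_isClosed_of_isClosed isClosed_Icc isClosed_Ici)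
        inter_subset_left
    have hAn : A.Nonempty := ⟨0, left_mem_Icc.2 zero_le_one, by
      simp only [mem_preimage, mem_Ici, h0]; linarith⟩
    obtain ⟨t0, ⟨ht0, ht0E⟩, hmax⟩ := hAc.exists_isGreatest hAn
    simp only [mem_preimage, mem_Ici] at ht0E
    have ht01 : t0 < 1 := by
      rcases ht0.2.lt_or_eq with e | e
      · exact e
      · rw [e, h1, hs1] at ht0E; linarith
    have hafter : ∀ t ∈ Ioc t0 1,
        (v6 1 - v7 1) * γ t 0 + (v7 0 - v6 0) * γ t 1 < E := by
      intro t ht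
      by_contra hcon
      have : t ∈ A := ⟨⟨ht0.1.trans ht.1.le, ht.2⟩, not_lt.1 hcon⟩
      exact absurd (hmax this) (not_le.2 ht.1)
    have hsub : Ioc t0 1 ⊆ Icc 0 1 := fun t ht => ⟨ht0.1.trans ht.1.le, ht.2⟩
    have hcl : t0 ∈ closure (Ioc t0 1) := by
      rw [closure_Ioc ht01.ne]; exact left_mem_Icc.2 ht01.le
    have hFle : (v6 1 - v7 1) * γ t0 0 + (v7 0 - v6 0) * γ t0 1 ≤ E :=
      ContinuousWithinAt.closure_le hcl ((hFc t0 ht0).mono hsub) continuousWithinAt_const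
        (fun t ht => (hafter t ht).le)
    have hGge : 0 ≤ v7 1 * γ t0 0 - v7 0 * γ t0 1 :=
      ContinuousWithinAt.closure_le hcl continuousWithinAt_const ((hGc t0 ht0).mono hsub)
        (fun t ht => h.wedge (hm (hsub ht)) (hafter t ht))
    refine ⟨t0, ht0, ?_⟩
    have hFeq : (v6 1 - v7 1) * γ t0 0 + (v7 0 - v6 0) * γ t0 1 = E := le_antisymm hFle ht0E
    -- `γ t0 = v6 + l • (v7 - v6)` with `l ≥ 1`
    have hp : 0 < v6 1 - v7 1 := by linarith
    obtain ⟨l, hl'⟩ : ∃ l, l = (v6 1 - γ t0 1) / (v6 1 - v7 1) := ⟨_, rfl⟩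
    have hE0 : 0 < E := by linarith
    have c1 : v6 1 - γ t0 1 = l * (v6 1 - v7 1) := by rw [hl']; field_simp
    have c1' : γ t0 1 = v6 1 - l * (v6 1 - v7 1) := by linarith
    have c0 : v6 0 - γ t0 0 = l * (v6 0 - v7 0) := by
      have : (v6 1 - v7 1) * (v6 0 - γ t0 0) = (v6 1 - v7 1) * (l * (v6 0 - v7 0)) := by
        rw [c1'] at hFeq; rw [hE] at hFeq; linarith
      exact mul_left_cancel₀ hp.ne' this
    have c0' : γ t0 0 = v6 0 - l * (v6 0 - v7 0) := by linarith
    have hl1 : 1 ≤ l := by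
      rw [c0', c1'] at hGge
      have : 0 ≤ (l - 1) * E := by rw [hE]; linarith
      by_contra hcon
      nlinarith
    rw [c0, c1]
    have : (l * (v6 0 - v7 0)) ^ 2 + (l * (v6 1 - v7 1)) ^ 2 =
      l ^ 2 * ((v6 0 - v7 0) ^ 2 + (v6 1 - v7 1) ^ 2) := by ring
    rw [this]
    have hl2 : 1 ≤ l ^ 2 := one_le_pow₀ hl1
    have := one_le_mul_of_one_le_of_one_le hl2 d67
    linarith
  · refine ⟨1, right_mem_Icc.2 zero_le_one, ?_⟩
    rw [h1, hs1]
    rcases le_or_gt (3 / 4) (v6 1 ^ 2) with hb2 | hb2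
    · nlinarith [sq_nonneg (v6 0 - s 0)]
    rcases le_or_gt X (v6 0) with haX | haX
    · have : (v6 0 - X) ^ 2 ≤ (v6 0 - s 0) ^ 2 := by
        apply pow_le_pow_left₀ <;> linarith
      nlinarith
    rcases le_or_gt (v7 0) (v6 0) with hxa | hxa
    · exfalso
      have hx : 0 < v7 0 := by
        by_contra hcon
        rw [not_lt] at hcon
        have k1 := mul_nonneg hy.le (sub_nonneg.2 hxa)
        have k2 := mul_nonneg (sub_nonneg.2 hby.le) (neg_nonneg.2 hcon)
        linarith
      exact numeric_core X (v6 0) (v6 1) (v7 0) (v7 1) hX2 haX hxa hx hy hby hb2 (by nlinarith)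
        (by nlinarith) d67
    · have hp : 0 < v6 1 - v7 1 := by linarith
      have k1 : (v6 1 - v7 1) * (v7 0 - v6 0) ≤ (v6 1 - v7 1) * (s 0 - v6 0) := by
        nlinarith
      have k2 : v7 0 - v6 0 ≤ s 0 - v6 0 := le_of_mul_le_mul_left k1 hp
      have k3 : (v7 0 - v6 0) ^ 2 ≤ (s 0 - v6 0) ^ 2 := by
        apply pow_le_pow_left₀ <;> linarith
      have k4 : (v6 1 - v7 1) ^ 2 ≤ v6 1 ^ 2 := by
        apply pow_le_pow_left₀ <;> linarith
      nlinarith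

end

/-- auxiliary claim (a).  In a simple quadrilateral
`Q = (v₁, v₅, v₆, v₇)` with `v₁ = (0,0)`, `v₅ = (x₅,0)`, `1 ≤ x₅ < 2`,
with `v₆, v₇` in the open upper half-plane, `v₇` reflex, and pairwise
geodesic vertex distance at least `1`, the geodesic distance from `v₆` to the
segment `S = [v₁,v₅]` is at least `√3/2`.
(Here `v₁, v₅, v₆, v₇` are `Q.vertex 0, 1, 2, 3`.) -/
theorem geodesic_dist_v6_to_S (Q : SimplePolygon) (hn : Q.n = 4) (x5 : ℝ)
    (hx5 : 1 ≤ x5) (hx5' : x5 < 2)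
    (hv1x : Q.vertex 0 0 = 0) (hv1y : Q.vertex 0 1 = 0)
    (hv5x : Q.vertex 1 0 = x5) (hv5y : Q.vertex 1 1 = 0)
    (hv6 : 0 < Q.vertex 2 1) (hv7 : 0 < Q.vertex 3 1)
    (hreflex : Q.IsReflexAt 3)
    (hsep : ∀ i j : ZMod Q.n, i ≠ j →
      1 ≤ geodesicDist Q.carrier (Q.vertex i) (Q.vertex j)) :
    ENNReal.ofReal (Real.sqrt 3 / 2) ≤
      ⨅ s ∈ segment ℝ (Q.vertex 0) (Q.vertex 1),
        geodesicDist Q.carrier (Q.vertex 2) s := by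
  obtain ⟨n, three_le, vertex, K, hcpt, hconn, hreg, hfr, hinj, hadj, hdisj⟩ := Q
  dsimp only at hn
  subst hn
  unfold SimplePolygon.IsReflexAt at hreflex
  dsimp only at *
  have e33 : (3 : ZMod 4) + 1 = 0 := by decide
  have e32 : (3 : ZMod 4) - 1 = 2 := by decide
  have e11 : (1 : ZMod 4) + 1 = 2 := by decide
  have e21 : (2 : ZMod 4) + 1 = 3 := by decide
  rw [e33, e32] at hreflex
  have hd := hdisj 1 3 (by decide) (by decide) (by decide)
  rw [e33, e11] at hd
  have hq : QuadData K (vertex 0) (vertex 1) (vertex 2) (vertex 3) x5 :=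
    { cpt := hcpt
      reg := hreg
      fr := by
        intro z
        rw [hfr, mem_iUnion]
        constructor
        · rintro ⟨i, hi⟩
          have hi4 : i = 0 ∨ i = 1 ∨ i = 2 ∨ i = 3 := by
            clear hi; revert i; decide
          rcases hi4 with rfl | rfl | rfl | rfl
          · rw [zero_add] at hi; exact Or.inl hi
          · rw [e11] at hi; exact Or.inr (Or.inl hi)
          · rw [e21] at hi; exact Or.inr (Or.inr (Or.inl hi))
          · rw [e33] at hi; exact Or.inr (Or.inr (Or.inr hi))
        · rintro (hi | hi | hi | hi)
          · exact ⟨0, by rw [zero_add]; exact hi⟩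
          · exact ⟨1, by rw [e11]; exact hi⟩
          · exact ⟨2, by rw [e21]; exact hi⟩
          · exact ⟨3, by rw [e33]; exact hi⟩
      disj := fun z h1 h2 => Set.disjoint_left.1 hd h1 h2
      X1 := hx5
      v1x := hv1x
      v1y := hv1y
      v5x := hv5x
      v5y := hv5y
      v6y := hv6
      v7y := hv7
      ne67 := fun e => absurd (hinj e) (by decide)
      reflex := hreflex }
  exact le_iInf fun s => le_iInf fun hs => hq.main hx5'
    (hsep 1 2 (by decide)) (hsep 2 3 (by decide)) (hsep 3 0 (by decide)) s hs
end
end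

section
/- Let Q be a simple pentagon in the Euclidean plane with vertices v1 = (0,0), v5 = (x5, 0) with 1 ≤ x5 < 2, and three further vertices v2, v3, v4 lying in the open lower half-plane, appearing in the boundary order (v1, v2, v3, v4, v5), such that v2 and v4 are reflex in Q and the pairwise geodesic distances in Q between the five vertices are all at least 1. Then the geodesic distance in Q from v3 to the segment S = [v1, v5] (the infimum over points s ∈ S of the geodesic distance from v3 to s in Q) is at least 2 − √3/2. -/
open Set Metric
open scoped ENNReal

noncomputable section

/-- signed area form -/
def crs (a b p : Plane) : ℝ := (b 0 - a 0) * (p 1 - a 1) - (b 1 - a 1) * (p 0 - a 0)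

lemma crs_comb (a b x y : Plane) (s t : ℝ) (h : s + t = 1) :
    crs a b (s • x + t • y) = s * crs a b x + t * crs a b y := by
  obtain rfl : t = 1 - s := by linarith
  simp [crs]; ring

lemma crs_cont (a b : Plane) : Continuous (crs a b) := by
  unfold crs; fun_prop

lemma convex_left (e : ℝ) (a b : Plane) : Convex ℝ {p | 0 < e * crs a b p} := by
  intro x hx y hy s t hs ht hst
  simp only [mem_ofPred_eq] at *
  rw [crs_comb _ _ _ _ _ _ hst]
  rcases hs.eq_or_lt with h | h
  · subst h
    have : t = 1 := by linarith
    subst this; linarith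
  · have h1 := mul_pos h hx
    have h2 := mul_nonneg ht hy.le
    nlinarith

lemma convex_low (c : ℝ) : Convex ℝ {p : Plane | p 1 < c} := by
  intro x hx y hy s t hs ht hst
  simp only [mem_ofPred_eq] at *
  simp
  rcases hs.eq_or_lt with h | h
  · subst h
    have : t = 1 := by linarith
    subst this; linarith
  · have h1 := mul_lt_mul_of_pos_left hx h
    have h2 := mul_le_mul_of_nonneg_left hy.le ht
    have h3 : s * c + t * c = c := by rw [← add_mul, hst, one_mul]
    linarith

lemma convex_up (c : ℝ) : Convex ℝ {p : Plane | c < p 1} := by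
  intro x hx y hy s t hs ht hst
  simp only [mem_ofPred_eq] at *
  simp
  rcases hs.eq_or_lt with h | h
  · subst h
    have : t = 1 := by linarith
    subst this; linarith
  · have h1 := mul_lt_mul_of_pos_left hx h
    have h2 := mul_le_mul_of_nonneg_left hy.le ht
    have h3 : s * c + t * c = c := by rw [← add_mul, hst, one_mul]
    linarith

lemma open_left (e : ℝ) (a b : Plane) : IsOpen {p | 0 < e * crs a b p} :=
  isOpen_lt continuous_const (continuous_const.mul (crs_cont a b))

lemma open_low (c : ℝ) : IsOpen {p : Plane | p 1 < c} :=
  isOpen_lt (by fun_prop) continuous_const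

/-- points of a segment keep a weak sign of `crs` -/
lemma seg_crs_nonpos (e : ℝ) (a b x y z : Plane) (hx : e * crs a b x ≤ 0) (hy : e * crs a b y ≤ 0)
    (hz : z ∈ segment ℝ x y) : e * crs a b z ≤ 0 := by
  obtain ⟨s, t, hs, ht, hst, rfl⟩ := hz
  rw [crs_comb _ _ _ _ _ _ hst]
  have h1 := mul_nonneg hs (neg_nonneg.2 hx)
  have h2 := mul_nonneg ht (neg_nonneg.2 hy)
  nlinarith

lemma seg_low (c : ℝ) (x y z : Plane) (hx : c ≤ x 1) (hy : c ≤ y 1)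
    (hz : z ∈ segment ℝ x y) : c ≤ z 1 := by
  obtain ⟨s, t, hs, ht, hst, rfl⟩ := hz
  simp
  have h1 := mul_le_mul_of_nonneg_left hx hs
  have h2 := mul_le_mul_of_nonneg_left hy ht
  have h3 : s * c + t * c = c := by rw [← add_mul, hst, one_mul]
  linarith

lemma seg_upp (c : ℝ) (x y z : Plane) (hx : x 1 ≤ c) (hy : y 1 ≤ c)
    (hz : z ∈ segment ℝ x y) : z 1 ≤ c := by
  obtain ⟨s, t, hs, ht, hst, rfl⟩ := hz
  simp
  have h1 := mul_le_mul_of_nonneg_left hx hs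
  have h2 := mul_le_mul_of_nonneg_left hy ht
  have h3 : s * c + t * c = c := by rw [← add_mul, hst, one_mul]
  linarith

lemma dich {C K : Set Plane} (hK : IsPreconnected K) (hd : ∀ z ∈ K, z ∉ frontier C)
    (hne : (K ∩ interior C).Nonempty) : K ⊆ interior C := by
  apply hK.subset_left_of_subset_union isOpen_interior (isClosed_closure (s := C)).isOpen_compl
    _ _ hne
  · exact disjoint_left.2 fun x hx hx' => hx' (subset_closure (interior_subset hx))
  · intro z hz
    by_cases h : z ∈ interior C
    · exact Or.inl h
    · right
      intro h'
      exact hd z hz ⟨h', h⟩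

lemma outside {C K : Set Plane} (hC : IsCompact C) (hK : Convex ℝ K)
    (hd : ∀ z ∈ K, z ∉ frontier C) (q d : Plane) (hdne : d ≠ 0)
    (hq : ∀ t : ℝ, 0 < t → q + t • d ∈ K) : ∀ z ∈ K, z ∉ C := by
  intro z hz hzC
  have hzi : z ∈ interior C := by
    by_contra h
    exact hd z hz ⟨subset_closure hzC, h⟩
  have hsub := dich hK.isPreconnected hd ⟨z, hz, hzi⟩
  obtain ⟨R, hR⟩ := hC.isBounded.exists_norm_le
  have hdn : 0 < ‖d‖ := norm_pos_iff.2 hdne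
  have hR0 : 0 ≤ R := (norm_nonneg z).trans (hR z hzC)
  set t : ℝ := (R + ‖q‖ + 1) / ‖d‖ with ht
  have htpos : 0 < t := by positivity
  have h1 := hR _ (interior_subset (hsub (hq t htpos)))
  have h2 : ‖t • d‖ = R + ‖q‖ + 1 := by
    rw [norm_smul, Real.norm_of_nonneg htpos.le, ht]; field_simp
  have h3 : ‖t • d‖ ≤ ‖q + t • d‖ + ‖q‖ := by
    have := norm_sub_le (q + t • d) q
    simpa using this
  linarith

lemma small {O : Set Plane} (hO : IsOpen O) {A : Plane} (hA : A ∈ O) (d : Plane) :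
    ∀ᶠ t in nhdsWithin (0:ℝ) (Ioi 0), A + t • d ∈ O := by
  have hc : Continuous fun t : ℝ => A + t • d := by fun_prop
  have := hc.tendsto 0
  simp only [zero_smul, add_zero] at this
  exact (this.mono_left nhdsWithin_le_nhds) (hO.mem_nhds hA)

lemma above_out {C : Set Plane} (hC : IsCompact C) (c : ℝ)
    (hF : ∀ z ∈ frontier C, z 1 ≤ c) : ∀ z ∈ C, z 1 ≤ c := by
  intro z hz
  by_contra! h
  refine outside hC (convex_up c) (fun z hz h => absurd (hF z h) (not_le.2 hz)) 
    (!₂[0, c]) (!₂[0, 1]) ?_ ?_ z h hz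
  · intro h
    have := congrArg (fun p : Plane => p 1) h
    simp at this
  · intro t ht; simpa using ht

lemma below_out {C : Set Plane} (hC : IsCompact C) (c : ℝ)
    (hF : ∀ z ∈ frontier C, c ≤ z 1) : ∀ z ∈ C, c ≤ z 1 := by
  intro z hz
  by_contra! h
  refine outside hC (convex_low c) (fun z hz h => absurd (hF z h) (not_le.2 hz)) 
    (!₂[0, c]) (!₂[0, -1]) ?_ ?_ z h hz
  · intro h
    have := congrArg (fun p : Plane => p 1) h
    simp at this
  · intro t ht; simpa using ht

lemma int_low {C : Set Plane} (c : ℝ) (h : ∀ z ∈ C, z 1 ≤ c) : ∀ z ∈ interior C, z 1 < c := by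
  intro z hz
  obtain ⟨t, ht, htp⟩ := ((small isOpen_interior hz (!₂[0, 1])).and self_mem_nhdsWithin).exists
  have := h _ (interior_subset ht)
  simp at this htp
  linarith

lemma tube (x y : Plane) {F : Set Plane} (hF : IsClosed F)
    (h : Disjoint (segment ℝ x y) F) : ∃ δ > 0, Disjoint (Metric.thickening δ (segment ℝ x y)) F := by
  have hc : IsCompact (segment ℝ x y) := by
    rw [segment_eq_image_lineMap]
    exact isCompact_Icc.image (by fun_prop)
  obtain ⟨δ, h1, h2⟩ := h.exists_thickenings hc hF
  exact ⟨δ, h1, h2.mono_right (Metric.self_subset_thickening h1 F)⟩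

lemma seg_closed (x y : Plane) : IsClosed (segment ℝ x y) := by
  rw [segment_eq_image_lineMap]
  exact (isCompact_Icc.image (by fun_prop)).isClosed

/-- hypotheses on half of the configuration -/
structure Cfg (C : Set Plane) (e : ℝ) (A B G D E : Plane) : Prop where
  comp : IsCompact C
  reg : C = closure (interior C)
  front : ∀ z, z ∈ frontier C ↔ z ∈ segment ℝ A B ∨ z ∈ segment ℝ B G ∨ z ∈ segment ℝ G D ∨
    z ∈ segment ℝ D E ∨ z ∈ segment ℝ E A
  A1 : A 1 = 0
  E1 : E 1 = 0
  B1 : B 1 < 0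
  G1 : G 1 < 0
  D1 : D 1 < 0
  he : 0 < e * (E 0 - A 0)
  d1 : Disjoint (segment ℝ A B) (segment ℝ G D)
  d2 : Disjoint (segment ℝ A B) (segment ℝ D E)
  d3 : Disjoint (segment ℝ B G) (segment ℝ D E)
  d4 : Disjoint (segment ℝ B G) (segment ℝ E A)

namespace Cfg
variable {C : Set Plane} {e : ℝ} {A B G D E : Plane}

lemma fsub (h : Cfg C e A B G D E) {z : Plane} (hz : z ∈ frontier C) : z ∈ C := by
  have := h.comp.isClosed.frontier_subset
  exact this hz

lemma Cle (h : Cfg C e A B G D E) : ∀ z ∈ C, z 1 ≤ 0 := by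
  apply above_out h.comp
  intro z hz
  have := h.A1; have := h.E1; have := h.B1; have := h.D1; have := h.G1
  rcases (h.front z).1 hz with h | h | h | h | h <;>
    exact seg_upp 0 _ _ z (by linarith) (by linarith) h

lemma left_E (h : Cfg C e A B G D E) : 0 < e * crs A B E := by
  have := mul_pos h.he (neg_pos.2 h.B1)
  simp only [crs, h.A1, h.E1]; linarith

lemma Kgen (h : Cfg C e A B G D E) (H : Set Plane) (hHo : IsOpen H) (hHc : Convex ℝ H)
    (hAH : A ∈ H) (hBG : ∀ z ∈ segment ℝ B G, z ∈ H → e * crs A B z ≤ 0) :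
    ∃ δ > 0, Metric.thickening δ (segment ℝ A B) ∩ {p | 0 < e * crs A B p} ∩ {p | p 1 < 0} ∩ H
      ⊆ interior C := by
  obtain ⟨δ, hδ, hdis⟩ := tube A B ((seg_closed G D).union (seg_closed D E))
    (disjoint_union_right.2 ⟨h.d1, h.d2⟩)
  refine ⟨δ, hδ, ?_⟩
  have hth : Convex ℝ (Metric.thickening δ (segment ℝ A B)) := (convex_segment A B).thickening δ
  apply dich
  · exact (((hth.inter (convex_left e A B)).inter (convex_low 0)).inter hHc).isPreconnected
  · rintro z ⟨⟨⟨hz1, hz2⟩, hz3⟩, hz4⟩ hzF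
    simp only [mem_ofPred_eq] at hz2 hz3
    rcases (h.front z).1 hzF with hz | hz | hz | hz | hz
    · have := seg_crs_nonpos e A B A B z (by simp [crs]) (by simp [crs, mul_comm]) hz
      linarith
    · have := hBG z hz hz4
      linarith
    · exact disjoint_left.1 hdis hz1 (Or.inl hz)
    · exact disjoint_left.1 hdis hz1 (Or.inr hz)
    · have := seg_low 0 E A z h.E1.ge h.A1.ge hz
      linarith
  · have hAt : A ∈ Metric.thickening δ (segment ℝ A B) ∩ H :=
      ⟨Metric.self_subset_thickening hδ _ (left_mem_segment ℝ A B), hAH⟩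
    have hO : IsOpen (Metric.thickening δ (segment ℝ A B) ∩ H) := Metric.isOpen_thickening.inter hHo
    have hlt : ∀ᶠ t in nhdsWithin (0:ℝ) (Ioi 0), t < 1 :=
      nhdsWithin_le_nhds (Iio_mem_nhds (by norm_num))
    obtain ⟨t, ⟨ht1, ht2⟩, ht3⟩ :=
      (((small hO hAt (E - A)).and self_mem_nhdsWithin).and hlt).exists
    replace ht2 : 0 < t := ht2
    set q := A + t • (E - A) with hq
    have hqs : q ∈ segment ℝ E A := ⟨t, 1 - t, ht2.le, by linarith, by ring, by rw [hq]; module⟩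
    have hqC : q ∈ closure (interior C) := by
      rw [← h.reg]; exact h.fsub ((h.front q).2 (by simp [hqs]))
    have hql : 0 < e * crs A B q := by
      have h1 : e * crs A B q = t * (e * crs A B E) := by
        simp [hq, crs]; ring
      rw [h1]; exact mul_pos ht2 h.left_E
    obtain ⟨z, hz1, hz2⟩ := mem_closure_iff.1 hqC _ (hO.inter (open_left e A B)) ⟨ht1, hql⟩
    exact ⟨z, ⟨⟨⟨hz1.1.1, hz1.2⟩, int_low 0 h.Cle z hz2⟩, hz1.1.2⟩, hz2⟩

lemma reflex (h : Cfg C e A B G D E) (hBGne : G ≠ B)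
    (hadj : segment ℝ A B ∩ segment ℝ B G = {B})
    (hr : ∃ δ > (0 : ℝ), ∀ a ∈ segment ℝ A B, ∀ c ∈ segment ℝ B G, a ≠ B → c ≠ B →
      dist a B < δ → dist c B < δ → ¬ segment ℝ a c ⊆ C) :
    e * crs A B G < 0 := by
  obtain ⟨δ', hδ', hr⟩ := hr
  have he := h.he
  have hA1 := h.A1
  have hB1 := h.B1
  have hAB : A ≠ B := by
    intro h; rw [h] at hA1; linarith
  have hlt : ∀ᶠ t in nhdsWithin (0:ℝ) (Ioi 0), t < 1 :=
      nhdsWithin_le_nhds (Iio_mem_nhds (by norm_num))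
  have key : ∀ (O : Set Plane), IsOpen O → B ∈ O → ∃ t : ℝ, 0 < t ∧ t < 1 ∧ B + t • (A - B) ∈ O ∧
      B + t • (G - B) ∈ O ∧ ¬ segment ℝ (B + t • (A - B)) (B + t • (G - B)) ⊆ C := by
    intro O hO hBO
    have hO' : IsOpen (O ∩ Metric.ball B δ') := hO.inter Metric.isOpen_ball
    have hBO' : B ∈ O ∩ Metric.ball B δ' := ⟨hBO, Metric.mem_ball_self hδ'⟩
    obtain ⟨t, ⟨⟨h1, h2⟩, h3⟩, h4⟩ := ((((small hO' hBO' (A - B)).and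
      (small hO' hBO' (G - B))).and hlt).and self_mem_nhdsWithin).exists
    replace h4 : 0 < t := h4
    refine ⟨t, h4, h3, h1.1, h2.1, hr _ ?_ _ ?_ ?_ ?_ h1.2 h2.2⟩
    · exact ⟨t, 1 - t, h4.le, by linarith, by ring, by module⟩
    · exact ⟨1 - t, t, by linarith, h4.le, by ring, by module⟩
    · simp [h4.ne', sub_eq_zero, hAB]
    · simp [h4.ne', sub_eq_zero, hBGne]
  by_contra! hge
  rcases hge.eq_or_lt with h0 | hpos
  · -- collinear
    have hc0 : crs A B G = 0 := by
      rcases mul_eq_zero.1 h0.symm with h | h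
      · rw [h] at he; simp at he
      · exact h
    have ha1 : A 1 - B 1 ≠ 0 := by rw [hA1]; linarith
    obtain ⟨k, hk⟩ : ∃ k : ℝ, G = B + k • (A - B) := by
      refine ⟨(G 1 - B 1) / (A 1 - B 1), ?_⟩
      ext i
      fin_cases i
      · simp
        field_simp
        unfold crs at hc0
        linarith
      · simp
        field_simp
        ring
    have hk0 : k ≠ 0 := by
      rintro rfl; simp at hk; exact hBGne hk
    rcases lt_or_gt_of_ne hk0 with hk1 | hk1
    · obtain ⟨t, t0, t1, -, -, hn⟩ := key univ isOpen_univ (mem_univ _)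
      apply hn
      rintro z ⟨u, v, hu, hv, huv, rfl⟩
      apply h.fsub
      rw [h.front]
      by_cases hs : 0 ≤ u + v * k
      · left
        have h1 : u + v * k ≤ 1 := by nlinarith
        refine ⟨t * (u + v * k), 1 - t * (u + v * k), by positivity, by nlinarith, by ring, ?_⟩
        rw [hk]
        obtain rfl : u = 1 - v := by linarith
        module
      · right; left
        push Not at hs
        have h1 : 0 ≤ u / k + v := by
          have : u / k + v = (u + v * k) / k := by field_simp
          rw [this]; exact div_nonneg_of_nonpos hs.le hk1.le
        have h2 : u / k + v ≤ 1 := by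
          have := div_nonpos_of_nonneg_of_nonpos hu hk1.le
          linarith
        refine ⟨1 - t * (u / k + v), t * (u / k + v), by nlinarith, by positivity, by ring, ?_⟩
        rw [hk]
        have h3 : u = (u / k) * k := by field_simp
        set w := u / k
        rw [h3]
        have h4 : v = 1 - w * k := by linarith
        rw [h4]
        module
    · rcases le_total k 1 with hk2 | hk2
      · have : G ∈ segment ℝ A B ∩ segment ℝ B G :=
          ⟨⟨k, 1 - k, hk1.le, by linarith, by ring, by rw [hk]; module⟩, right_mem_segment ℝ B G⟩
        rw [hadj] at this
        exact hBGne this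
      · have : A ∈ segment ℝ A B ∩ segment ℝ B G := by
          refine ⟨left_mem_segment ℝ A B, ⟨1 - 1/k, 1/k, ?_, by positivity, by ring, ?_⟩⟩
          · rw [sub_nonneg, div_le_one hk1]; exact hk2
          · rw [hk, smul_add, smul_smul, one_div_mul_cancel hk0]; module
        rw [hadj] at this
        exact hAB this
  · have hcyc : crs B G A = crs A B G := by unfold crs; ring
    obtain ⟨δ, hδ, hK⟩ := h.Kgen {p | 0 < e * crs B G p} (open_left e B G) (convex_left e B G)
      (by simp only [mem_ofPred_eq]; rw [hcyc]; exact hpos) (by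
        intro z hz hz'
        exfalso
        have := seg_crs_nonpos e B G B G z (by simp [crs]) (by simp [crs, mul_comm]) hz
        exact absurd hz' (not_lt.2 this))
    have hconv : Convex ℝ (Metric.ball B δ ∩ {p : Plane | p 1 < 0}) :=
      (convex_ball B δ).inter (convex_low 0)
    obtain ⟨t, t0, t1, ha, hc, hn⟩ := key (Metric.ball B δ ∩ {p : Plane | p 1 < 0})
      (Metric.isOpen_ball.inter (open_low 0)) ⟨Metric.mem_ball_self hδ, hB1⟩
    apply hn
    intro z hz
    have hzO := hconv.segment_subset ha hc hz
    obtain ⟨u, v, hu, hv, huv, rfl⟩ := hz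
    rcases hu.eq_or_lt with hu | hu
    · subst hu
      obtain rfl : v = 1 := by linarith
      apply h.fsub; rw [h.front]; right; left
      exact ⟨1 - t, t, by linarith, t0.le, by ring, by module⟩
    rcases hv.eq_or_lt with hv | hv
    · subst hv
      obtain rfl : u = 1 := by linarith
      apply h.fsub; rw [h.front]; left
      exact ⟨t, 1 - t, t0.le, by linarith, by ring, by module⟩
    apply interior_subset
    apply hK
    refine ⟨⟨⟨?_, ?_⟩, hzO.2⟩, ?_⟩
    · exact Metric.mem_thickening_iff.2 ⟨B, right_mem_segment ℝ A B, hzO.1⟩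
    · have : e * crs A B (u • (B + t • (A - B)) + v • (B + t • (G - B))) =
          v * t * (e * crs A B G) := by
        obtain rfl : u = 1 - v := by linarith
        simp [crs]; ring
      simp only [mem_ofPred_eq]
      rw [this]; positivity
    · have : e * crs B G (u • (B + t • (A - B)) + v • (B + t • (G - B))) =
          u * t * (e * crs A B G) := by
        obtain rfl : u = 1 - v := by linarith
        simp [crs]; ring
      simp only [mem_ofPred_eq]
      rw [this]; positivity

lemma zint (h : Cfg C e A B G D E) (hr : e * crs A B G < 0) :
    ∀ᶠ t in nhdsWithin (0:ℝ) (Ioi 0), B + t • ((B - A) + (B - G)) ∈ interior C := by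
  obtain ⟨δ, hδ, hK⟩ := h.Kgen univ isOpen_univ convex_univ (mem_univ _) (by
    intro z hz _
    exact seg_crs_nonpos e A B B G z (by simp [crs, mul_comm]) hr.le hz)
  have hO : IsOpen (Metric.ball B δ ∩ {p : Plane | p 1 < 0}) :=
    Metric.isOpen_ball.inter (open_low 0)
  filter_upwards [small hO ⟨Metric.mem_ball_self hδ, h.B1⟩ ((B - A) + (B - G)),
    self_mem_nhdsWithin] with t ht t0
  replace t0 : 0 < t := t0
  apply hK
  refine ⟨⟨⟨?_, ?_⟩, ht.2⟩, mem_univ _⟩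
  · exact Metric.mem_thickening_iff.2 ⟨B, right_mem_segment ℝ A B, ht.1⟩
  · have : e * crs A B (B + t • ((B - A) + (B - G))) = t * (-(e * crs A B G)) := by
      simp [crs]; ring
    simp only [mem_ofPred_eq]
    rw [this]; exact mul_pos t0 (by linarith)

lemma notlow (h : Cfg C e A B G D E) (hr : e * crs A B G < 0) : ¬ (B 1 ≤ G 1 ∧ B 1 ≤ D 1) := by
  rintro ⟨h1, h2⟩
  have hB := h.B1; have hA := h.A1; have hE := h.E1
  have hb := below_out h.comp (B 1) (by
    intro z hz
    rcases (h.front z).1 hz with h | h | h | h | h <;>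
      exact seg_low _ _ _ z (by linarith) (by linarith) h)
  obtain ⟨t, ht, t0⟩ := ((h.zint hr).and self_mem_nhdsWithin).exists
  have := hb _ (interior_subset ht)
  replace t0 : 0 < t := t0
  simp [hA] at this
  nlinarith

lemma turn (h : Cfg C e A B G D E) (hr : e * crs A B G < 0) (hGB : G 1 < B 1) (hGD : G 1 < D 1) :
    0 < e * crs B G D := by
  by_contra! hle
  have hB := h.B1; have hA := h.A1; have hE := h.E1; have hG := h.G1
  have hb := below_out h.comp (G 1) (by
    intro z hz
    rcases (h.front z).1 hz with h | h | h | h | h <;>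
      exact seg_low _ _ _ z (by linarith) (by linarith) h)
  obtain ⟨δ, hδ, hdis⟩ := tube B G ((seg_closed D E).union (seg_closed E A))
    (disjoint_union_right.2 ⟨h.d3, h.d4⟩)
  have hcyc : crs B G A = crs A B G := by unfold crs; ring
  have hth : Convex ℝ (Metric.thickening δ (segment ℝ B G)) := (convex_segment B G).thickening δ
  have hO : IsOpen (Metric.thickening δ (segment ℝ B G)) := Metric.isOpen_thickening
  have hK : Metric.thickening δ (segment ℝ B G) ∩ {p | 0 < e * crs B G p} ⊆ interior C := by
    apply dich
    · exact (hth.inter (convex_left e B G)).isPreconnected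
    · rintro z ⟨hz1, hz2⟩ hzF
      simp only [mem_ofPred_eq] at hz2
      have hBB : e * crs B G B ≤ 0 := by simp [crs]
      have hGG : e * crs B G G ≤ 0 := by simp [crs, mul_comm]
      rcases (h.front z).1 hzF with hz | hz | hz | hz | hz
      · have := seg_crs_nonpos e B G A B z (by rw [hcyc]; exact hr.le) hBB hz
        linarith
      · have := seg_crs_nonpos e B G B G z hBB hGG hz
        linarith
      · have := seg_crs_nonpos e B G G D z hGG hle hz
        linarith
      · exact disjoint_left.1 hdis hz1 (Or.inl hz)
      · exact disjoint_left.1 hdis hz1 (Or.inr hz)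
    · obtain ⟨t, ⟨ht, ht'⟩, t0⟩ := (((h.zint hr).and (small hO
        (Metric.self_subset_thickening hδ _ (left_mem_segment ℝ B G)) ((B - A) + (B - G)))).and
        self_mem_nhdsWithin).exists
      replace t0 : 0 < t := t0
      refine ⟨_, ⟨ht', ?_⟩, ht⟩
      have : e * crs B G (B + t • ((B - A) + (B - G))) = t * (-(e * crs A B G)) := by
        simp [crs]; ring
      simp only [mem_ofPred_eq]
      rw [this]; exact mul_pos t0 (by linarith)
  obtain ⟨t, ht', t0⟩ := ((small hO (Metric.self_subset_thickening hδ _ (right_mem_segment ℝ B G))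
    (G - A)).and self_mem_nhdsWithin).exists
  replace t0 : 0 < t := t0
  have hin : G + t • (G - A) ∈ interior C := by
    apply hK
    refine ⟨ht', ?_⟩
    have : e * crs B G (G + t • (G - A)) = t * (-(e * crs A B G)) := by
      simp [crs]; ring
    simp only [mem_ofPred_eq]
    rw [this]; exact mul_pos t0 (by linarith)
  have := hb _ (interior_subset hin)
  simp [hA] at this
  nlinarith

lemma wedge (h : Cfg C e A B G D E) (hr : e * crs A B G < 0) (hD : 0 ≤ e * crs B G D)
    (hE : 0 ≤ e * crs B G E) : ∀ z ∈ C, e * crs B G z < 0 → 0 ≤ e * crs A B z := by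
  intro z hzC hz1
  by_contra! hz2
  have hcv : Convex ℝ ({p | 0 < (-e) * crs B G p} ∩ {p | 0 < (-e) * crs A B p}) :=
    (convex_left (-e) B G).inter (convex_left (-e) A B)
  have hlE := h.left_E
  refine outside h.comp hcv ?_ B ((A - B) + (G - B)) ?_ ?_ z
    ⟨by simp only [mem_ofPred_eq]; linarith, by simp only [mem_ofPred_eq]; linarith⟩ hzC
  · rintro z ⟨hz1, hz2⟩ hzF
    simp only [mem_ofPred_eq] at hz1 hz2
    have hBB : (-e) * crs B G B ≤ 0 := by simp [crs]
    have hGG : (-e) * crs B G G ≤ 0 := by simp [crs, mul_comm]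
    have hAA : (-e) * crs A B A ≤ 0 := by simp [crs]
    have hBB' : (-e) * crs A B B ≤ 0 := by simp [crs, mul_comm]
    have hDD : (-e) * crs B G D ≤ 0 := by linarith
    have hEE : (-e) * crs B G E ≤ 0 := by linarith
    have hEE' : (-e) * crs A B E ≤ 0 := by linarith
    rcases (h.front z).1 hzF with hz | hz | hz | hz | hz
    · linarith [seg_crs_nonpos (-e) A B A B z hAA hBB' hz]
    · linarith [seg_crs_nonpos (-e) B G B G z hBB hGG hz]
    · linarith [seg_crs_nonpos (-e) B G G D z hGG hDD hz]
    · linarith [seg_crs_nonpos (-e) B G D E z hDD hEE hz]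
    · linarith [seg_crs_nonpos (-e) A B E A z hEE' hAA hz]
  · intro h0
    have e0 : A 0 - B 0 + (G 0 - B 0) = 0 := by simpa using congrArg (fun p : Plane => p 0) h0
    have e1 : A 1 - B 1 + (G 1 - B 1) = 0 := by simpa using congrArg (fun p : Plane => p 1) h0
    have : crs A B G = 0 := by
      unfold crs
      linear_combination (B 0 - A 0) * e1 - (B 1 - A 1) * e0
    rw [this] at hr; simp at hr
  · intro t ht
    constructor
    · have : (-e) * crs B G (B + t • ((A - B) + (G - B))) = t * (-(e * crs A B G)) := by
        simp [crs]; ring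
      simp only [mem_ofPred_eq]
      rw [this]; exact mul_pos ht (by linarith)
    · have : (-e) * crs A B (B + t • ((A - B) + (G - B))) = t * (-(e * crs A B G)) := by
        simp [crs]; ring
      simp only [mem_ofPred_eq]
      rw [this]; exact mul_pos ht (by linarith)

lemma path (h : Cfg C e A B G D E) (hr : e * crs A B G < 0) (hD : 0 ≤ e * crs B G D)
    (hE : 0 ≤ e * crs B G E) (s : Plane) (hs : e * crs B G s < 0)
    (γ : ℝ → Plane) (hγ : ContinuousOn γ (Icc 0 1)) (h0 : γ 0 = G) (h1 : γ 1 = s)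
    (hm : MapsTo γ (Icc 0 1) C) :
    ENNReal.ofReal (dist G B + dist B s) ≤ eVariationOn γ (Icc 0 1) := by
  have hw := h.wedge hr hD hE
  have hf : ContinuousOn (fun t => e * crs B G (γ t)) (Icc 0 1) :=
    continuousOn_const.mul ((crs_cont B G).comp_continuousOn hγ)
  have hg : ContinuousOn (fun t => e * crs A B (γ t)) (Icc 0 1) :=
    continuousOn_const.mul ((crs_cont A B).comp_continuousOn hγ)
  have c1 := hf.preimage_isClosed_of_isClosed isClosed_Icc (isClosed_Ici (a := (0:ℝ)))
  have c2 := hf.preimage_isClosed_of_isClosed isClosed_Icc (isClosed_Iic (a := (0:ℝ)))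
  have c3 := hg.preimage_isClosed_of_isClosed isClosed_Icc (isClosed_Ici (a := (0:ℝ)))
  obtain ⟨t, ht, ⟨-, hta⟩, ⟨-, htb⟩, ⟨-, htc⟩⟩ := isPreconnected_closed_iff.1
    (isPreconnected_Icc (a := (0:ℝ)) (b := 1)) _ _ c1 (c2.inter c3) (by
      intro t ht
      by_cases hh : 0 ≤ e * crs B G (γ t)
      · exact Or.inl ⟨ht, hh⟩
      · push Not at hh
        exact Or.inr ⟨⟨ht, hh.le⟩, ⟨ht, hw _ (hm ht) hh⟩⟩)
      ⟨0, by simp, by simp, by simp [h0, crs, mul_comm]⟩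
      ⟨1, by simp, ⟨by simp, by simp only [mem_preimage, mem_Iic, h1]; exact hs.le⟩,
        ⟨by simp, hw _ (hm (by simp)) (by rw [h1]; exact hs)⟩⟩
  simp only [mem_preimage, mem_Ici, mem_Iic] at hta htb htc
  set q := γ t with hq
  have he := h.he
  have hene : e ≠ 0 := by rintro rfl; simp at he
  have hcr : crs A B G ≠ 0 := by intro h; rw [h] at hr; simp at hr
  have hq0 : crs B G q = 0 := by
    have : e * crs B G q = 0 := le_antisymm htb hta
    simpa [hene] using this
  -- q = B + lam (B - G)
  set lam := crs A B q / (- crs A B G) with hlam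
  have hl0 : 0 ≤ lam := by
    have : lam = (e * crs A B q) / (-(e * crs A B G)) := by
      rw [hlam]; field_simp
    rw [this]; exact div_nonneg htc (by linarith)
  have hl1 : lam * crs A B G = - crs A B q := by
    rw [hlam]; field_simp
  have hqe : q = B + lam • (B - G) := by
    have k0 : (q 0 - B 0 - lam * (B 0 - G 0)) * crs A B G = 0 := by
      have : (q 0 - B 0 - lam * (B 0 - G 0)) * crs A B G =
        (q 0 - B 0) * crs A B G - (B 0 - G 0) * (lam * crs A B G) := by ring
      rw [this, hl1]
      unfold crs at hq0 ⊢
      linear_combination (-(B 0 - A 0)) * hq0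
    have k1 : (q 1 - B 1 - lam * (B 1 - G 1)) * crs A B G = 0 := by
      have : (q 1 - B 1 - lam * (B 1 - G 1)) * crs A B G =
        (q 1 - B 1) * crs A B G - (B 1 - G 1) * (lam * crs A B G) := by ring
      rw [this, hl1]
      unfold crs at hq0 ⊢
      linear_combination (-(B 1 - A 1)) * hq0
    have k0' := (mul_eq_zero.1 k0).resolve_right hcr
    have k1' := (mul_eq_zero.1 k1).resolve_right hcr
    ext i
    fin_cases i
    · simp; linarith
    · simp; linarith
  have hGq : dist G q = dist G B + dist B q := by
    rw [hqe, dist_eq_norm, dist_eq_norm, dist_eq_norm]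
    have e1 : G - (B + lam • (B - G)) = (1 + lam) • (G - B) := by module
    have e2 : B - (B + lam • (B - G)) = lam • (G - B) := by module
    rw [e1, e2, norm_smul, norm_smul, Real.norm_of_nonneg hl0, Real.norm_of_nonneg (by linarith)]
    ring
  have tri := dist_triangle B q s
  have hsplit := eVariationOn.Icc_add_Icc (s := univ) γ ht.1 ht.2 (mem_univ t)
  simp only [univ_inter] at hsplit
  rw [← hsplit]
  have v1 := eVariationOn.edist_le γ (s := Icc 0 t) (x := 0) (y := t) (by simp [ht.1]) (by simp [ht.1])
  have v2 := eVariationOn.edist_le γ (s := Icc t 1) (x := t) (y := 1) (by simp [ht.2]) (by simp [ht.2])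
  refine le_trans ?_ (add_le_add v1 v2)
  rw [h0, h1, edist_dist, edist_dist, ← ENNReal.ofReal_add dist_nonneg dist_nonneg]
  apply ENNReal.ofReal_le_ofReal
  rw [← hq, hGq]
  linarith

end Cfg

lemma dsq (a b : Plane) : dist a b ^ 2 = (a 0 - b 0) ^ 2 + (a 1 - b 1) ^ 2 := by
  rw [EuclideanSpace.dist_eq, Real.sq_sqrt (by positivity)]
  simp [Real.dist_eq, sq_abs]

/-- `p` is a convex combination of `a, b, c` -/
def InHull (p a b c : Plane) : Prop :=
  ∃ u v w : ℝ, 0 ≤ u ∧ 0 ≤ v ∧ 0 ≤ w ∧ u + v + w = 1 ∧ p 0 = u * a 0 + v * b 0 + w * c 0 ∧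
    p 1 = u * a 1 + v * b 1 + w * c 1

lemma hullcore {p q a b c : Plane} (h : InHull p a b c)
    (ha : dist a q ^ 2 < dist a p ^ 2 + dist q p ^ 2)
    (hb : dist b q ^ 2 < dist b p ^ 2 + dist q p ^ 2)
    (hc : dist c q ^ 2 < dist c p ^ 2 + dist q p ^ 2) : False := by
  obtain ⟨u, v, w, hu, hv, hw, hs, h0, h1⟩ := h
  simp only [dsq] at ha hb hc
  set fa := (a 0 - p 0) * (q 0 - p 0) + (a 1 - p 1) * (q 1 - p 1) with hfa
  set fb := (b 0 - p 0) * (q 0 - p 0) + (b 1 - p 1) * (q 1 - p 1) with hfb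
  set fc := (c 0 - p 0) * (q 0 - p 0) + (c 1 - p 1) * (q 1 - p 1) with hfc
  have ga : 0 < fa := by rw [hfa]; nlinarith
  have gb : 0 < fb := by rw [hfb]; nlinarith
  have gc : 0 < fc := by rw [hfc]; nlinarith
  have hsum : u * fa + v * fb + w * fc = 0 := by
    rw [hfa, hfb, hfc]
    linear_combination (-(q 0 - p 0)) * h0 - (q 1 - p 1) * h1
      - (p 0 * (q 0 - p 0) + p 1 * (q 1 - p 1)) * hs
  have m1 := mul_nonneg hu ga.le
  have m2 := mul_nonneg hv gb.le
  have m3 := mul_nonneg hw gc.le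
  have z1 : u = 0 := by
    have : u * fa = 0 := by linarith
    exact (mul_eq_zero.1 this).resolve_right ga.ne'
  have z2 : v = 0 := by
    have : v * fb = 0 := by linarith
    exact (mul_eq_zero.1 this).resolve_right gb.ne'
  have z3 : w = 0 := by
    have : w * fc = 0 := by linarith
    exact (mul_eq_zero.1 this).resolve_right gc.ne'
  rw [z1, z2, z3] at hs
  norm_num at hs

lemma hullsum {p a b c : Plane} (h : InHull p a b c) :
    dist a p + dist b p ≤ dist a c + dist b c := by
  obtain ⟨u, v, w, hu, hv, hw, hs, h0, h1⟩ := h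
  have hp : p = u • a + v • b + w • c := by
    ext i; fin_cases i
    · simpa using h0
    · simpa using h1
  have e1 : a - p = v • (a - b) + w • (a - c) := by
    rw [hp]
    obtain rfl : u = 1 - v - w := by linarith
    module
  have e2 : b - p = u • (b - a) + w • (b - c) := by
    rw [hp]
    obtain rfl : v = 1 - u - w := by linarith
    module
  have n1 : dist a p ≤ v * dist a b + w * dist a c := by
    rw [dist_eq_norm, e1]
    refine (norm_add_le _ _).trans ?_
    rw [norm_smul, norm_smul, Real.norm_of_nonneg hv, Real.norm_of_nonneg hw, dist_eq_norm,
      dist_eq_norm]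
  have n2 : dist b p ≤ u * dist a b + w * dist b c := by
    rw [dist_eq_norm, e2]
    refine (norm_add_le _ _).trans ?_
    rw [norm_smul, norm_smul, Real.norm_of_nonneg hu, Real.norm_of_nonneg hw, dist_comm a b,
      dist_eq_norm, dist_eq_norm]
  have tri := dist_triangle_right a b c
  have hu' : u + v = 1 - w := by linarith
  have hm := mul_le_mul_of_nonneg_left tri (add_nonneg hu hv)
  have : (u + v) * (dist a c + dist b c) = (1 - w) * (dist a c + dist b c) := by rw [hu']
  nlinarith

lemma mkhull (e : ℝ) (G s E D : Plane) (s1 : s 1 = 0) (E1 : E 1 = 0) (hGD : G 1 < D 1)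
    (D1 : D 1 < 0) (he : 0 < e * (E 0 - s 0)) (h1 : e * crs G s D ≤ 0) (h2 : 0 ≤ e * crs G E D) :
    InHull D G s E := by
  have hG : G 1 < 0 := by linarith
  have hene : e ≠ 0 := by rintro rfl; simp at he
  have hne : E 0 - s 0 ≠ 0 := by intro h; rw [h] at he; simp at he
  have hden : e * (E 0 - s 0) * G 1 < 0 := mul_neg_of_pos_of_neg he hG
  refine ⟨D 1 / G 1, -(e * crs G E D) / (e * (E 0 - s 0) * G 1),
    (e * crs G s D) / (e * (E 0 - s 0) * G 1), ?_, ?_, ?_, ?_, ?_, ?_⟩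
  · exact div_nonneg_of_nonpos D1.le hG.le
  · exact div_nonneg_of_nonpos (by linarith) hden.le
  · exact div_nonneg_of_nonpos h1 hden.le
  · have := hG.ne
    simp only [crs, s1, E1]
    field_simp
    ring
  · have := hG.ne
    simp only [crs, s1, E1]
    field_simp
    ring
  · have := hG.ne
    simp only [s1, E1]
    field_simp
    ring

lemma caseI {A B G D E s : Plane} (hh : InHull D G s E)
    (hAB : 1 ≤ dist A B) (hBG : 1 ≤ dist G B) (hGD : 1 ≤ dist G D) (hDE : 1 ≤ dist E D)
    (hBD : 1 ≤ dist B D) (hs : dist A s + dist s E < 2)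
    (hl : dist G B + dist B s < 1.135) : False := by
  have t1 := dist_triangle_right A B s
  have t2 := dist_triangle_right E B s
  have c1 := dist_comm s E
  have c2 := dist_comm s B
  have p1 : 0 ≤ dist B s := dist_nonneg
  have p2 : 0 ≤ dist E B := dist_nonneg
  have p3 : 0 ≤ dist G B := dist_nonneg
  refine hullcore (q := B) hh ?_ ?_ ?_
  · nlinarith
  · rw [c2]; nlinarith [sq_nonneg (dist s D)]
  · have : dist E B < 1.3 := by linarith
    nlinarith

set_option maxHeartbeats 1000000 in
lemma caseIII {A B G D E s : Plane} (hB : InHull B A G s) (hD : InHull D G s E)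
    (A0 : A 0 = 0) (A1 : A 1 = 0) (E1 : E 1 = 0) (s1 : s 1 = 0) (hs0 : 0 < s 0)
    (hsE : s 0 < E 0) (hE2 : E 0 < 2)
    (hAB : 1 ≤ dist A B) (hBG : 1 ≤ dist G B) (hGD : 1 ≤ dist G D) (hDE : 1 ≤ dist E D)
    (hBD : 1 ≤ dist B D) (hl : dist G s < 1.135) : False := by
  have dAs : dist A s = s 0 := by
    have := dsq A s
    rw [A0, A1, s1] at this
    have h : dist A s ^ 2 = s 0 ^ 2 := by rw [this]; ring
    exact (sq_eq_sq₀ dist_nonneg hs0.le).1 h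
  have dEs : dist E s = E 0 - s 0 := by
    have := dsq E s
    rw [E1, s1] at this
    have h : dist E s ^ 2 = (E 0 - s 0) ^ 2 := by rw [this]; ring
    exact (sq_eq_sq₀ dist_nonneg (by linarith)).1 h
  have hDEG : InHull D G E s := by
    obtain ⟨u, v, w, hu, hv, hw, h, h0, h1⟩ := hD
    exact ⟨u, w, v, hu, hw, hv, by linarith, by linarith, by linarith⟩
  have S1 := hullsum hB
  have S2 := hullsum hDEG
  rw [dAs] at S1
  rw [dEs] at S2
  have pl : 0 ≤ dist G s := dist_nonneg
  set m := E 0 - s 0 with hm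
  set l := dist G s with hldef
  set σ := s 0 with hσ
  have m1 : 0.865 < m := by linarith
  have m2 : m < 1.135 := by linarith
  have hGD2 : dist G D < 1.27 := by linarith
  have hEE : E 0 = σ + m := by rw [hm]; ring
  -- distance from s to D
  have hd : dist s D ^ 2 ≤ 0.29 := by
    obtain ⟨u, v, w, hu, hv, hw, h, h0, h1⟩ := hD
    have id : 2 * dist s D ^ 2 = u * (dist s D ^ 2 + l ^ 2 - dist G D ^ 2)
        + w * (dist s D ^ 2 + m ^ 2 - dist E D ^ 2) := by
      have hm2 : m ^ 2 = (E 0 - s 0) ^ 2 + (E 1 - s 1) ^ 2 := by rw [E1, s1, hm, hσ]; ring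
      rw [hm2, hldef, dsq, dsq, dsq, dsq, h0, h1]
      obtain rfl : v = 1 - u - w := by linarith
      ring
    have k1 : dist s D ^ 2 + l ^ 2 - dist G D ^ 2 ≤ dist s D ^ 2 + 0.29 := by nlinarith
    have k2 : dist s D ^ 2 + m ^ 2 - dist E D ^ 2 ≤ dist s D ^ 2 + 0.29 := by nlinarith
    have q1 := mul_le_mul_of_nonneg_left k1 hu
    have q2 := mul_le_mul_of_nonneg_left k2 hw
    have q3 : (u + w) * (dist s D ^ 2 + 0.29) ≤ 1 * (dist s D ^ 2 + 0.29) :=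
      mul_le_mul_of_nonneg_right (by linarith) (by positivity)
    linarith
  have hAD : dist A D ^ 2 < 2 := by
    have d1 := dsq A D
    have d2 := dsq s D
    have d3 := dsq E D
    rw [A0, A1] at d1
    rw [s1] at d2
    rw [E1, hEE] at d3
    rw [← hσ] at d2
    set d := dist s D ^ 2
    have d4 : 1 ≤ dist E D ^ 2 := by nlinarith
    have hd0 : 0 ≤ d := sq_nonneg _
    have e1 : 2 * m * (D 0 - σ) ≤ d + m ^ 2 - 1 := by
      have : dist E D ^ 2 = d + m ^ 2 - 2 * m * (D 0 - σ) := by rw [d3, d2]; ring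
      linarith
    have e2 : m * dist A D ^ 2 ≤ m * σ ^ 2 + σ * (d + m ^ 2 - 1) + m * d := by
      have : dist A D ^ 2 = σ ^ 2 + 2 * σ * (D 0 - σ) + d := by rw [d1, d2]; ring
      rw [this]
      have := mul_le_mul_of_nonneg_left e1 hs0.le
      linarith
    have e3 : m * σ ^ 2 + σ * (d + m ^ 2 - 1) + m * d < 2 * m := by
      have f1 : σ + m < 2 := by linarith
      have f2 : (m * σ) * (σ + m) ≤ (m * σ) * 2 :=
        mul_le_mul_of_nonneg_left f1.le (by positivity)
      have f3 : d * (σ + m) ≤ 0.29 * 2 :=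
        mul_le_mul hd f1.le (by linarith) (by norm_num)
      have f4 : σ * (2 * m - 1) ≤ (2 - m) * (2 * m - 1) :=
        mul_le_mul_of_nonneg_right (by linarith) (by linarith)
      nlinarith [sq_nonneg (m - 0.75)]
    by_contra! hcon
    have := mul_le_mul_of_nonneg_left hcon (by linarith : (0:ℝ) ≤ m)
    linarith
  have pGD : 0 ≤ dist G D := dist_nonneg
  refine hullcore (q := D) hB ?_ ?_ ?_
  · rw [dist_comm D B]; nlinarith
  · rw [dist_comm D B]; nlinarith
  · rw [dist_comm D B]; nlinarith [sq_nonneg (dist s B)]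

lemma geo_le {C : Set Plane} {p q : Plane} (h : segment ℝ p q ⊆ C) :
    geodesicDist C p q ≤ edist p q := by
  unfold geodesicDist
  refine iInf_le_of_le (fun t => AffineMap.lineMap p q t) ?_
  refine iInf_le_of_le (by fun_prop) ?_
  refine iInf_le_of_le (by simp) ?_
  refine iInf_le_of_le (by simp) ?_
  refine iInf_le_of_le ?_ ?_
  · intro t ht
    apply h
    rw [segment_eq_image_lineMap]
    exact ⟨t, ht, rfl⟩
  · have hl : LipschitzWith (nndist p q) (fun t : ℝ => (AffineMap.lineMap p q t : Plane)) :=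
      lipschitzWith_lineMap p q
    have h1 := (hl.lipschitzOnWith (s := univ)).comp_eVariationOn_le
      (f := fun t : ℝ => (AffineMap.lineMap p q t : Plane)) (g := (id : ℝ → ℝ)) (s := Icc 0 1)
      (mapsTo_univ _ _)
    have h2 := ((monotone_id.monotoneOn (Icc (0:ℝ) 1)).eVariationOn_eq
      (a := 0) (b := 1) (by simp) (by simp)).le
    simp only [inter_self, id, sub_zero, ENNReal.ofReal_one] at h2
    refine h1.trans ?_
    refine (mul_le_mul_right h2 _).trans ?_
    rw [mul_one, edist_nndist]

lemma geo_dist {C : Set Plane} {p q : Plane} (h : segment ℝ p q ⊆ C)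
    (h1 : 1 ≤ geodesicDist C p q) : 1 ≤ dist p q := by
  have := h1.trans (geo_le h)
  rw [edist_dist, ENNReal.one_le_ofReal] at this
  exact this

lemma core {C : Set Plane} {A B G D E : Plane} (hc : Cfg C 1 A B G D E)
    (hc' : Cfg C (-1) E D G B A) (A0 : A 0 = 0) (hE1 : 1 ≤ E 0) (hE2 : E 0 < 2)
    (hr : crs A B G < 0) (hr' : 0 < crs E D G)
    (gAB : 1 ≤ geodesicDist C A B) (gBG : 1 ≤ geodesicDist C G B)
    (gGD : 1 ≤ geodesicDist C G D) (gDE : 1 ≤ geodesicDist C E D)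
    (gBD : 1 ≤ geodesicDist C B D) (s : Plane) (hs : s ∈ segment ℝ A E) :
    ENNReal.ofReal (2 - Real.sqrt 3 / 2) ≤ geodesicDist C G s := by
  have A1 := hc.A1; have E1 := hc.E1; have B1 := hc.B1; have D1 := hc.D1; have G1 := hc.G1
  have hn1 := hc.notlow (by linarith)
  have hn2 := hc'.notlow (by linarith)
  have hGB : G 1 < B 1 := by
    by_contra! hle
    rcases le_total (B 1) (D 1) with h | h
    · exact hn1 ⟨hle, h⟩
    · exact hn2 ⟨h.trans hle, h⟩
  have hGD : G 1 < D 1 := by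
    by_contra! hle
    rcases le_total (B 1) (D 1) with h | h
    · exact hn1 ⟨h.trans hle, h⟩
    · exact hn2 ⟨hle, h⟩
  have ht : 0 < crs B G D := by
    have := hc.turn (by linarith) hGB hGD
    linarith
  -- angular order at G
  have trans3 : ∀ u v w : Plane, G 1 < u 1 → G 1 < v 1 → G 1 < w 1 → crs G u v ≤ 0 →
      crs G v w < 0 → crs G u w < 0 := by
    intro u v w hu hv hw h1 h2
    have id : (v 1 - G 1) * crs G u w = (u 1 - G 1) * crs G v w + (w 1 - G 1) * crs G u v := by
      unfold crs; ring
    have k1 := mul_neg_of_pos_of_neg (sub_pos.2 hu) h2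
    have k2 := mul_nonpos_of_nonneg_of_nonpos (sub_pos.2 hw).le h1
    by_contra! h
    have := mul_nonneg (sub_pos.2 hv).le h
    linarith
  have oAB : crs G A B < 0 := by
    have : crs G A B = crs A B G := by unfold crs; ring
    linarith
  have oBD : crs G B D < 0 := by
    have : crs G B D = - crs B G D := by unfold crs; ring
    linarith
  have oDE : crs G D E < 0 := by
    have : crs G D E = - crs E D G := by unfold crs; ring
    linarith
  have oBE : crs G B E < 0 := trans3 B D E hGB hGD (by linarith) oBD.le oDE
  have oAD : crs G A D < 0 := trans3 A B D (by linarith) hGB hGD oAB.le oBD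
  -- the diagonal
  have seg_sub : ∀ x y : Plane, segment ℝ x y ⊆ frontier C → segment ℝ x y ⊆ C :=
    fun x y h z hz => hc.fsub (h hz)
  have sAB : segment ℝ A B ⊆ C := fun z hz => hc.fsub ((hc.front z).2 (by simp [hz]))
  have sBG : segment ℝ G B ⊆ C := fun z hz => hc.fsub ((hc.front z).2 (by
    rw [segment_symm] at hz; simp [hz]))
  have sGD : segment ℝ G D ⊆ C := fun z hz => hc.fsub ((hc.front z).2 (by simp [hz]))
  have sDE : segment ℝ E D ⊆ C := fun z hz => hc.fsub ((hc.front z).2 (by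
    rw [segment_symm] at hz; simp [hz]))
  have hK : {p | 0 < 1 * crs B G p} ∩ {p | 0 < 1 * crs G D p} ∩ {p : Plane | p 1 < 0}
      ⊆ interior C := by
    apply dich
    · exact (((convex_left 1 B G).inter (convex_left 1 G D)).inter (convex_low 0)).isPreconnected
    · rintro z ⟨⟨z1, z2⟩, z3⟩ hzF
      simp only [mem_ofPred_eq] at z1 z2 z3
      have b1 : 1 * crs B G A ≤ 0 := by
        have : crs B G A = crs A B G := by unfold crs; ring
        linarith
      have b2 : 1 * crs B G B ≤ 0 := by simp [crs]
      have b3 : 1 * crs B G G ≤ 0 := by simp [crs, mul_comm]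
      have b4 : 1 * crs G D G ≤ 0 := by simp [crs]
      have b5 : 1 * crs G D D ≤ 0 := by simp [crs, mul_comm]
      rcases (hc.front z).1 hzF with hz | hz | hz | hz | hz
      · linarith [seg_crs_nonpos 1 B G A B z b1 b2 hz]
      · linarith [seg_crs_nonpos 1 B G B G z b2 b3 hz]
      · linarith [seg_crs_nonpos 1 G D G D z b4 b5 hz]
      · linarith [seg_crs_nonpos 1 G D D E z b5 (by linarith) hz]
      · linarith [seg_low 0 E A z E1.ge A1.ge hz]
    · have hO : IsOpen ({p | 0 < 1 * crs G D p} ∩ {p : Plane | p 1 < 0}) :=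
        (open_left 1 G D).inter (open_low 0)
      have hBO : B ∈ ({p | 0 < 1 * crs G D p} ∩ {p : Plane | p 1 < 0}) := by
        refine ⟨?_, B1⟩
        have : crs G D B = crs B G D := by unfold crs; ring
        simp only [mem_ofPred_eq]
        linarith
      obtain ⟨t, ⟨h1, h2⟩, t0⟩ := (((hc.zint (by linarith)).and
        (small hO hBO ((B - A) + (B - G)))).and self_mem_nhdsWithin).exists
      replace t0 : 0 < t := t0
      refine ⟨_, ⟨⟨?_, h2.1⟩, h2.2⟩, h1⟩
      have : 1 * crs B G (B + t • ((B - A) + (B - G))) = t * (-(crs A B G)) := by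
        simp [crs]; ring
      simp only [mem_ofPred_eq]
      rw [this]; exact mul_pos t0 (by linarith)
  have sBD : segment ℝ B D ⊆ C := by
    intro z hz
    have hz1 : z 1 < 0 := (convex_low 0).segment_subset B1 D1 hz
    obtain ⟨u, v, hu, hv, huv, rfl⟩ := hz
    rcases hu.eq_or_lt with h | hu
    · subst h
      obtain rfl : v = 1 := by linarith
      simpa using sGD (right_mem_segment ℝ G D)
    rcases hv.eq_or_lt with h | hv
    · subst h
      obtain rfl : u = 1 := by linarith
      simpa using sAB (right_mem_segment ℝ A B)
    apply interior_subset
    apply hK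
    refine ⟨⟨?_, ?_⟩, hz1⟩
    · have : 1 * crs B G (u • B + v • D) = v * crs B G D := by
        rw [crs_comb _ _ _ _ _ _ huv]; unfold crs; ring
      simp only [mem_ofPred_eq]
      rw [this]; positivity
    · have : 1 * crs G D (u • B + v • D) = u * crs B G D := by
        rw [crs_comb _ _ _ _ _ _ huv]; unfold crs; ring
      simp only [mem_ofPred_eq]
      rw [this]; positivity
  have lAB := geo_dist sAB gAB
  have lBG := geo_dist sBG gBG
  have lGD := geo_dist sGD gGD
  have lDE := geo_dist sDE gDE
  have lBD := geo_dist sBD gBD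
  have hKnum : 2 - Real.sqrt 3 / 2 < 1.135 := by
    have : (1.73:ℝ) < Real.sqrt 3 := Real.lt_sqrt_of_sq_lt (by norm_num)
    linarith
  -- the target point
  have s1 : s 1 = 0 :=
    le_antisymm (seg_upp 0 A E s A1.le E1.le hs) (seg_low 0 A E s A1.ge E1.ge hs)
  have s0 : 0 ≤ s 0 ∧ s 0 ≤ E 0 := by
    obtain ⟨u, v, hu, hv, huv, rfl⟩ := hs
    simp [A0]
    constructor
    · exact mul_nonneg hv (by linarith)
    · nlinarith
  have hsum : dist A s + dist s E < 2 := by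
    rw [dist_add_dist_of_mem_segment hs]
    have h1 : dist A E ^ 2 = E 0 ^ 2 := by rw [dsq, A0, A1, E1]; ring
    rw [(sq_eq_sq₀ dist_nonneg (by linarith)).1 h1]
    exact hE2
  have hsum' : dist E s + dist s A < 2 := by
    rw [dist_comm E, dist_comm s A]; linarith
  unfold geodesicDist
  refine le_iInf fun γ => le_iInf fun hγ => le_iInf fun h0 => le_iInf fun h1 => le_iInf fun hm => ?_
  have cBE : 0 < crs B G E := by
    have : crs B G E = - crs G B E := by unfold crs; ring
    linarith
  by_cases cI : crs B G s < 0
  · refine le_trans (ENNReal.ofReal_le_ofReal ?_)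
      (hc.path (by linarith) (by linarith) (by linarith) s (by linarith) γ hγ h0 h1 hm)
    by_contra! hlt
    have sE : s 0 < E 0 := by
      refine lt_of_le_of_ne s0.2 fun h => ?_
      have : crs B G s = crs B G E := by unfold crs; rw [h, s1, E1]
      linarith
    have osB : crs G s B < 0 := by
      have : crs G s B = crs B G s := by unfold crs; ring
      linarith
    have osD := trans3 s B D (by linarith) hGB hGD osB.le oBD
    have oED : crs G E D = - crs G D E := by unfold crs; ring
    exact caseI (mkhull 1 G s E D s1 E1 hGD D1 (by linarith) (by linarith) (by linarith))
      lAB lBG lGD lDE lBD hsum (by linarith)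
  by_cases cII : 0 < crs D G s
  · have e1 : crs D G B = - crs B G D := by unfold crs; ring
    have e2 : crs D G A = crs G A D := by unfold crs; ring
    refine le_trans (ENNReal.ofReal_le_ofReal ?_)
      (hc'.path (by linarith) (by linarith) (by linarith) s (by linarith) γ hγ h0 h1 hm)
    by_contra! hlt
    have sA : 0 < s 0 := by
      refine lt_of_le_of_ne s0.1 fun h => ?_
      have : crs D G s = crs D G A := by unfold crs; rw [← h, s1, A1, A0]
      linarith
    have oDs : crs G D s < 0 := by
      have : crs G D s = - crs D G s := by unfold crs; ring
      linarith
    have oBs := trans3 B D s hGB hGD (by linarith) oBD.le oDs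
    have osB : crs G s B = - crs G B s := by unfold crs; ring
    exact caseI (mkhull (-1) G s A B s1 A1 hGB B1 (by rw [A0]; linarith) (by linarith)
      (by linarith)) lDE lGD lBG lAB (by rw [dist_comm]; exact lBD) hsum' (by linarith)
  · push Not at cI cII
    have hd : ENNReal.ofReal (dist G s) ≤ eVariationOn γ (Icc 0 1) := by
      rw [← edist_dist]
      have := eVariationOn.edist_le γ (s := Icc 0 1) (x := 0) (y := 1) (by simp) (by simp)
      rwa [h0, h1] at this
    refine le_trans (ENNReal.ofReal_le_ofReal ?_) hd
    by_contra! hlt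
    have sA : 0 < s 0 := by
      refine lt_of_le_of_ne s0.1 fun h => ?_
      have e1 : crs B G s = crs G A B := by unfold crs; rw [← h, s1, A1, A0]; ring
      linarith
    have sE : s 0 < E 0 := by
      refine lt_of_le_of_ne s0.2 fun h => ?_
      have e1 : crs D G s = - crs G D E := by unfold crs; rw [h, s1, E1]; ring
      linarith
    have e1 : crs G s B = crs B G s := by unfold crs; ring
    have e2 : crs G s D = crs D G s := by unfold crs; ring
    have e3 : crs G E D = - crs G D E := by unfold crs; ring
    have H2 := mkhull 1 G s E D s1 E1 hGD D1 (by linarith) (by linarith) (by linarith)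
    have H1 := mkhull (-1) G s A B s1 A1 hGB B1 (by rw [A0]; linarith) (by linarith)
      (by linarith)
    have H1' : InHull B A G s := by
      obtain ⟨u, v, w, hu, hv, hw, h, h0, h1⟩ := H1
      exact ⟨w, u, v, hw, hu, hv, by linarith, by linarith, by linarith⟩
    exact caseIII H1' H2 A0 A1 E1 s1 sA sE hE2 lAB lBG lGD lDE lBD (by linarith)

/-- auxiliary claim (b).  In a simple pentagon
`Q = (v₁, v₂, v₃, v₄, v₅)` with `v₁ = (0,0)`, `v₅ = (x₅,0)`, `1 ≤ x₅ < 2`,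
with `v₂, v₃, v₄` in the open lower half-plane, `v₂` and `v₄` reflex, and
pairwise geodesic vertex distance at least `1`, the geodesic distance from
`v₃` to the segment `S = [v₁,v₅]` is at least `2 - √3/2`.
(Here `v₁, v₂, v₃, v₄, v₅` are `Q.vertex 0, 1, 2, 3, 4`.) -/
theorem geodesic_dist_v3_to_S (Q : SimplePolygon) (hn : Q.n = 5) (x5 : ℝ)
    (hx5 : 1 ≤ x5) (hx5' : x5 < 2)
    (hv1x : Q.vertex 0 0 = 0) (hv1y : Q.vertex 0 1 = 0)
    (hv5x : Q.vertex 4 0 = x5) (hv5y : Q.vertex 4 1 = 0)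
    (hv2 : Q.vertex 1 1 < 0) (hv3 : Q.vertex 2 1 < 0) (hv4 : Q.vertex 3 1 < 0)
    (hreflex2 : Q.IsReflexAt 1) (hreflex4 : Q.IsReflexAt 3)
    (hsep : ∀ i j : ZMod Q.n, i ≠ j →
      1 ≤ geodesicDist Q.carrier (Q.vertex i) (Q.vertex j)) :
    ENNReal.ofReal (2 - Real.sqrt 3 / 2) ≤
      ⨅ s ∈ segment ℝ (Q.vertex 0) (Q.vertex 4),
        geodesicDist Q.carrier (Q.vertex 2) s := by
  obtain ⟨n, h3, V, C, comp, conn, reg, fr, inj, adj, dis⟩ := Q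
  simp only at hn
  subst hn
  simp only [SimplePolygon.IsReflexAt] at *
  have front : ∀ z, z ∈ frontier C ↔ z ∈ segment ℝ (V 0) (V 1) ∨ z ∈ segment ℝ (V 1) (V 2) ∨
      z ∈ segment ℝ (V 2) (V 3) ∨ z ∈ segment ℝ (V 3) (V 4) ∨ z ∈ segment ℝ (V 4) (V 0) := by
    intro z
    rw [fr, mem_iUnion]
    constructor
    · rintro ⟨i, hi⟩
      fin_cases i
      · exact Or.inl hi
      · exact Or.inr (Or.inl hi)
      · exact Or.inr (Or.inr (Or.inl hi))
      · exact Or.inr (Or.inr (Or.inr (Or.inl hi)))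
      · exact Or.inr (Or.inr (Or.inr (Or.inr hi)))
    · rintro (h | h | h | h | h)
      · exact ⟨0, h⟩
      · exact ⟨1, h⟩
      · exact ⟨2, h⟩
      · exact ⟨3, h⟩
      · exact ⟨4, h⟩
  have d1 : Disjoint (segment ℝ (V 0) (V 1)) (segment ℝ (V 2) (V 3)) :=
    dis 0 2 (by decide) (by decide) (by decide)
  have d2 : Disjoint (segment ℝ (V 0) (V 1)) (segment ℝ (V 3) (V 4)) :=
    dis 0 3 (by decide) (by decide) (by decide)
  have d3 : Disjoint (segment ℝ (V 1) (V 2)) (segment ℝ (V 3) (V 4)) :=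
    dis 1 3 (by decide) (by decide) (by decide)
  have d4 : Disjoint (segment ℝ (V 1) (V 2)) (segment ℝ (V 4) (V 0)) :=
    dis 1 4 (by decide) (by decide) (by decide)
  have d5 : Disjoint (segment ℝ (V 2) (V 3)) (segment ℝ (V 4) (V 0)) :=
    dis 2 4 (by decide) (by decide) (by decide)
  have a1 : segment ℝ (V 0) (V 1) ∩ segment ℝ (V 1) (V 2) = {V 1} := adj 0
  have a3 : segment ℝ (V 2) (V 3) ∩ segment ℝ (V 3) (V 4) = {V 3} := adj 2
  have hc : Cfg C 1 (V 0) (V 1) (V 2) (V 3) (V 4) :=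
    ⟨comp, reg, front, hv1y, hv5y, hv2, hv3, hv4, by rw [hv5x, hv1x]; linarith, d1, d2, d3, d4⟩
  have hc' : Cfg C (-1) (V 4) (V 3) (V 2) (V 1) (V 0) := by
    refine ⟨comp, reg, ?_, hv5y, hv1y, hv4, hv3, hv2, by rw [hv5x, hv1x]; linarith, ?_, ?_, ?_, ?_⟩
    · intro z
      rw [front, segment_symm ℝ (V 4) (V 3), segment_symm ℝ (V 3) (V 2), segment_symm ℝ (V 2) (V 1),
        segment_symm ℝ (V 1) (V 0), segment_symm ℝ (V 0) (V 4)]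
      tauto
    · rw [segment_symm ℝ (V 4) (V 3), segment_symm ℝ (V 2) (V 1)]; exact d3.symm
    · rw [segment_symm ℝ (V 4) (V 3), segment_symm ℝ (V 1) (V 0)]; exact d2.symm
    · rw [segment_symm ℝ (V 3) (V 2), segment_symm ℝ (V 1) (V 0)]; exact d1.symm
    · rw [segment_symm ℝ (V 3) (V 2), segment_symm ℝ (V 0) (V 4)]; exact d5
  have r1 : 1 * crs (V 0) (V 1) (V 2) < 0 :=
    hc.reflex (inj.ne (by decide)) a1 hreflex2
  have r2 : (-1) * crs (V 4) (V 3) (V 2) < 0 := by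
    refine hc'.reflex (inj.ne (by decide)) ?_ ?_
    · rw [segment_symm ℝ (V 4) (V 3), segment_symm ℝ (V 3) (V 2), inter_comm]; exact a3
    · obtain ⟨δ, hδ, hr⟩ := hreflex4
      refine ⟨δ, hδ, fun a ha c hcc ha' hc' hda hdc => ?_⟩
      rw [segment_symm] at ha hcc
      rw [segment_symm]
      exact hr c hcc a ha hc' ha' hdc hda
  refine le_iInf fun s => le_iInf fun hs => ?_
  exact core hc hc' hv1x (by rw [hv5x]; exact hx5) (by rw [hv5x]; exact hx5') (by linarith)
    (by linarith) (hsep 0 1 (by decide)) (hsep 2 1 (by decide)) (hsep 2 3 (by decide))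
    (hsep 4 3 (by decide)) (hsep 1 3 (by decide)) s hs
end
end

section
/- For every positive integer m and every real K > 0, there exists a simple polygon P in the Euclidean plane such that: (i) some set of exactly two vertices of P guards P; and (ii) there exists a vertex guard set G of P with |G| ≥ m whose dispersion distance is greater than K times the dispersion distance of every vertex guard set of P consisting of exactly two vertices. In particular, an optimal solution of the Dispersive Art Gallery Problem may contain arbitrarily many guards even when two guards suffice to guard the polygon, and the ratio of dispersion distances can be arbitrarily large. -/
open Set Metric
open scoped ENNReal

noncomputable section

/-- The point with coordinates `(x, y)`. -/
def pt (x y : ℝ) : Plane := !₂[x, y]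

@[simp] lemma pt_zero (x y : ℝ) : pt x y 0 = x := rfl
@[simp] lemma pt_one (x y : ℝ) : pt x y 1 = y := rfl

lemma plane_ext {p q : Plane} (h0 : p 0 = q 0) (h1 : p 1 = q 1) : p = q := by
  ext i; fin_cases i
  · exact h0
  · exact h1

lemma mem_seg (p q z : Plane) : z ∈ segment ℝ p q ↔
    ∃ t : ℝ, 0 ≤ t ∧ t ≤ 1 ∧ z 0 = (1 - t) * p 0 + t * q 0 ∧ z 1 = (1 - t) * p 1 + t * q 1 := by
  rw [segment_eq_image]
  constructor
  · rintro ⟨t, ⟨h0, h1⟩, rfl⟩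
    exact ⟨t, h0, h1, by simp, by simp⟩
  · rintro ⟨t, h0, h1, e0, e1⟩
    exact ⟨t, ⟨h0, h1⟩, plane_ext (by simp [e0]) (by simp [e1])⟩

lemma mem_seg_graph {x₁ y₁ x₂ y₂ : ℝ} (h : x₁ < x₂) (z : Plane) :
    z ∈ segment ℝ (pt x₁ y₁) (pt x₂ y₂) ↔
      x₁ ≤ z 0 ∧ z 0 ≤ x₂ ∧ z 1 = y₁ + (y₂ - y₁) / (x₂ - x₁) * (z 0 - x₁) := by
  have hd : 0 < x₂ - x₁ := sub_pos.2 h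
  rw [mem_seg]
  simp only [pt_zero, pt_one]
  constructor
  · rintro ⟨t, h0, h1, e0, e1⟩
    refine ⟨by nlinarith, by nlinarith, ?_⟩
    have : z 0 - x₁ = t * (x₂ - x₁) := by rw [e0]; ring
    rw [this, e1]; field_simp; ring
  · rintro ⟨h0, h1, e⟩
    refine ⟨(z 0 - x₁) / (x₂ - x₁), div_nonneg (by linarith) hd.le, ?_, ?_, ?_⟩
    · rw [div_le_one hd]; linarith
    · field_simp; ring
    · rw [e]; field_simp; ring

/-- The region between the graphs of `g` and `f` over `[A, B]`. -/
def region (A B : ℝ) (f g : ℝ → ℝ) : Set Plane :=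
  {z | A ≤ z 0 ∧ z 0 ≤ B ∧ g (z 0) ≤ z 1 ∧ z 1 ≤ f (z 0)}

section regionLemmas

variable {A B : ℝ} {f g : ℝ → ℝ}

/-- Parametrisation of the region by a rectangle. -/
def regionMap (f g : ℝ → ℝ) (w : ℝ × ℝ) : Plane :=
  pt w.1 ((1 - w.2) * g w.1 + w.2 * f w.1)

lemma continuous_regionMap (hf : Continuous f) (hg : Continuous g) :
    Continuous (regionMap f g) := by
  unfold regionMap pt
  refine (PiLp.continuous_toLp 2 _).comp ?_
  refine continuous_pi fun i => ?_
  fin_cases i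
  · exact continuous_fst
  · show Continuous fun w : ℝ × ℝ => (1 - w.2) * g w.1 + w.2 * f w.1
    fun_prop

lemma region_eq_image (h : ∀ x ∈ Icc A B, g x ≤ f x) :
    region A B f g = regionMap f g '' (Icc A B ×ˢ Icc 0 1) := by
  ext z
  constructor
  · rintro ⟨h0, h1, h2, h3⟩
    rcases eq_or_lt_of_le (h2.trans h3) with e | l
    · refine ⟨(z 0, 0), ⟨⟨h0, h1⟩, by simp⟩, plane_ext (by simp [regionMap]) ?_⟩
      simp [regionMap]; linarith
    · have hd : 0 < f (z 0) - g (z 0) := sub_pos.2 l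
      refine ⟨(z 0, (z 1 - g (z 0)) / (f (z 0) - g (z 0))), ⟨⟨h0, h1⟩, ?_, ?_⟩,
        plane_ext (by simp [regionMap]) ?_⟩
      · exact div_nonneg (by linarith) hd.le
      · show _ / _ ≤ _
        rw [div_le_one hd]; linarith
      · simp only [regionMap, pt_one]
        field_simp; ring
  · rintro ⟨⟨x, t⟩, ⟨⟨h0, h1⟩, h2, h3⟩, rfl⟩
    have := h x ⟨h0, h1⟩
    simp only at h2 h3
    refine ⟨h0, h1, ?_, ?_⟩ <;> simp only [regionMap, pt_zero, pt_one] <;> nlinarith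

lemma isCompact_region (hf : Continuous f) (hg : Continuous g)
    (h : ∀ x ∈ Icc A B, g x ≤ f x) : IsCompact (region A B f g) := by
  rw [region_eq_image h]
  exact (isCompact_Icc.prod isCompact_Icc).image (continuous_regionMap hf hg)

lemma isConnected_region (hAB : A ≤ B) (hf : Continuous f) (hg : Continuous g)
    (h : ∀ x ∈ Icc A B, g x ≤ f x) : IsConnected (region A B f g) := by
  rw [region_eq_image h]
  exact ((isConnected_Icc hAB).prod (isConnected_Icc zero_le_one)).image _
    (continuous_regionMap hf hg).continuousOn

/-- The open region between the two graphs. -/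
def openRegion (A B : ℝ) (f g : ℝ → ℝ) : Set Plane :=
  {z | A < z 0 ∧ z 0 < B ∧ g (z 0) < z 1 ∧ z 1 < f (z 0)}

lemma isOpen_openRegion (hf : Continuous f) (hg : Continuous g) :
    IsOpen (openRegion A B f g) := by
  have c0 : Continuous fun z : Plane => z 0 := by fun_prop
  have c1 : Continuous fun z : Plane => z 1 := by fun_prop
  exact (isOpen_lt continuous_const c0).inter ((isOpen_lt c0 continuous_const).inter
    ((isOpen_lt (hg.comp c0) c1).inter (isOpen_lt c1 (hf.comp c0))))

lemma interior_region (hf : Continuous f) (hg : Continuous g)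
    (hA : f A = g A) (hB : f B = g B) :
    interior (region A B f g) = openRegion A B f g := by
  apply Subset.antisymm
  · intro z hz
    have hzr : z ∈ region A B f g := interior_subset hz
    have hcont : Continuous fun s : ℝ => pt (z 0) (z 1 + s) := by
      unfold pt
      refine (PiLp.continuous_toLp 2 _).comp (continuous_pi fun i => ?_)
      fin_cases i
      · exact continuous_const
      · show Continuous fun s : ℝ => z 1 + s
        fun_prop
    have hnhds : (fun s : ℝ => pt (z 0) (z 1 + s)) ⁻¹' (region A B f g) ∈ nhds (0 : ℝ) := by
      apply hcont.continuousAt.preimage_mem_nhds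
      have : pt (z 0) (z 1 + 0) = z := plane_ext (by simp) (by simp)
      rw [this]
      exact mem_interior_iff_mem_nhds.1 hz
    obtain ⟨ε, hε, hb⟩ := Metric.mem_nhds_iff.1 hnhds
    have h1 := hb (show ε / 2 ∈ Metric.ball (0 : ℝ) ε by
      simp [abs_of_pos hε]; linarith)
    have h2 := hb (show -(ε / 2) ∈ Metric.ball (0 : ℝ) ε by
      simp [abs_of_pos hε]; linarith)
    obtain ⟨-, -, -, h1⟩ := h1
    obtain ⟨-, -, h2, -⟩ := h2
    simp only [pt_zero, pt_one] at h1 h2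
    obtain ⟨a, b, -, -⟩ := hzr
    have hlt : g (z 0) < f (z 0) := by linarith
    refine ⟨lt_of_le_of_ne a ?_, lt_of_le_of_ne b ?_, by linarith, by linarith⟩
    · intro e; rw [← e] at hlt; linarith
    · intro e; rw [e] at hlt; linarith
  · refine interior_maximal ?_ (isOpen_openRegion hf hg)
    rintro z ⟨a, b, c, d⟩
    exact ⟨a.le, b.le, c.le, d.le⟩

lemma region_regular (hAB : A < B) (hf : Continuous f) (hg : Continuous g)
    (hA : f A = g A) (hB : f B = g B) (h : ∀ x ∈ Ioo A B, g x < f x) :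
    region A B f g = closure (interior (region A B f g)) := by
  have h' : ∀ x ∈ Icc A B, g x ≤ f x := by
    rintro x ⟨h0, h1⟩
    rcases eq_or_lt_of_le h0 with rfl | h0
    · exact hA.ge
    rcases eq_or_lt_of_le h1 with rfl | h1
    · exact hB.ge
    exact (h x ⟨h0, h1⟩).le
  apply Subset.antisymm
  · rw [interior_region hf hg hA hB, region_eq_image h']
    have : Icc A B ×ˢ Icc (0 : ℝ) 1 = closure (Ioo A B ×ˢ Ioo (0 : ℝ) 1) := by
      rw [closure_prod_eq, closure_Ioo hAB.ne, closure_Ioo zero_ne_one]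
    rw [this]
    refine (image_closure_subset_closure_image (continuous_regionMap hf hg)).trans
      (closure_mono ?_)
    rintro _ ⟨⟨x, t⟩, ⟨hx, h2, h3⟩, rfl⟩
    have := h x hx
    simp only at h2 h3
    refine ⟨hx.1, hx.2, ?_, ?_⟩ <;> simp only [regionMap, pt_zero, pt_one] <;> nlinarith
  · exact closure_minimal interior_subset (isCompact_region hf hg h').isClosed

lemma frontier_region (hf : Continuous f) (hg : Continuous g)
    (hA : f A = g A) (hB : f B = g B) (h : ∀ x ∈ Ioo A B, g x < f x) :
    frontier (region A B f g) =
      {z | A ≤ z 0 ∧ z 0 ≤ B ∧ (z 1 = f (z 0) ∨ z 1 = g (z 0))} := by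
  have h' : ∀ x ∈ Icc A B, g x ≤ f x := by
    rintro x ⟨h0, h1⟩
    rcases eq_or_lt_of_le h0 with rfl | h0
    · exact hA.ge
    rcases eq_or_lt_of_le h1 with rfl | h1
    · exact hB.ge
    exact (h x ⟨h0, h1⟩).le
  rw [(isCompact_region hf hg h').isClosed.frontier_eq, interior_region hf hg hA hB]
  ext z
  constructor
  · rintro ⟨⟨a, b, c, d⟩, hn⟩
    refine ⟨a, b, ?_⟩
    by_contra hcon
    push Not at hcon
    have c' := lt_of_le_of_ne c hcon.2.symm
    have d' := lt_of_le_of_ne d hcon.1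
    have hlt := c'.trans d'
    apply hn
    refine ⟨lt_of_le_of_ne a ?_, lt_of_le_of_ne b ?_, c', d'⟩
    · intro e; rw [← e] at hlt; linarith
    · intro e; rw [e] at hlt; linarith
  · rintro ⟨a, b, c⟩
    have := h' _ ⟨a, b⟩
    refine ⟨⟨a, b, ?_, ?_⟩, ?_⟩
    · rcases c with c | c <;> linarith
    · rcases c with c | c <;> linarith
    · rintro ⟨-, -, c', d'⟩
      rcases c with c | c <;> linarith

end regionLemmas

/-! ### Piecewise linear interpolation -/

/-- The piecewise linear function through the points `(X k, Y k)`, `k ≤ n`. -/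
def interp (X Y : ℕ → ℝ) (n : ℕ) (x : ℝ) : ℝ :=
  Y 0 + ∑ k ∈ Finset.range n,
    (Y (k + 1) - Y k) / (X (k + 1) - X k) * (max (X k) (min x (X (k + 1))) - X k)

lemma continuous_interp (X Y : ℕ → ℝ) (n : ℕ) : Continuous (interp X Y n) := by
  unfold interp
  fun_prop

lemma interp_succ (X Y : ℕ → ℝ) (n : ℕ) (x : ℝ) : interp X Y (n + 1) x = interp X Y n x +
    (Y (n + 1) - Y n) / (X (n + 1) - X n) * (max (X n) (min x (X (n + 1))) - X n) := by
  unfold interp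
  rw [Finset.sum_range_succ, add_assoc]

lemma interp_of_ge {X : ℕ → ℝ} (hX : StrictMono X) (Y : ℕ → ℝ) (n : ℕ) {x : ℝ} (hx : X n ≤ x) :
    interp X Y n x = Y n := by
  induction n with
  | zero => simp [interp]
  | succ n ih =>
    have hlt := hX (Nat.lt_succ_self n)
    have hd : X (n + 1) - X n ≠ 0 := (sub_pos.2 hlt).ne'
    rw [interp_succ, ih (hlt.le.trans hx), min_eq_right hx, max_eq_right hlt.le]
    field_simp; ring

lemma interp_of_le {X : ℕ → ℝ} (hX : StrictMono X) (Y : ℕ → ℝ) {k n : ℕ} (hkn : k ≤ n) {x : ℝ}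
    (hx : x ≤ X k) : interp X Y n x = interp X Y k x := by
  induction n, hkn using Nat.le_induction with
  | base => rfl
  | succ n hn ih =>
    have h1 : x ≤ X n := hx.trans (hX.monotone hn)
    rw [interp_succ, ih, max_eq_left ((min_le_left _ _).trans h1)]
    simp

lemma interp_eq {X : ℕ → ℝ} (hX : StrictMono X) (Y : ℕ → ℝ) {k n : ℕ} (hkn : k < n) {x : ℝ}
    (h0 : X k ≤ x) (h1 : x ≤ X (k + 1)) :
    interp X Y n x = Y k + (Y (k + 1) - Y k) / (X (k + 1) - X k) * (x - X k) := by
  rw [interp_of_le hX Y hkn h1, interp_succ, interp_of_ge hX Y k h0, min_eq_left h1,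
    max_eq_right h0]

lemma exists_piece {X : ℕ → ℝ} (n : ℕ) {x : ℝ} (hn : 0 < n) (h0 : X 0 ≤ x) (h1 : x ≤ X n) :
    ∃ k < n, X k ≤ x ∧ x ≤ X (k + 1) := by
  induction n with
  | zero => omega
  | succ n ih =>
    rcases Nat.eq_zero_or_pos n with rfl | hpos
    · exact ⟨0, by omega, h0, h1⟩
    rcases le_total x (X n) with h | h
    · obtain ⟨k, hk, h2⟩ := ih hpos h
      exact ⟨k, by omega, h2⟩
    · exact ⟨n, by omega, h, h1⟩

/-! ### Geodesic distance bounds -/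

lemma edist_le_geodesicDist (P : Set Plane) (p q : Plane) : edist p q ≤ geodesicDist P p q := by
  unfold geodesicDist
  refine le_iInf fun γ => le_iInf fun _ => le_iInf fun h0 => le_iInf fun h1 => le_iInf fun _ => ?_
  rw [← h0, ← h1]
  exact eVariationOn.edist_le _ (by simp) (by simp)

lemma ofReal_abs_sub_le_geodesicDist (P : Set Plane) (p q : Plane) :
    ENNReal.ofReal |p 0 - q 0| ≤ geodesicDist P p q := by
  refine le_trans ?_ (edist_le_geodesicDist P p q)
  rw [edist_dist]
  apply ENNReal.ofReal_le_ofReal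
  rw [dist_eq_norm]
  exact PiLp.norm_apply_le (p - q) 0

lemma geodesicDist_le_of_lipschitz (P : Set Plane) (p q : Plane) (C : NNReal) (γ : ℝ → Plane)
    (hγ : LipschitzWith C γ) (h0 : γ 0 = p) (h1 : γ 1 = q) (hm : MapsTo γ (Icc 0 1) P) :
    geodesicDist P p q ≤ C := by
  unfold geodesicDist
  refine (iInf_le_of_le γ <| iInf_le_of_le hγ.continuous.continuousOn <| iInf_le_of_le h0 <|
    iInf_le_of_le h1 <| iInf_le_of_le hm ?_)
  have := (hγ.lipschitzOnWith (s := univ)).comp_eVariationOn_le (g := fun x : ℝ => x)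
    (s := Icc (0 : ℝ) 1) (fun _ _ => mem_univ _)
  refine this.trans ?_
  have h2 : eVariationOn (fun x : ℝ => x) (Icc (0 : ℝ) 1) ≤ ENNReal.ofReal (1 - 0) := by
    have := (monotone_id (α := ℝ)).monotoneOn (Icc (0 : ℝ) 1) |>.eVariationOn_eq
      (a := 0) (b := 1) (by simp) (by simp)
    rw [Set.inter_self] at this
    exact this.le
  calc (C : ℝ≥0∞) * _ ≤ C * ENNReal.ofReal (1 - 0) := by gcongr
    _ = C := by simp

/-! ### The concrete polygon -/

/-- Abscissae of the upper chain. -/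
def cX (M : ℝ) (k : ℕ) : ℝ :=
  if k = 0 then -2 else if k % 2 = 1 then M ^ (k / 2) else M ^ (k / 2) / 2

/-- Ordinates of the upper chain. -/
def cY (M : ℝ) (N : ℕ) (k : ℕ) : ℝ :=
  if k = 0 ∨ k = 2 * N + 3 then 0 else if k % 2 = 1 then 4 else 2 * M

/-- The upper boundary function. -/
def cf (M : ℝ) (N : ℕ) : ℝ → ℝ := interp (cX M) (cY M N) (2 * N + 3)

/-- The lower boundary function. -/
def cg (x : ℝ) : ℝ := max 0 (min (x + 2) (-x))

/-- The vertices. -/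
def cW (M : ℝ) (N : ℕ) (k : ℕ) : Plane :=
  if k ≤ 2 * N + 3 then pt (cX M k) (cY M N k) else if k = 2 * N + 4 then pt 0 0 else pt (-1) 1

/-- The region. -/
def cP (M : ℝ) (N : ℕ) : Set Plane := region (-2) (M ^ (N + 1)) (cf M N) cg

lemma cX_zero (M : ℝ) : cX M 0 = -2 := by simp [cX]
lemma cX_odd (M : ℝ) (i : ℕ) : cX M (2 * i + 1) = M ^ i := by
  have h1 : (2 * i + 1) % 2 = 1 := by omega
  have h2 : (2 * i + 1) / 2 = i := by omega
  simp [cX, h1, h2]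
lemma cX_even (M : ℝ) (i : ℕ) : cX M (2 * i + 2) = M ^ (i + 1) / 2 := by
  have h1 : (2 * i + 2) % 2 = 0 := by omega
  have h2 : (2 * i + 2) / 2 = i + 1 := by omega
  simp [cX, h1, h2]
lemma cY_zero (M : ℝ) (N : ℕ) : cY M N 0 = 0 := by simp [cY]
lemma cY_last (M : ℝ) (N : ℕ) : cY M N (2 * N + 3) = 0 := by simp [cY]
lemma cY_odd (M : ℝ) {N i : ℕ} (h : i ≤ N) : cY M N (2 * i + 1) = 4 := by
  have h1 : (2 * i + 1) % 2 = 1 := by omega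
  have h2 : ¬ (2 * i + 1 = 2 * N + 3) := by omega
  simp only [cY, h1, h2]; simp
lemma cY_even (M : ℝ) (N i : ℕ) : cY M N (2 * i + 2) = 2 * M := by
  have h1 : (2 * i + 2) % 2 = 0 := by omega
  have h2 : ¬ (2 * i + 2 = 2 * N + 3) := by omega
  simp only [cY, h1, h2]; simp

section concrete

variable {M : ℝ} {N : ℕ}

lemma cX_strictMono (hM : 4 ≤ M) : StrictMono (cX M) := by
  refine strictMono_nat_of_lt_succ fun k => ?_
  rcases Nat.eq_zero_or_pos k with rfl | hk
  · rw [cX_zero, show 0 + 1 = 2 * 0 + 1 by rfl, cX_odd]; norm_num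
  rcases Nat.even_or_odd' k with ⟨i, rfl | rfl⟩
  · obtain ⟨i, rfl⟩ : ∃ j, i = j + 1 := ⟨i - 1, by omega⟩
    rw [cX_odd, show 2 * (i + 1) = 2 * i + 2 by ring, cX_even]
    have : 0 < M ^ (i + 1) := by positivity
    linarith
  · rw [cX_odd, cX_even, pow_succ]
    have : 0 < M ^ i := by positivity
    nlinarith

lemma cf_core (hM : 4 ≤ M) {x : ℝ} (h0 : -2 ≤ x) (h1 : x ≤ 1) : cf M N x = 4 / 3 * (x + 2) := by
  have e1 : cX M (0 + 1) = 1 := by simpa using cX_odd M 0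
  have e2 : cY M N (0 + 1) = 4 := by simpa using cY_odd M (Nat.zero_le N)
  unfold cf
  rw [interp_eq (cX_strictMono hM) _ (k := 0) (by omega) (by rw [cX_zero]; exact h0)
    (by rw [e1]; exact h1), e1, e2, cX_zero, cY_zero]
  ring

lemma cf_up (hM : 4 ≤ M) {i : ℕ} (hi : i ≤ N) {x : ℝ} (h0 : M ^ i ≤ x) (h1 : x ≤ M ^ (i + 1) / 2) :
    cf M N x = 4 / M ^ i * x := by
  unfold cf
  rw [interp_eq (cX_strictMono hM) _ (k := 2 * i + 1) (by omega) (by rw [cX_odd]; exact h0)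
    (by rw [cX_even]; exact h1), cX_odd, cX_even, cY_odd _ hi, cY_even]
  have hp : 0 < M ^ i := by positivity
  have hd : M ^ (i + 1) / 2 - M ^ i = M ^ i * ((M - 2) / 2) := by rw [pow_succ]; ring
  have hM2 : M - 2 ≠ 0 := by linarith
  rw [hd]
  field_simp
  ring

lemma cf_down (hM : 4 ≤ M) {i : ℕ} (hi : i ≤ N) {x : ℝ} (h0 : M ^ (i + 1) / 2 ≤ x)
    (h1 : x ≤ M ^ (i + 1)) :
    cf M N x = 2 * M + (cY M N (2 * i + 3) - 2 * M) / (M ^ (i + 1) / 2) *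
      (x - M ^ (i + 1) / 2) := by
  unfold cf
  have e : cX M (2 * i + 2 + 1) = M ^ (i + 1) := cX_odd M (i + 1)
  rw [interp_eq (cX_strictMono hM) _ (k := 2 * i + 2) (by omega) (by rw [cX_even]; exact h0)
    (by rw [e]; exact h1), e, cX_even, cY_even]
  congr 3; ring

lemma cY_next_nonneg (M : ℝ) {i : ℕ} (hi : i ≤ N) : 0 ≤ cY M N (2 * i + 3) := by
  rcases hi.eq_or_lt with rfl | h
  · rw [cY_last]
  · rw [show 2 * i + 3 = 2 * (i + 1) + 1 by ring, cY_odd M (by omega)]; norm_num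

lemma cY_next_le (M : ℝ) {i : ℕ} (hi : i ≤ N) : cY M N (2 * i + 3) ≤ 4 := by
  rcases hi.eq_or_lt with rfl | h
  · rw [cY_last]; norm_num
  · rw [show 2 * i + 3 = 2 * (i + 1) + 1 by ring, cY_odd M (by omega)]

/-- On a descending piece, `cf` is a convex combination. -/
lemma cf_down' (hM : 4 ≤ M) {i : ℕ} (hi : i ≤ N) {x : ℝ} (h0 : M ^ (i + 1) / 2 ≤ x)
    (h1 : x ≤ M ^ (i + 1)) : ∃ c : ℝ, 0 ≤ c ∧ c ≤ 1 ∧ x = (1 + c) * (M ^ (i + 1) / 2) ∧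
    cf M N x = (1 - c) * (2 * M) + c * cY M N (2 * i + 3) := by
  have hp : 0 < M ^ (i + 1) / 2 := by positivity
  refine ⟨(x - M ^ (i + 1) / 2) / (M ^ (i + 1) / 2), div_nonneg (by linarith) hp.le, ?_, ?_, ?_⟩
  · rw [div_le_one hp]; linarith
  · field_simp; ring
  · rw [cf_down hM hi h0 h1]
    field_simp; ring

lemma cases_x {x : ℝ} (h0 : -2 ≤ x) (h1 : x ≤ M ^ (N + 1)) :
    x ≤ 1 ∨ ∃ i ≤ N, (M ^ i ≤ x ∧ x ≤ M ^ (i + 1) / 2) ∨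
      (M ^ (i + 1) / 2 ≤ x ∧ x ≤ M ^ (i + 1)) := by
  obtain ⟨k, hk, h2, h3⟩ := exists_piece (X := cX M) (2 * N + 3) (x := x) (by omega)
    (by rw [cX_zero]; exact h0)
    (by rw [show 2 * N + 3 = 2 * (N + 1) + 1 by ring, cX_odd]; exact h1)
  rcases Nat.eq_zero_or_pos k with rfl | hk0
  · left
    have e1 : cX M (0 + 1) = 1 := by simpa using cX_odd M 0
    rwa [e1] at h3
  right
  rcases Nat.even_or_odd' k with ⟨i, rfl | rfl⟩
  · obtain ⟨i, rfl⟩ : ∃ j, i = j + 1 := ⟨i - 1, by omega⟩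
    rw [cX_odd] at h3
    rw [show 2 * (i + 1) = 2 * i + 2 by ring, cX_even] at h2
    exact ⟨i, by omega, Or.inr ⟨h2, h3⟩⟩
  · rw [cX_even] at h3
    rw [cX_odd] at h2
    exact ⟨i, by omega, Or.inl ⟨h2, h3⟩⟩

lemma one_le_powM (hM : 4 ≤ M) (i : ℕ) : 1 ≤ M ^ i := one_le_pow₀ (by linarith)

lemma cg_nonneg (x : ℝ) : 0 ≤ cg x := le_max_left _ _
lemma cg_pos {x : ℝ} (h : 0 ≤ x) : cg x = 0 := by
  unfold cg; rw [max_eq_left]; exact (min_le_right _ _).trans (by linarith)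
lemma cg_mid {x : ℝ} (h : -1 ≤ x) (h' : x ≤ 0) : cg x = -x := by
  unfold cg; rw [min_eq_right (by linarith), max_eq_right (by linarith)]
lemma cg_left {x : ℝ} (h : -2 ≤ x) (h' : x ≤ -1) : cg x = x + 2 := by
  unfold cg; rw [min_eq_left (by linarith), max_eq_right (by linarith)]

lemma continuous_cg : Continuous cg := by unfold cg; fun_prop
lemma continuous_cf : Continuous (cf M N) := continuous_interp _ _ _

lemma cg_lt_cf (hM : 4 ≤ M) {x : ℝ} (hx : x ∈ Ioo (-2) (M ^ (N + 1))) : cg x < cf M N x := by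
  obtain ⟨h0, h1⟩ := hx
  rcases cases_x h0.le h1.le with h | ⟨i, hi, ⟨a, b⟩ | ⟨a, b⟩⟩
  · rw [cf_core hM h0.le h]
    unfold cg
    rcases max_cases 0 (min (x + 2) (-x)) with ⟨e, -⟩ | ⟨e, -⟩ <;> rw [e]
    · linarith
    · exact (min_le_left _ _).trans_lt (by linarith)
  · have := one_le_powM hM i
    rw [cf_up hM hi a b, cg_pos (by linarith)]
    have : 0 < x := by linarith
    positivity
  · obtain ⟨c, c0, c1, hx, e⟩ := cf_down' hM hi a b
    have hp : 0 < M ^ (i + 1) := by positivity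
    rw [e, cg_pos (by linarith)]
    rcases hi.eq_or_lt with rfl | h
    · have : c < 1 := by
        by_contra hcon
        have : c = 1 := by linarith
        rw [this] at hx; linarith
      rw [cY_last]; nlinarith
    · rw [show 2 * i + 3 = 2 * (i + 1) + 1 by ring, cY_odd M (by omega)]; nlinarith

lemma cf_left (hM : 4 ≤ M) : cf M N (-2) = cg (-2) := by
  rw [cf_core hM le_rfl (by norm_num), cg_left le_rfl (by norm_num)]; norm_num

lemma cf_right (hM : 4 ≤ M) : cf M N (M ^ (N + 1)) = cg (M ^ (N + 1)) := by
  have hp : 0 < M ^ (N + 1) := by positivity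
  rw [cf_down hM le_rfl (by linarith) le_rfl, cg_pos hp.le, cY_last]
  field_simp; ring

lemma L_gt (hM : 4 ≤ M) : (0 : ℝ) < M ^ (N + 1) := by positivity

lemma cf_vertex (hM : 4 ≤ M) {k : ℕ} (hk : k ≤ 2 * N + 3) : cf M N (cX M k) = cY M N k := by
  unfold cf
  rw [interp_of_le (cX_strictMono hM) _ hk le_rfl, interp_of_ge (cX_strictMono hM) _ _ le_rfl]

/-! ### Edges -/

/-- The cyclic successor. -/
def cs (N k : ℕ) : ℕ := if k = 2 * N + 5 then 0 else k + 1

/-- Edges. -/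
def cE (M : ℝ) (N k : ℕ) : Set Plane := segment ℝ (cW M N k) (cW M N (cs N k))

lemma cX_last (M : ℝ) (N : ℕ) : cX M (2 * N + 3) = M ^ (N + 1) := cX_odd M (N + 1)

lemma mem_edge_up (hM : 4 ≤ M) {k : ℕ} (hk : k < 2 * N + 3) (z : Plane) :
    z ∈ cE M N k ↔ cX M k ≤ z 0 ∧ z 0 ≤ cX M (k + 1) ∧ z 1 = cf M N (z 0) := by
  have e : cs N k = k + 1 := by unfold cs; rw [if_neg (by omega)]
  have e1 : cW M N k = pt (cX M k) (cY M N k) := by unfold cW; rw [if_pos (by omega)]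
  have e2 : cW M N (k + 1) = pt (cX M (k + 1)) (cY M N (k + 1)) := by
    unfold cW; rw [if_pos (by omega)]
  unfold cE
  rw [e, e1, e2, mem_seg_graph (cX_strictMono hM (Nat.lt_succ_self k))]
  refine and_congr_right fun h0 => and_congr_right fun h1 => ?_
  unfold cf
  rw [interp_eq (cX_strictMono hM) _ hk h0 h1]

lemma cW_last (M : ℝ) (N : ℕ) : cW M N (2 * N + 3) = pt (M ^ (N + 1)) 0 := by
  unfold cW; rw [if_pos le_rfl, cX_last, cY_last]
lemma cW_a (M : ℝ) (N : ℕ) : cW M N (2 * N + 4) = pt 0 0 := by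
  unfold cW; rw [if_neg (by omega), if_pos rfl]
lemma cW_r (M : ℝ) (N : ℕ) : cW M N (2 * N + 5) = pt (-1) 1 := by
  unfold cW; rw [if_neg (by omega), if_neg (by omega)]
lemma cW_b (M : ℝ) (N : ℕ) : cW M N 0 = pt (-2) 0 := by
  unfold cW; rw [if_pos (by omega), cX_zero, cY_zero]

lemma mem_edge_p (hM : 4 ≤ M) (z : Plane) :
    z ∈ cE M N (2 * N + 3) ↔ 0 ≤ z 0 ∧ z 0 ≤ M ^ (N + 1) ∧ z 1 = cg (z 0) := by
  have e : cs N (2 * N + 3) = 2 * N + 4 := by unfold cs; rw [if_neg (by omega)]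
  unfold cE
  rw [e, cW_a, cW_last, segment_symm, mem_seg_graph (L_gt hM)]
  refine and_congr_right fun h0 => and_congr_right fun h1 => ?_
  rw [cg_pos h0]; simp

lemma mem_edge_p1 (z : Plane) :
    z ∈ cE M N (2 * N + 4) ↔ -1 ≤ z 0 ∧ z 0 ≤ 0 ∧ z 1 = cg (z 0) := by
  have e : cs N (2 * N + 4) = 2 * N + 5 := by unfold cs; rw [if_neg (by omega)]
  unfold cE
  rw [e, cW_a, cW_r, segment_symm, mem_seg_graph (by norm_num)]
  refine and_congr_right fun h0 => and_congr_right fun h1 => ?_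
  rw [cg_mid h0 h1]; ring_nf

lemma mem_edge_p2 (z : Plane) :
    z ∈ cE M N (2 * N + 5) ↔ -2 ≤ z 0 ∧ z 0 ≤ -1 ∧ z 1 = cg (z 0) := by
  have e : cs N (2 * N + 5) = 0 := by unfold cs; rw [if_pos rfl]
  unfold cE
  rw [e, cW_b, cW_r, segment_symm, mem_seg_graph (by norm_num)]
  refine and_congr_right fun h0 => and_congr_right fun h1 => ?_
  rw [cg_left h0 h1]; ring_nf

lemma eq_ends (hM : 4 ≤ M) {x : ℝ} (h0 : -2 ≤ x) (h1 : x ≤ M ^ (N + 1)) (e : cf M N x = cg x) :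
    x = -2 ∨ x = M ^ (N + 1) := by
  by_contra hcon
  push Not at hcon
  have := cg_lt_cf hM ⟨lt_of_le_of_ne h0 hcon.1.symm, lt_of_le_of_ne h1 hcon.2⟩
  linarith

lemma edges_disj_lt (hM : 4 ≤ M) {k l : ℕ} (hkl : k < l) (hl : l < 2 * N + 6)
    (h1 : cs N k ≠ l) (h2 : cs N l ≠ k) : Disjoint (cE M N k) (cE M N l) := by
  rw [Set.disjoint_left]
  intro z hz hz'
  have hL : (0 : ℝ) < M ^ (N + 1) := L_gt hM
  have hmono := cX_strictMono hM
  by_cases hk : k < 2 * N + 3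
  · rw [mem_edge_up hM hk] at hz
    obtain ⟨a, b, c⟩ := hz
    have hkr : k + 1 ≠ l := by
      unfold cs at h1; rwa [if_neg (by omega)] at h1
    by_cases hl' : l < 2 * N + 3
    · rw [mem_edge_up hM hl'] at hz'
      have := hmono (show k + 1 < l by omega)
      linarith [hz'.1]
    · have a' : -2 ≤ z 0 := by rw [← cX_zero M]; exact (hmono.monotone (Nat.zero_le k)).trans a
      have b' : z 0 ≤ M ^ (N + 1) := by
        rw [← cX_last]; exact b.trans (hmono.monotone (by omega))
      have hcase : ∀ c' : z 1 = cg (z 0), z 0 = -2 ∨ z 0 = M ^ (N + 1) :=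
        fun c' => eq_ends hM a' b' (c.symm.trans c')
      have hlast : z 0 = M ^ (N + 1) → k + 1 = 2 * N + 3 := by
        intro e
        by_contra hne
        have := hmono (show k + 1 < 2 * N + 3 by omega)
        rw [cX_last] at this; linarith
      have hfirst : z 0 = -2 → k = 0 := by
        intro e
        by_contra hne
        have := hmono (show 0 < k by omega)
        rw [cX_zero] at this; linarith
      obtain rfl | rfl | rfl : l = 2 * N + 3 ∨ l = 2 * N + 4 ∨ l = 2 * N + 5 := by omega
      · rw [mem_edge_p hM] at hz'
        rcases hcase hz'.2.2 with e | e
        · linarith [hz'.1]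
        · exact hkr (hlast e)
      · rw [mem_edge_p1] at hz'
        rcases hcase hz'.2.2 with e | e
        · linarith [hz'.1]
        · linarith [hz'.2.1]
      · rw [mem_edge_p2] at hz'
        rcases hcase hz'.2.2 with e | e
        · apply h2; rw [hfirst e]; simp [cs]
        · linarith [hz'.2.1]
  · obtain ⟨rfl, rfl⟩ : k = 2 * N + 3 ∧ l = 2 * N + 5 := by
      unfold cs at h1; rw [if_neg (by omega)] at h1; omega
    rw [mem_edge_p hM] at hz
    rw [mem_edge_p2] at hz'
    linarith [hz.1, hz'.2.1]

lemma edges_adj (hM : 4 ≤ M) {k : ℕ} (hk : k < 2 * N + 6) :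
    cE M N k ∩ cE M N (cs N k) = {cW M N (cs N k)} := by
  have hL : (0 : ℝ) < M ^ (N + 1) := L_gt hM
  have hmono := cX_strictMono hM
  apply Subset.antisymm
  · rintro z ⟨hz, hz'⟩
    rw [mem_singleton_iff]
    by_cases h1 : k < 2 * N + 3
    · have e : cs N k = k + 1 := by unfold cs; rw [if_neg (by omega)]
      rw [e] at hz' ⊢
      rw [mem_edge_up hM h1] at hz
      obtain ⟨a, b, c⟩ := hz
      by_cases h2 : k + 1 < 2 * N + 3
      · rw [mem_edge_up hM h2] at hz'
        have e0 : z 0 = cX M (k + 1) := le_antisymm b hz'.1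
        have e2 : cW M N (k + 1) = pt (cX M (k + 1)) (cY M N (k + 1)) := by
          unfold cW; rw [if_pos (by omega)]
        rw [e2]
        refine plane_ext e0 ?_
        rw [c, e0, cf_vertex hM (by omega)]; rfl
      · have e3 : k + 1 = 2 * N + 3 := by omega
        rw [e3] at hz' b ⊢
        rw [mem_edge_p hM] at hz'
        rcases eq_ends hM (by linarith [hz'.1]) hz'.2.1 (c.symm.trans hz'.2.2) with e | e
        · linarith [hz'.1]
        · rw [cW_last]
          refine plane_ext e ?_
          rw [hz'.2.2, cg_pos hz'.1]; rfl
    · obtain rfl | rfl | rfl : k = 2 * N + 3 ∨ k = 2 * N + 4 ∨ k = 2 * N + 5 := by omega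
      · have e : cs N (2 * N + 3) = 2 * N + 4 := by unfold cs; rw [if_neg (by omega)]
        rw [e] at hz' ⊢
        rw [mem_edge_p hM] at hz
        rw [mem_edge_p1] at hz'
        rw [cW_a]
        refine plane_ext (le_antisymm hz'.2.1 hz.1) ?_
        rw [hz.2.2, cg_pos hz.1]; rfl
      · have e : cs N (2 * N + 4) = 2 * N + 5 := by unfold cs; rw [if_neg (by omega)]
        rw [e] at hz' ⊢
        rw [mem_edge_p1] at hz
        rw [mem_edge_p2] at hz'
        have e0 : z 0 = -1 := le_antisymm hz'.2.1 hz.1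
        rw [cW_r]
        refine plane_ext e0 ?_
        rw [hz.2.2, e0, cg_mid le_rfl (by norm_num)]; simp
      · have e : cs N (2 * N + 5) = 0 := by unfold cs; rw [if_pos rfl]
        rw [e] at hz' ⊢
        rw [mem_edge_p2] at hz
        rw [mem_edge_up hM (by omega)] at hz'
        rcases eq_ends hM hz.1 (by linarith [hz.2.1]) (hz'.2.2.symm.trans hz.2.2) with e | e
        · rw [cW_b]
          refine plane_ext e ?_
          rw [hz.2.2, e, cg_left le_rfl (by norm_num)]; simp
        · linarith [hz.2.1]
  · rintro _ rfl
    exact ⟨right_mem_segment _ _ _, left_mem_segment _ _ _⟩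

lemma cW_injOn (hM : 4 ≤ M) {k l : ℕ} (hkl : k < l) (hl : l < 2 * N + 6) :
    cW M N k ≠ cW M N l := by
  intro h
  have hmono := cX_strictMono hM
  have h0 := congrArg (fun z : Plane => z 0) h
  have hone : ∀ j, 0 < j → 1 ≤ cX M j := by
    intro j hj
    have e1 : cX M 1 = 1 := by simpa using cX_odd M 0
    rw [← e1]
    exact hmono.monotone hj
  have hup : ∀ j, j ≤ 2 * N + 3 → cW M N j = pt (cX M j) (cY M N j) := by
    intro j hj; unfold cW; rw [if_pos hj]
  by_cases hl' : l ≤ 2 * N + 3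
  · rw [hup k (by omega), hup l hl'] at h0
    exact (hmono hkl).ne h0
  · by_cases hk : k ≤ 2 * N + 3
    · rw [hup k hk] at h0
      have h3 : cX M k = -2 ∨ 1 ≤ cX M k := by
        rcases Nat.eq_zero_or_pos k with rfl | hk
        · left; exact cX_zero M
        · right; exact hone k hk
      obtain rfl | rfl : l = 2 * N + 4 ∨ l = 2 * N + 5 := by omega
      · rw [cW_a] at h0; simp only [pt_zero] at h0; rcases h3 with h3 | h3 <;> linarith
      · rw [cW_r] at h0; simp only [pt_zero] at h0; rcases h3 with h3 | h3 <;> linarith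
    · obtain ⟨rfl, rfl⟩ : k = 2 * N + 4 ∧ l = 2 * N + 5 := by omega
      rw [cW_a, cW_r] at h0; norm_num at h0

lemma val_succ (i : ZMod (2 * N + 6)) : (i + 1).val = cs N i.val := by
  have h := ZMod.val_lt i
  have h1 : (1 : ZMod (2 * N + 6)).val = 1 := ZMod.val_one'' (by omega)
  rw [ZMod.val_add, h1]
  unfold cs
  split_ifs with h2
  · rw [h2]; exact Nat.mod_self _
  · exact Nat.mod_eq_of_lt (by omega)

lemma edge_eq (i : ZMod (2 * N + 6)) :
    segment ℝ (cW M N i.val) (cW M N (i + 1).val) = cE M N i.val := by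
  rw [val_succ]; rfl

lemma cfrontier (hM : 4 ≤ M) : frontier (cP M N) =
    ⋃ i : ZMod (2 * N + 6), segment ℝ (cW M N i.val) (cW M N (i + 1).val) := by
  have hL : (0 : ℝ) < M ^ (N + 1) := L_gt hM
  have hmono := cX_strictMono hM
  unfold cP
  rw [frontier_region continuous_cf continuous_cg (cf_left hM) (cf_right hM)
    (fun x hx => cg_lt_cf hM hx)]
  simp only [edge_eq]
  have hval : ∀ k, k < 2 * N + 6 → ∃ i : ZMod (2 * N + 6), i.val = k :=
    fun k hk => ⟨(k : ZMod (2 * N + 6)), ZMod.val_cast_of_lt hk⟩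
  ext z
  rw [mem_iUnion]
  constructor
  · rintro ⟨a, b, c | c⟩
    · obtain ⟨k, hk, h2, h3⟩ := exists_piece (X := cX M) (2 * N + 3) (x := z 0) (by omega)
        (by rw [cX_zero]; exact a) (by rw [cX_last]; exact b)
      obtain ⟨i, hi⟩ := hval k (by omega)
      exact ⟨i, by rw [hi, mem_edge_up hM hk]; exact ⟨h2, h3, c⟩⟩
    · rcases le_total 0 (z 0) with h | h
      · obtain ⟨i, hi⟩ := hval (2 * N + 3) (by omega)
        exact ⟨i, by rw [hi, mem_edge_p hM]; exact ⟨h, b, c⟩⟩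
      rcases le_total (-1) (z 0) with h' | h'
      · obtain ⟨i, hi⟩ := hval (2 * N + 4) (by omega)
        exact ⟨i, by rw [hi, mem_edge_p1]; exact ⟨h', h, c⟩⟩
      · obtain ⟨i, hi⟩ := hval (2 * N + 5) (by omega)
        exact ⟨i, by rw [hi, mem_edge_p2]; exact ⟨a, h', c⟩⟩
  · rintro ⟨i, hi⟩
    have hlt := ZMod.val_lt i
    generalize i.val = k at hi hlt
    by_cases hk : k < 2 * N + 3
    · rw [mem_edge_up hM hk] at hi
      refine ⟨?_, ?_, Or.inl hi.2.2⟩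
      · rw [← cX_zero M]; exact (hmono.monotone (Nat.zero_le k)).trans hi.1
      · rw [← cX_last]; exact hi.2.1.trans (hmono.monotone (by omega))
    · obtain rfl | rfl | rfl : k = 2 * N + 3 ∨ k = 2 * N + 4 ∨ k = 2 * N + 5 := by omega
      · rw [mem_edge_p hM] at hi
        exact ⟨by linarith [hi.1], hi.2.1, Or.inr hi.2.2⟩
      · rw [mem_edge_p1] at hi
        exact ⟨by linarith [hi.1], by linarith [hi.2.1], Or.inr hi.2.2⟩
      · rw [mem_edge_p2] at hi
        exact ⟨by linarith [hi.1], by linarith [hi.2.1], Or.inr hi.2.2⟩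

lemma cg_le_cf (hM : 4 ≤ M) : ∀ x ∈ Icc (-2) (M ^ (N + 1)), cg x ≤ cf M N x := by
  rintro x ⟨h0, h1⟩
  rcases eq_or_lt_of_le h0 with rfl | h0
  · exact (cf_left hM).ge
  rcases eq_or_lt_of_le h1 with rfl | h1
  · exact (cf_right hM).ge
  exact (cg_lt_cf hM ⟨h0, h1⟩).le

/-- The polygon. -/
def poly (M : ℝ) (N : ℕ) (hM : 4 ≤ M) : SimplePolygon where
  n := 2 * N + 6
  three_le := by omega
  vertex i := cW M N i.val
  carrier := cP M N
  isCompact := isCompact_region continuous_cf continuous_cg (cg_le_cf hM)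
  isConnected := isConnected_region (by linarith [L_gt (N := N) hM]) continuous_cf continuous_cg
    (cg_le_cf hM)
  regular := region_regular (by linarith [L_gt (N := N) hM]) continuous_cf continuous_cg
    (cf_left hM) (cf_right hM) (fun x hx => cg_lt_cf hM hx)
  frontier_eq := cfrontier hM
  vertex_injective := by
    intro i j h
    apply ZMod.val_injective (2 * N + 6)
    by_contra hne
    rcases Nat.lt_or_gt_of_ne hne with hl | hl
    · exact cW_injOn hM hl (ZMod.val_lt j) h
    · exact cW_injOn hM hl (ZMod.val_lt i) h.symm
  edges_adjacent i := by
    have e : i + 2 = i + 1 + 1 := by rw [add_assoc]; norm_num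
    rw [e, edge_eq, edge_eq, val_succ]
    exact edges_adj hM (ZMod.val_lt i)
  edges_disjoint i j h1 h2 h3 := by
    rw [edge_eq, edge_eq]
    have h1' : i.val ≠ j.val := fun h => h1 (ZMod.val_injective _ h)
    have h2' : cs N i.val ≠ j.val := by
      rw [← val_succ]; exact fun h => h2 (ZMod.val_injective _ h)
    have h3' : cs N j.val ≠ i.val := by
      rw [← val_succ]; exact fun h => h3 (ZMod.val_injective _ h)
    rcases Nat.lt_or_gt_of_ne h1' with hl | hl
    · exact edges_disj_lt hM hl (ZMod.val_lt j) h2' h3'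
    · exact (edges_disj_lt hM hl (ZMod.val_lt i) h3' h2').symm

/-! ### Visibility -/

lemma Sees.symm' {P : Set Plane} {p q : Plane} (h : Sees P p q) : Sees P q p := by
  unfold Sees at *; rwa [segment_symm]

lemma mem_cP {z : Plane} : z ∈ cP M N ↔
    -2 ≤ z 0 ∧ z 0 ≤ M ^ (N + 1) ∧ cg (z 0) ≤ z 1 ∧ z 1 ≤ cf M N (z 0) := Iff.rfl

lemma powM_le (hM : 4 ≤ M) {i j : ℕ} (h : i ≤ j) : M ^ i ≤ M ^ j :=
  pow_le_pow_right₀ (by linarith) h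

lemma cf_le_ray (hM : 4 ≤ M) {i : ℕ} (hi : i ≤ N) {x : ℝ} (h0 : M ^ i ≤ x)
    (h1 : x ≤ M ^ (i + 1)) : cf M N x ≤ 4 / M ^ i * x := by
  have hp : 0 < M ^ i := by positivity
  rcases le_total x (M ^ (i + 1) / 2) with h | h
  · rw [cf_up hM hi h0 h]
  · obtain ⟨c, c0, c1, hx, e⟩ := cf_down' hM hi h h1
    have h3 := cY_next_le M hi
    rw [e]
    have h4 : 2 * M ≤ 4 / M ^ i * x := by
      rw [div_mul_eq_mul_div, le_div_iff₀ hp]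
      rw [pow_succ] at h
      nlinarith
    nlinarith

/-- A tooth tip sees its whole slab. -/
lemma tip_sees (hM : 4 ≤ M) {i : ℕ} (hi : i ≤ N) {z : Plane} (hz : z ∈ cP M N)
    (h0 : M ^ i ≤ z 0) (h1 : z 0 ≤ M ^ (i + 1)) :
    Sees (cP M N) (pt (M ^ (i + 1) / 2) (2 * M)) z := by
  intro w hw
  rw [mem_seg] at hw
  obtain ⟨t, t0, t1, e0, e1⟩ := hw
  simp only [pt_zero, pt_one] at e0 e1
  obtain ⟨-, -, z2, z3⟩ := mem_cP.1 hz
  have hp : 0 < M ^ i := by positivity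
  have hq : M ^ (i + 1) = M ^ i * M := pow_succ _ _
  have hiN := powM_le hM (show i + 1 ≤ N + 1 by omega)
  have hone := one_le_powM hM i
  have hz1 : 0 ≤ z 1 := (cg_nonneg _).trans z2
  have u1 := z3.trans (cf_le_ray hM hi h0 h1)
  have hmid : M ^ i ≤ M ^ (i + 1) / 2 := by rw [hq]; nlinarith
  have hmid' : M ^ (i + 1) / 2 ≤ M ^ (i + 1) := by rw [hq]; nlinarith
  have w0 : M ^ i ≤ w 0 := by rw [e0]; nlinarith
  have w1 : w 0 ≤ M ^ (i + 1) := by rw [e0]; nlinarith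
  set σ := (cY M N (2 * i + 3) - 2 * M) / (M ^ (i + 1) / 2) with hσ
  have hσ0 : σ ≤ 0 := by
    apply div_nonpos_of_nonpos_of_nonneg
    · linarith [cY_next_le M hi]
    · positivity
  have u2 : z 1 ≤ 2 * M + σ * (z 0 - M ^ (i + 1) / 2) := by
    rcases le_total (z 0) (M ^ (i + 1) / 2) with h | h
    · have h5 : 4 / M ^ i * z 0 ≤ 2 * M := by
        rw [div_mul_eq_mul_div, div_le_iff₀ hp]; rw [hq] at h; nlinarith
      nlinarith
    · rw [cf_down hM hi h h1] at z3; exact z3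
  refine mem_cP.2 ⟨by linarith, by linarith, ?_, ?_⟩
  · rw [cg_pos (by linarith), e1]
    have : 0 ≤ (1 - t) * (2 * M) := mul_nonneg (by linarith) (by linarith)
    nlinarith
  · rcases le_total (w 0) (M ^ (i + 1) / 2) with h | h
    · rw [cf_up hM hi w0 h, e0, e1, hq]
      have : 4 / M ^ i * ((1 - t) * (M ^ i * M / 2) + t * z 0) =
        (1 - t) * (2 * M) + t * (4 / M ^ i * z 0) := by field_simp; ring
      rw [this]
      have := mul_le_mul_of_nonneg_left u1 t0
      linarith
    · rw [cf_down hM hi h w1, e0, e1]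
      have := mul_le_mul_of_nonneg_left u2 t0
      rw [← hσ]
      linarith

lemma ray_le_cf (hM : 4 ≤ M) {i : ℕ} (hi : i ≤ N) {x : ℝ} (h0 : 0 ≤ x)
    (h1 : x ≤ M ^ (i + 1) / 2) : 4 / M ^ i * x ≤ cf M N x := by
  have hp : 0 < M ^ i := by positivity
  have hone := one_le_powM hM i
  have hiN := powM_le hM (show i + 1 ≤ N + 1 by omega)
  have hp1 : 0 < M ^ (i + 1) := by positivity
  rcases cases_x (M := M) (N := N) (x := x) (by linarith) (by linarith) with
    h | ⟨j, hj, ⟨a, b⟩ | ⟨a, b⟩⟩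
  · rw [cf_core hM (by linarith) h]
    have : 4 / M ^ i ≤ 4 := by rw [div_le_iff₀ hp]; linarith
    nlinarith
  · have hji : j ≤ i := by
      by_contra hcon
      have := powM_le hM (show i + 1 ≤ j by omega)
      linarith
    rw [cf_up hM hj a b]
    have hpj : 0 < M ^ j := by positivity
    have := powM_le hM hji
    gcongr
  · rcases Nat.lt_or_ge j i with hji | hji
    · obtain ⟨c, c0, c1, hx, e⟩ := cf_down' hM hj a b
      rw [e, show 2 * j + 3 = 2 * (j + 1) + 1 by ring, cY_odd M (by omega)]
      have h5 := powM_le hM (show j + 1 ≤ i by omega)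
      have : 4 / M ^ i * x ≤ 4 := by
        rw [div_mul_eq_mul_div, div_le_iff₀ hp]; nlinarith
      nlinarith
    · have h5 := powM_le hM (show i + 1 ≤ j + 1 by omega)
      have hx : x = M ^ (j + 1) / 2 := by linarith
      have h6 : M ^ (i + 1) = M ^ (j + 1) := by linarith
      have hq : M ^ (j + 1) = M ^ j * M := pow_succ _ _
      have hpj : 0 < M ^ j := by positivity
      have h7 : M ^ i = M ^ j := by
        rw [pow_succ, pow_succ] at h6
        exact mul_right_cancel₀ (by linarith) h6
      rw [h7, hx, cf_down hM hj le_rfl (by linarith), hq, sub_self, mul_zero, add_zero]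
      apply le_of_eq
      field_simp; ring

/-- The vertex at the origin sees everything with nonnegative abscissa. -/
lemma origin_sees (hM : 4 ≤ M) {z : Plane} (hz : z ∈ cP M N) (h0 : 0 ≤ z 0) :
    Sees (cP M N) (pt 0 0) z := by
  intro w hw
  rw [mem_seg] at hw
  obtain ⟨t, t0, t1, e0, e1⟩ := hw
  simp only [pt_zero, pt_one, mul_zero, zero_add] at e0 e1
  obtain ⟨-, z1, z2, z3⟩ := mem_cP.1 hz
  have hz1 : 0 ≤ z 1 := (cg_nonneg _).trans z2
  have w0 : 0 ≤ w 0 := by rw [e0]; positivity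
  have w0' : w 0 ≤ z 0 := by rw [e0]; nlinarith
  refine mem_cP.2 ⟨by linarith, by linarith, ?_, ?_⟩
  · rw [cg_pos w0, e1]; positivity
  rcases cases_x (M := M) (N := N) (x := z 0) (by linarith) z1 with
    h | ⟨j, hj, ⟨a, b⟩ | ⟨a, b⟩⟩
  · rw [cf_core hM (by linarith) h] at z3
    rw [cf_core hM (by linarith) (by linarith), e1, e0]
    nlinarith
  · have h5 := ray_le_cf hM hj w0 (w0'.trans b)
    rw [cf_up hM hj a b] at z3
    have := mul_le_mul_of_nonneg_left z3 t0
    rw [e0] at h5 ⊢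
    rw [e1]; nlinarith
  · have hpj : 0 < M ^ j := by positivity
    have hq : M ^ (j + 1) = M ^ j * M := pow_succ _ _
    rcases le_total (w 0) (M ^ (j + 1) / 2) with h | h
    · have h5 := ray_le_cf hM hj w0 h
      have h6 := cf_le_ray hM hj (x := z 0) (by rw [hq] at a; nlinarith) b
      have := mul_le_mul_of_nonneg_left (z3.trans h6) t0
      rw [e0] at h5 ⊢
      rw [e1]; nlinarith
    · have hσ0 : (cY M N (2 * j + 3) - 2 * M) / (M ^ (j + 1) / 2) ≤ 0 := by
        apply div_nonpos_of_nonpos_of_nonneg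
        · linarith [cY_next_le M hj]
        · positivity
      rw [cf_down hM hj a b] at z3
      rw [cf_down hM hj h (w0'.trans b)]
      have : w 1 ≤ z 1 := by rw [e1]; nlinarith
      nlinarith

/-- The first upper vertex sees the core. -/
lemma v0_sees (hM : 4 ≤ M) {z : Plane} (hz : z ∈ cP M N) (h1 : z 0 ≤ 1) :
    Sees (cP M N) (pt 1 4) z := by
  intro w hw
  rw [mem_seg] at hw
  obtain ⟨t, t0, t1, e0, e1⟩ := hw
  simp only [pt_zero, pt_one] at e0 e1
  obtain ⟨z0, -, z2, z3⟩ := mem_cP.1 hz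
  have hz1 : 0 ≤ z 1 := (cg_nonneg _).trans z2
  have hone := one_le_powM hM (N + 1)
  have w0 : -2 ≤ w 0 := by rw [e0]; nlinarith
  have w0' : w 0 ≤ 1 := by rw [e0]; nlinarith
  rw [cf_core hM z0 h1] at z3
  refine mem_cP.2 ⟨w0, by linarith, ?_, ?_⟩
  · unfold cg
    apply max_le
    · rw [e1]; nlinarith
    · rcases le_total (-1) (z 0) with h | h
      · refine (min_le_right _ _).trans ?_
        have : -z 0 ≤ z 1 := by
          rcases le_total (z 0) 0 with h' | h'
          · rwa [cg_mid h h'] at z2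
          · linarith
        rw [e0, e1]; nlinarith
      · refine (min_le_left _ _).trans ?_
        rw [cg_left z0 h] at z2
        rw [e0, e1]; nlinarith
  · rw [cf_core hM w0 w0', e0, e1]; nlinarith

/-- Points above the ray are blocked by `v_i`. -/
lemma not_sees_tip (hM : 4 ≤ M) {i : ℕ} (hi : i ≤ N) {w : Plane} (h0 : w 0 < M ^ i)
    (h1 : 4 / M ^ i * w 0 < w 1) : ¬ Sees (cP M N) w (pt (M ^ (i + 1) / 2) (2 * M)) := by
  intro hs
  have hp : 0 < M ^ i := by positivity
  have hq : M ^ (i + 1) = M ^ i * M := pow_succ _ _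
  have hmid : M ^ i < M ^ (i + 1) / 2 := by rw [hq]; nlinarith
  have hd : 0 < M ^ (i + 1) / 2 - w 0 := by linarith
  set t := (M ^ i - w 0) / (M ^ (i + 1) / 2 - w 0) with ht
  have t0 : 0 < t := div_pos (by linarith) hd
  have t1 : t < 1 := by rw [ht, div_lt_one hd]; linarith
  have e0 : (1 - t) * w 0 + t * (M ^ (i + 1) / 2) = M ^ i := by
    have : t * (M ^ (i + 1) / 2 - w 0) = M ^ i - w 0 := div_mul_cancel₀ _ hd.ne'
    linear_combination this
  have hmem : pt (M ^ i) ((1 - t) * w 1 + t * (2 * M)) ∈ cP M N := by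
    apply hs
    rw [mem_seg]
    exact ⟨t, t0.le, t1.le, e0.symm, rfl⟩
  obtain ⟨-, -, -, h⟩ := mem_cP.1 hmem
  simp only [pt_zero, pt_one] at h
  rw [cf_up hM hi le_rfl hmid.le, div_mul_cancel₀ _ hp.ne'] at h
  have e2 : (1 - t) * (4 / M ^ i * w 0) + t * (2 * M) = 4 := by
    have : 2 * M = 4 / M ^ i * (M ^ (i + 1) / 2) := by rw [hq]; field_simp; ring
    rw [this]
    calc _ = 4 / M ^ i * ((1 - t) * w 0 + t * (M ^ (i + 1) / 2)) := by ring
      _ = 4 := by rw [e0]; field_simp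
  have := mul_lt_mul_of_pos_left h1 (show 0 < 1 - t by linarith)
  linarith

/-- Far points do not see the tip `t_1`. -/
lemma not_sees_tip_one (hM : 4 ≤ M) (hN : 3 ≤ N) {w : Plane} (h0 : M ^ 3 ≤ w 0)
    (h1 : 0 ≤ w 1) : ¬ Sees (cP M N) w (pt (M ^ (1 + 1) / 2) (2 * M)) := by
  intro hs
  have hM2 : 16 ≤ M ^ 2 := by nlinarith
  have hM3 : 4 * M ^ 2 ≤ M ^ 3 := by
    have : M ^ 3 = M * M ^ 2 := by ring
    rw [this]; nlinarith
  have hd : 0 < w 0 - M ^ (1 + 1) / 2 := by norm_num; linarith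
  set t := (w 0 - M ^ 2) / (w 0 - M ^ (1 + 1) / 2) with ht
  have t0 : 2 / 3 ≤ t := by
    rw [ht, le_div_iff₀ hd]; norm_num; linarith
  have t1 : t < 1 := by rw [ht, div_lt_one hd]; norm_num; linarith
  have e0 : (1 - t) * w 0 + t * (M ^ (1 + 1) / 2) = M ^ 2 := by
    have : t * (w 0 - M ^ (1 + 1) / 2) = w 0 - M ^ 2 := div_mul_cancel₀ _ hd.ne'
    linear_combination -this
  have hmem : pt (M ^ 2) ((1 - t) * w 1 + t * (2 * M)) ∈ cP M N := by
    apply hs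
    rw [mem_seg]
    exact ⟨t, by linarith, t1.le, e0.symm, rfl⟩
  obtain ⟨-, -, -, h⟩ := mem_cP.1 hmem
  simp only [pt_zero, pt_one] at h
  have hp : 0 < M ^ 2 := by positivity
  rw [cf_up hM (i := 2) (by omega) le_rfl (by norm_num; linarith), div_mul_cancel₀ _ hp.ne'] at h
  have : 0 ≤ (1 - t) * w 1 := mul_nonneg (by linarith) h1
  nlinarith

/-- Points below the line through `b` and `r` do not see `b`. -/
lemma not_sees_b {w : Plane} (h0 : -1 < w 0) (h1 : w 1 < w 0 + 2) :
    ¬ Sees (cP M N) w (pt (-2) 0) := by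
  intro hs
  have hd : 0 < w 0 + 2 := by linarith
  set t := (w 0 + 1) / (w 0 + 2) with ht
  have t0 : 0 < t := div_pos (by linarith) hd
  have t1 : t < 1 := by rw [ht, div_lt_one hd]; linarith
  have e0 : (1 - t) * w 0 + t * (-2) = -1 := by
    rw [ht]; field_simp; ring
  have hmem : pt (-1) ((1 - t) * w 1 + t * 0) ∈ cP M N := by
    apply hs
    rw [mem_seg]
    exact ⟨t, t0.le, t1.le, e0.symm, rfl⟩
  obtain ⟨-, -, h, -⟩ := mem_cP.1 hmem
  simp only [pt_zero, pt_one] at h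
  rw [cg_left (by norm_num) le_rfl] at h
  nlinarith

/-! ### Vertices -/

lemma cW_v (M : ℝ) {i : ℕ} (hi : i ≤ N) : cW M N (2 * i + 1) = pt (M ^ i) 4 := by
  unfold cW; rw [if_pos (by omega), cX_odd, cY_odd M hi]
lemma cW_t (M : ℝ) {i : ℕ} (hi : i ≤ N) : cW M N (2 * i + 2) = pt (M ^ (i + 1) / 2) (2 * M) := by
  unfold cW; rw [if_pos (by omega), cX_even, cY_even]

lemma vertex_cases (M : ℝ) {k : ℕ} (hk : k < 2 * N + 6) :
    cW M N k = pt (-2) 0 ∨ cW M N k = pt (-1) 1 ∨ cW M N k = pt 0 0 ∨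
    cW M N k = pt (M ^ (N + 1)) 0 ∨ (∃ i ≤ N, cW M N k = pt (M ^ i) 4) ∨
    (∃ i ≤ N, cW M N k = pt (M ^ (i + 1) / 2) (2 * M)) := by
  by_cases h0 : k = 0
  · subst h0; left; exact cW_b M N
  by_cases h1 : k = 2 * N + 5
  · subst h1; right; left; exact cW_r M N
  by_cases h2 : k = 2 * N + 4
  · subst h2; right; right; left; exact cW_a M N
  by_cases h3 : k = 2 * N + 3
  · subst h3; right; right; right; left; exact cW_last M N
  right; right; right; right
  rcases Nat.even_or_odd' k with ⟨i, rfl | rfl⟩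
  · right
    obtain ⟨i, rfl⟩ : ∃ j, i = j + 1 := ⟨i - 1, by omega⟩
    exact ⟨i, by omega, cW_t M (by omega)⟩
  · left
    exact ⟨i, by omega, cW_v M (by omega)⟩

lemma sees_b_cases (hM : 4 ≤ M) {k : ℕ} (hk : k < 2 * N + 6)
    (hs : Sees (cP M N) (cW M N k) (pt (-2) 0)) :
    cW M N k = pt (-2) 0 ∨ cW M N k = pt (-1) 1 ∨ cW M N k = pt 1 4 := by
  rcases vertex_cases M hk with h | h | h | h | ⟨i, hi, h⟩ | ⟨i, hi, h⟩
  · exact Or.inl h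
  · exact Or.inr (Or.inl h)
  · rw [h] at hs
    exact absurd hs (not_sees_b (by simp) (by simp))
  · rw [h] at hs
    have := one_le_powM hM (N + 1)
    exact absurd hs (not_sees_b (by rw [pt_zero]; linarith) (by rw [pt_zero, pt_one]; linarith))
  · rcases Nat.eq_zero_or_pos i with rfl | hpos
    · right; right; simpa using h
    · rw [h] at hs
      have := powM_le hM (show 1 ≤ i from hpos)
      rw [pow_one] at this
      exact absurd hs (not_sees_b (by rw [pt_zero]; linarith) (by rw [pt_zero, pt_one]; linarith))
  · rw [h] at hs
    rcases Nat.eq_zero_or_pos i with rfl | hpos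
    · exact absurd hs.symm' (not_sees_tip hM hi (by norm_num) (by norm_num))
    · have := powM_le hM (show 2 ≤ i + 1 by omega)
      exact absurd hs (not_sees_b (by rw [pt_zero]; nlinarith)
        (by rw [pt_zero, pt_one]; nlinarith [sq_pos_of_pos (show 0 < M - 2 by linarith)]))

lemma sees_tips_cases (hM : 4 ≤ M) (hN : 3 ≤ N) {k : ℕ} (hk : k < 2 * N + 6)
    (hs1 : Sees (cP M N) (cW M N k) (pt (M ^ (1 + 1) / 2) (2 * M)))
    (hs3 : Sees (cP M N) (cW M N k) (pt (M ^ (3 + 1) / 2) (2 * M))) :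
    cW M N k = pt 0 0 := by
  have hp : 0 < M ^ 3 := by positivity
  have key : ∀ x y : ℝ, 0 ≤ y → (x < 0 ∨ 4 ≤ y ∨ M ^ 3 ≤ x) → cW M N k ≠ pt x y := by
    intro x y hy hx h
    rw [h] at hs1 hs3
    rcases lt_or_ge x (M ^ 3) with h3 | h3
    · refine not_sees_tip hM hN (w := pt x y) h3 ?_ hs3
      rw [pt_zero, pt_one, div_mul_eq_mul_div, div_lt_iff₀ hp]
      rcases hx with hx | hx | hx
      · nlinarith
      · nlinarith
      · linarith
    · exact not_sees_tip_one hM hN (w := pt x y) h3 hy hs1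
  rcases vertex_cases M hk with h | h | h | h | ⟨i, hi, h⟩ | ⟨i, hi, h⟩
  · exact absurd h (key _ _ (by norm_num) (by norm_num))
  · exact absurd h (key _ _ (by norm_num) (by norm_num))
  · exact h
  · exact absurd h (key _ _ le_rfl (Or.inr (Or.inr (powM_le hM (by omega)))))
  · exact absurd h (key _ _ (by norm_num) (by norm_num))
  · exact absurd h (key _ _ (by linarith) (Or.inr (Or.inl (by linarith))))

lemma tip_mem (hM : 4 ≤ M) {i : ℕ} (hi : i ≤ N) : pt (M ^ (i + 1) / 2) (2 * M) ∈ cP M N := by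
  have hp : 0 < M ^ i := by positivity
  have hq : M ^ (i + 1) = M ^ i * M := pow_succ _ _
  have hmid : M ^ i ≤ M ^ (i + 1) / 2 := by rw [hq]; nlinarith
  have hiN := powM_le hM (show i + 1 ≤ N + 1 by omega)
  refine mem_cP.2 ⟨?_, ?_, ?_, ?_⟩ <;> simp only [pt_zero, pt_one]
  · linarith
  · linarith
  · rw [cg_pos (by linarith)]; linarith
  · rw [cf_up hM hi hmid le_rfl, hq]
    apply le_of_eq; field_simp; ring

lemma b_mem (hM : 4 ≤ M) : pt (-2) 0 ∈ cP M N := by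
  have := one_le_powM hM (N + 1)
  refine mem_cP.2 ⟨?_, ?_, ?_, ?_⟩ <;> simp only [pt_zero, pt_one]
  · linarith
  · linarith
  · rw [cg_left le_rfl (by norm_num)]; norm_num
  · rw [cf_core hM le_rfl (by norm_num)]; norm_num

lemma a_mem (hM : 4 ≤ M) : pt 0 0 ∈ cP M N := by
  have := one_le_powM hM (N + 1)
  refine mem_cP.2 ⟨?_, ?_, ?_, ?_⟩ <;> simp only [pt_zero, pt_one]
  · linarith
  · linarith
  · rw [cg_pos le_rfl]
  · rw [cf_core hM (by norm_num) (by norm_num)]; norm_num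

lemma v0_mem (hM : 4 ≤ M) : pt 1 4 ∈ cP M N := by
  have := one_le_powM hM (N + 1)
  refine mem_cP.2 ⟨?_, ?_, ?_, ?_⟩ <;> simp only [pt_zero, pt_one]
  · linarith
  · linarith
  · rw [cg_pos (by norm_num)]; norm_num
  · rw [cf_core hM (by norm_num) (by norm_num)]; norm_num

lemma mem_range_vertex (hM : 4 ≤ M) {k : ℕ} (hk : k < 2 * N + 6) :
    cW M N k ∈ Set.range (poly M N hM).vertex :=
  ⟨(k : ZMod (2 * N + 6)), congrArg (cW M N) (ZMod.val_cast_of_lt hk)⟩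

lemma exists_of_mem_range (hM : 4 ≤ M) {z : Plane} (hz : z ∈ Set.range (poly M N hM).vertex) :
    ∃ k < 2 * N + 6, z = cW M N k := by
  obtain ⟨i, rfl⟩ := hz
  exact ⟨ZMod.val (n := 2 * N + 6) i, ZMod.val_lt (n := 2 * N + 6) i, rfl⟩

/-! ### Short paths -/

lemma lipschitz_pt {C D : ℝ} {E : NNReal} (hE : C + D ≤ E) {u v : ℝ → ℝ}
    (hu : ∀ s t, |u s - u t| ≤ C * |s - t|) (hv : ∀ s t, |v s - v t| ≤ D * |s - t|) :
    LipschitzWith E (fun t => pt (u t) (v t)) := by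
  refine LipschitzWith.of_dist_le_mul fun s t => ?_
  rw [EuclideanSpace.dist_eq, Fin.sum_univ_two]
  simp only [pt_zero, pt_one]
  rw [Real.dist_eq, Real.dist_eq, Real.dist_eq]
  have h1 := hu s t
  have h2 := hv s t
  have h3 := abs_nonneg (u s - u t)
  have h4 := abs_nonneg (v s - v t)
  calc √(|u s - u t| ^ 2 + |v s - v t| ^ 2) ≤ |u s - u t| + |v s - v t| := by
        apply Real.sqrt_le_iff.2
        constructor
        · linarith
        · nlinarith
    _ ≤ (C + D) * |s - t| := by linarith
    _ ≤ E * |s - t| := by gcongr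

lemma cg_lip (x y : ℝ) : |cg x - cg y| ≤ |x - y| := by
  unfold cg
  rw [max_comm 0 (min (x + 2) (-x)), max_comm 0 (min (y + 2) (-y))]
  refine (abs_max_sub_max_le_abs (min (x + 2) (-x)) (min (y + 2) (-y)) 0).trans ?_
  refine (abs_min_sub_min_le_max _ _ _ _).trans ?_
  apply max_le
  · apply le_of_eq; congr 1; ring
  · rw [abs_sub_comm x y]; apply le_of_eq; congr 1; ring

lemma geod_floor (hM : 4 ≤ M) {c : ℝ} (h0 : 0 ≤ c) (h2 : c ≤ 2) :
    geodesicDist (cP M N) (pt (-c) (cg (-c))) (pt 0 0) ≤ (5 : NNReal) := by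
  have hL := L_gt (N := N) hM
  have hu : ∀ s t : ℝ, |(-c * (1 - s)) - (-c * (1 - t))| ≤ 2 * |s - t| := by
    intro s t
    rw [show (-c * (1 - s)) - (-c * (1 - t)) = c * (s - t) by ring, abs_mul, abs_of_nonneg h0]
    gcongr
  refine geodesicDist_le_of_lipschitz _ _ _ 5
    (fun t => pt (-c * (1 - t)) (cg (-c * (1 - t)))) (lipschitz_pt (C := 2) (D := 2)
      (by norm_num) hu (fun s t => (cg_lip _ _).trans (hu s t))) ?_ ?_ ?_
  · simp
  · simp [cg]
  · rintro t ⟨t0, t1⟩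
    have a1 : -2 ≤ -c * (1 - t) := by nlinarith
    have a2 : -c * (1 - t) ≤ M ^ (N + 1) := by nlinarith
    exact mem_cP.2 ⟨a1, a2, le_rfl, cg_le_cf hM _ ⟨a1, a2⟩⟩

lemma geod_v0 (hM : 4 ≤ M) : geodesicDist (cP M N) (pt 1 4) (pt 0 0) ≤ (5 : NNReal) := by
  have hu : ∀ s t : ℝ, |(1 - s) - (1 - t)| ≤ 1 * |s - t| := by
    intro s t
    rw [abs_sub_comm s t, one_mul]; apply le_of_eq; congr 1; ring
  have hv : ∀ s t : ℝ, |4 * (1 - s) - 4 * (1 - t)| ≤ 4 * |s - t| := by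
    intro s t
    rw [show 4 * (1 - s) - 4 * (1 - t) = 4 * (t - s) by ring, abs_mul, abs_sub_comm s t]
    norm_num
  refine geodesicDist_le_of_lipschitz _ _ _ 5
    (fun t => pt (1 - t) (4 * (1 - t))) (lipschitz_pt (C := 1) (D := 4)
      (by norm_num) hu hv) ?_ ?_ ?_
  · simp
  · simp
  · rintro t ⟨t0, t1⟩
    apply v0_sees (N := N) hM (a_mem hM) (by simp)
    rw [mem_seg]
    exact ⟨t, t0, t1, by simp, by simp; ring⟩

lemma two_guards_close (hM : 4 ≤ M) (hN : 3 ≤ N) {p q : Plane} (hpq : p ≠ q)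
    (hv : ({p, q} : Set Plane) ⊆ Set.range (poly M N hM).vertex)
    (hg : ∀ x ∈ cP M N, ∃ g ∈ ({p, q} : Set Plane), Sees (cP M N) g x)
    (hb : Sees (cP M N) p (pt (-2) 0)) :
    dispersionDist (cP M N) {p, q} ≤ (5 : NNReal) := by
  obtain ⟨k, hk, ek⟩ := exists_of_mem_range hM (hv (show p ∈ ({p, q} : Set Plane) by simp))
  obtain ⟨l, hl, el⟩ := exists_of_mem_range hM (hv (show q ∈ ({p, q} : Set Plane) by simp))
  have hpc : p = pt (-2) 0 ∨ p = pt (-1) 1 ∨ p = pt 1 4 := by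
    rw [ek] at hb ⊢; exact sees_b_cases hM hk hb
  have hnot : ∀ i, 0 < i → i ≤ N → ¬ Sees (cP M N) p (pt (M ^ (i + 1) / 2) (2 * M)) := by
    intro i hi0 hi
    have hp : 0 < M ^ i := by positivity
    have h4 := powM_le hM (show 1 ≤ i from hi0)
    rw [pow_one] at h4
    rcases hpc with rfl | rfl | rfl <;> refine not_sees_tip hM hi ?_ ?_ <;>
      simp only [pt_zero, pt_one] <;> try rw [div_mul_eq_mul_div, div_lt_iff₀ hp]
    all_goals linarith
  have hq : ∀ i, 0 < i → i ≤ N → Sees (cP M N) q (pt (M ^ (i + 1) / 2) (2 * M)) := by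
    intro i hi0 hi
    obtain ⟨g, hgm, hs⟩ := hg _ (tip_mem hM hi)
    rcases hgm with rfl | hgm
    · exact absurd hs (hnot i hi0 hi)
    · rw [mem_singleton_iff] at hgm; rwa [← hgm]
  have hqa : q = pt 0 0 := by
    have h1 := hq 1 (by omega) (by omega)
    have h3 := hq 3 (by omega) (by omega)
    rw [el] at h1 h3 ⊢
    exact sees_tips_cases hM hN hl h1 h3
  have hgeo : geodesicDist (cP M N) p q ≤ (5 : NNReal) := by
    rw [hqa]
    rcases hpc with rfl | rfl | rfl
    · have := geod_floor (N := N) hM (c := 2) (by norm_num) le_rfl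
      rwa [cg_left le_rfl (by norm_num), show (-2 : ℝ) + 2 = 0 by norm_num] at this
    · have := geod_floor (N := N) hM (c := 1) (by norm_num) (by norm_num)
      rwa [cg_left (by norm_num) le_rfl, show (-1 : ℝ) + 2 = 1 by norm_num] at this
    · exact geod_v0 hM
  refine le_trans ?_ hgeo
  unfold dispersionDist
  exact iInf_le_of_le p <| iInf_le_of_le (by simp) <| iInf_le_of_le q <|
    iInf_le_of_le (by simp) <| iInf_le_of_le hpq le_rfl

/-- The large guard set. -/
def bigG (M : ℝ) (N : ℕ) : Set Plane :=
  insert (pt 1 4) ((fun i : ℕ => pt (M ^ (i + 1) / 2) (2 * M)) '' Set.Iic N)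

lemma bigG_guard (hM : 4 ≤ M) : (poly M N hM).IsVertexGuardSet (bigG M N) := by
  refine ⟨?_, ?_, ?_⟩
  · rintro z (rfl | ⟨i, hi, rfl⟩)
    · have := mem_range_vertex (N := N) hM (k := 2 * 0 + 1) (by omega)
      rwa [cW_v M (Nat.zero_le N), pow_zero] at this
    · have hi : i ≤ N := hi
      have := mem_range_vertex (N := N) hM (k := 2 * i + 2) (by omega)
      rwa [cW_t M hi] at this
  · rintro z (rfl | ⟨i, hi, rfl⟩)
    · exact v0_mem hM
    · exact tip_mem hM hi
  · intro z (hz : z ∈ cP M N)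
    obtain ⟨z0, z1, -, -⟩ := mem_cP.1 hz
    rcases cases_x z0 z1 with h | ⟨i, hi, h⟩
    · exact ⟨_, Or.inl rfl, v0_sees hM hz h⟩
    · have hp : 0 < M ^ i := by positivity
      have hq : M ^ (i + 1) = M ^ i * M := pow_succ _ _
      have h' : M ^ i ≤ z 0 ∧ z 0 ≤ M ^ (i + 1) := by
        rcases h with h | h
        · exact ⟨h.1, by nlinarith [h.2]⟩
        · exact ⟨by nlinarith [h.1], h.2⟩
      exact ⟨_, Or.inr ⟨i, hi, rfl⟩, tip_sees hM hi hz h'.1 h'.2⟩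

lemma tip_gap (hM : 4 ≤ M) {i j : ℕ} (h : i < j) :
    M / 2 - 1 ≤ |M ^ (i + 1) / 2 - M ^ (j + 1) / 2| := by
  have h1 := powM_le hM (show i + 1 + 1 ≤ j + 1 by omega)
  have h2 := powM_le hM (show 1 ≤ i + 1 by omega)
  rw [pow_one] at h2
  rw [pow_succ _ (i + 1)] at h1
  rw [abs_sub_comm]
  refine le_trans ?_ (le_abs_self _)
  nlinarith

lemma v0_gap (hM : 4 ≤ M) (i : ℕ) : M / 2 - 1 ≤ |M ^ (i + 1) / 2 - 1| := by
  have h2 := powM_le hM (show 1 ≤ i + 1 by omega)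
  rw [pow_one] at h2
  refine le_trans ?_ (le_abs_self _)
  linarith

lemma bigG_disp (hM : 4 ≤ M) :
    ENNReal.ofReal (M / 2 - 1) ≤ dispersionDist (cP M N) (bigG M N) := by
  unfold dispersionDist
  refine le_iInf fun g => le_iInf fun hg => le_iInf fun h => le_iInf fun hh => le_iInf fun hne => ?_
  refine le_trans (ENNReal.ofReal_le_ofReal ?_) (ofReal_abs_sub_le_geodesicDist _ _ _)
  rcases hg with rfl | ⟨i, hi, rfl⟩ <;> rcases hh with rfl | ⟨j, hj, rfl⟩
  · exact absurd rfl hne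
  · simp only [pt_zero]; rw [abs_sub_comm]; exact v0_gap hM j
  · simp only [pt_zero]; exact v0_gap hM i
  · simp only [pt_zero]
    rcases lt_trichotomy i j with h | rfl | h
    · exact tip_gap hM h
    · exact absurd rfl hne
    · rw [abs_sub_comm]; exact tip_gap hM h

lemma bigG_card (hM : 4 ≤ M) : N + 1 ≤ (bigG M N).ncard := by
  have hinj : Function.Injective (fun i : ℕ => pt (M ^ (i + 1) / 2) (2 * M)) := by
    intro i j h
    have h0 := congrArg (fun z : Plane => z 0) h
    simp only [pt_zero] at h0
    by_contra hne
    rcases Nat.lt_or_gt_of_ne hne with h | h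
    · have := tip_gap hM h
      rw [h0, sub_self, abs_zero] at this; linarith
    · have := tip_gap hM h
      rw [h0, sub_self, abs_zero] at this; linarith
  have hfin : (bigG M N).Finite := ((Set.finite_Iic N).image _).insert _
  calc N + 1 = (Set.Iic N).ncard := by
        rw [← Finset.coe_Iic, Set.ncard_coe_finset, Nat.card_Iic]
    _ = ((fun i : ℕ => pt (M ^ (i + 1) / 2) (2 * M)) '' Set.Iic N).ncard :=
        (Set.ncard_image_of_injective _ hinj).symm
    _ ≤ _ := Set.ncard_le_ncard (Set.subset_insert _ _) hfin

lemma small_guard (hM : 4 ≤ M) : (poly M N hM).IsVertexGuardSet {pt 1 4, pt 0 0} := by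
  refine ⟨?_, ?_, ?_⟩
  · rintro z (rfl | rfl)
    · have := mem_range_vertex (N := N) hM (k := 2 * 0 + 1) (by omega)
      rwa [cW_v M (Nat.zero_le N), pow_zero] at this
    · have := mem_range_vertex (N := N) hM (k := 2 * N + 4) (by omega)
      rwa [cW_a] at this
  · rintro z (rfl | rfl)
    · exact v0_mem hM
    · exact a_mem hM
  · intro z (hz : z ∈ cP M N)
    rcases le_total (z 0) 1 with h | h
    · exact ⟨_, Or.inl rfl, v0_sees hM hz h⟩
    · exact ⟨_, Or.inr rfl, origin_sees hM hz (by linarith)⟩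

end concrete

/-- For every `m ≥ 1` and every `K > 0` there is a simple
polygon that can be guarded by two vertices, yet has a vertex guard set `G` of
at least `m` guards whose dispersion distance exceeds `K` times the dispersion
distance of every two-element vertex guard set. -/
theorem exists_polygon_many_guards_large_dispersion (m : ℕ) (hm : 0 < m)
    (K : ℝ) (hK : 0 < K) :
    ∃ P : SimplePolygon,
      (∃ G₂ : Set Plane, P.IsVertexGuardSet G₂ ∧ G₂.ncard = 2) ∧
      ∃ G : Set Plane, P.IsVertexGuardSet G ∧ m ≤ G.ncard ∧
        ∀ G' : Set Plane, P.IsVertexGuardSet G' → G'.ncard = 2 →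
          ENNReal.ofReal K * dispersionDist P.carrier G' <
            dispersionDist P.carrier G := by
  have hM : (4 : ℝ) ≤ 10 * K + 4 := by linarith
  refine ⟨poly (10 * K + 4) (m + 3) hM, ⟨_, small_guard hM, ?_⟩, bigG (10 * K + 4) (m + 3),
    bigG_guard hM, ?_, ?_⟩
  · apply Set.ncard_pair
    intro h
    have := congrArg (fun z : Plane => z 0) h
    simp at this
  · have := bigG_card (N := m + 3) hM
    omega
  · intro G' hG' hcard
    have hclose : dispersionDist (poly (10 * K + 4) (m + 3) hM).carrier G' ≤ (5 : NNReal) := by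
      obtain ⟨p, q, hpq, rfl⟩ := Set.ncard_eq_two.1 hcard
      obtain ⟨hv, -, hg⟩ := hG'
      obtain ⟨g, hgm, hs⟩ := hg _ (b_mem hM)
      rcases hgm with rfl | hgm
      · exact two_guards_close hM (by omega) hpq hv hg hs
      · rw [mem_singleton_iff] at hgm
        subst hgm
        rw [Set.pair_comm] at hv hg ⊢
        exact two_guards_close hM (by omega) hpq.symm hv hg hs
    calc ENNReal.ofReal K * dispersionDist (poly (10 * K + 4) (m + 3) hM).carrier G'
        ≤ ENNReal.ofReal K * (5 : NNReal) := by gcongr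
      _ = ENNReal.ofReal (K * 5) := by
          rw [ENNReal.ofReal_mul hK.le]; norm_num
      _ < ENNReal.ofReal ((10 * K + 4) / 2 - 1) := by
          rw [ENNReal.ofReal_lt_ofReal_iff (by linarith)]; linarith
      _ ≤ _ := bigG_disp hM
end
end
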